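/- Let s be a finite-dimensional complex semisimple Lie algebra which is disemisimple, i.e., s = s1 + s2 is the vector space sum of two semisimple Lie subalgebras s1 and s2. Then the subalgebra s1 ∩ s2 is either zero or a semisimple Lie algebra. -/

import Mathlib

section
namespace Dis

open Module LinearMap

section Weyl

variable {g : Type*} [LieRing g] [LieAlgebra ℂ g]
variable {M : Type*} [AddCommGroup M] [Module ℂ M]

/-- invariants of a representation -/
def rinv (ρ : g →ₗ[ℂ] Module.End ℂ M) : Submodule ℂ M := ⨅ x, LinearMap.ker (ρ x)

/-- the span of the images of all operators of a representation -/
def rimg (ρ : g →ₗ[ℂ] Module.End ℂ M) : Submodule ℂ M := ⨆ x, LinearMap.range (ρ x)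

lemma mem_rinv {ρ : g →ₗ[ℂ] Module.End ℂ M} {m : M} : m ∈ rinv ρ ↔ ∀ x, ρ x m = 0 := by
  simp [rinv]

lemma mem_rimg (ρ : g →ₗ[ℂ] Module.End ℂ M) (x : g) (m : M) : ρ x m ∈ rimg ρ :=
  Submodule.mem_iSup_of_mem x ⟨m, rfl⟩

lemma rimg_le {ρ : g →ₗ[ℂ] Module.End ℂ M} {N : Submodule ℂ M} (h : ∀ x m, ρ x m ∈ N) :
    rimg ρ ≤ N := by
  refine iSup_le fun x => ?_
  rintro _ ⟨m, rfl⟩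
  exact h x m

/-- a linear map to endomorphisms is a Lie algebra representation -/
def IsRep (ρ : g →ₗ[ℂ] Module.End ℂ M) : Prop := ∀ x y, ρ ⁅x, y⁆ = ρ x * ρ y - ρ y * ρ x

lemma IsRep.apply {ρ : g →ₗ[ℂ] Module.End ℂ M} (h : IsRep ρ) (x y : g) (m : M) :
    ρ ⁅x, y⁆ m = ρ x (ρ y m) - ρ y (ρ x m) := by
  rw [h]; rfl

/-- restriction of a representation to a stable subspace -/
def rrestr (ρ : g →ₗ[ℂ] Module.End ℂ M) (N : Submodule ℂ M) (hN : ∀ x, ∀ m ∈ N, ρ x m ∈ N) :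
    g →ₗ[ℂ] Module.End ℂ N where
  toFun x := (ρ x).restrict (hN x)
  map_add' x y := by ext; simp
  map_smul' x y := by ext; simp

lemma IsRep.restr {ρ : g →ₗ[ℂ] Module.End ℂ M} (h : IsRep ρ) (N : Submodule ℂ M)
    (hN : ∀ x, ∀ m ∈ N, ρ x m ∈ N) : IsRep (rrestr ρ N hN) := by
  intro x y
  ext m
  simp [rrestr, h.apply]

@[simp] lemma rrestr_apply (ρ : g →ₗ[ℂ] Module.End ℂ M) (N : Submodule ℂ M)
    (hN : ∀ x, ∀ m ∈ N, ρ x m ∈ N) (x : g) (m : N) : ((rrestr ρ N hN x m : N) : M) = ρ x m := rfl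

/-- An ideal acting faithfully with zero trace form is solvable. -/
lemma solvable_of_trace_zero [Module.Finite ℂ g] [Module.Finite ℂ M]
    {ρ : g →ₗ[ℂ] Module.End ℂ M} (hρ : IsRep ρ) (I : LieIdeal ℂ g)
    (hinj : ∀ x ∈ I, ρ x = 0 → x = 0)
    (htr : ∀ x ∈ I, ∀ y ∈ I, trace ℂ M (ρ x * ρ y) = 0) : LieAlgebra.IsSolvable I := by
  let _i1 : LieRingModule g M :=
    { bracket := fun x m => ρ x m
      add_lie := fun x y m => by simp
      lie_add := fun x m n => by simp
      leibniz_lie := fun x y m => by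
        change ρ x (ρ y m) = ρ ⁅x, y⁆ m + ρ y (ρ x m)
        rw [hρ.apply]; abel }
  have _i2 : LieModule ℂ g M :=
    { smul_lie := fun t x m => by change ρ (t • x) m = t • ρ x m; simp
      lie_smul := fun t x m => by change ρ x (t • m) = t • ρ x m; simp }
  have tf : LieModule.traceForm ℂ I M = 0 := by
    ext ⟨x, hx⟩ ⟨y, hy⟩
    exact htr x hx y hy
  have hnil : LieModule.IsNilpotent (LieAlgebra.derivedSeries ℂ I 1) M :=
    LieModule.isNilpotent_derivedSeries_of_traceForm_eq_zero tf
  have key : ∀ x, x ∈ LieAlgebra.derivedSeries ℂ I 1 → IsNilpotent (ρ x) := fun x hx =>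
    (LieModule.isNilpotent_iff_forall' (R := ℂ)).mp hnil ⟨x, hx⟩
  have ring_nilp : LieRing.IsNilpotent (LieAlgebra.derivedSeries ℂ I 1) := by
    rw [LieAlgebra.isNilpotent_iff_forall (R := ℂ)]
    rintro ⟨x, hx⟩
    have h1 : IsNilpotent (LinearMap.mulLeft ℂ (ρ x) - LinearMap.mulRight ℂ (ρ x)) := by
      refine (LinearMap.commute_mulLeft_right (R := ℂ) (ρ x) (ρ x)).isNilpotent_sub ?_ ?_
      · exact (LinearMap.isNilpotent_mulLeft_iff ℂ _).mpr (key x hx)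
      · exact (LinearMap.isNilpotent_mulRight_iff ℂ _).mpr (key x hx)
    obtain ⟨n, hn⟩ := h1
    refine ⟨n, ?_⟩
    have h2 : ∀ (n : ℕ) (y : LieAlgebra.derivedSeries ℂ I 1),
        ρ ((((LieAlgebra.ad ℂ (LieAlgebra.derivedSeries ℂ I 1) ⟨x, hx⟩) ^ n) y :
          LieAlgebra.derivedSeries ℂ I 1) : I) =
        ((LinearMap.mulLeft ℂ (ρ x) - LinearMap.mulRight ℂ (ρ x)) ^ n) (ρ (y : I)) := by
      intro n
      induction n with
      | zero => intro y; simp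
      | succ n ih =>
        intro y
        rw [pow_succ, pow_succ, Module.End.mul_apply, Module.End.mul_apply, ih]
        simp [hρ x _]
    ext y
    have h3 := h2 n y
    rw [hn] at h3
    have := hinj _ (((((LieAlgebra.ad ℂ (LieAlgebra.derivedSeries ℂ I 1) ⟨x, hx⟩) ^ n) y :
          LieAlgebra.derivedSeries ℂ I 1) : I)).2 (by simpa using h3)
    simpa using this
  obtain ⟨k, hk⟩ := LieAlgebra.IsSolvable.solvable ℂ (LieAlgebra.derivedSeries ℂ I 1)
  rw [LieIdeal.derivedSeries_eq_bot_iff] at hk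
  refine LieAlgebra.IsSolvable.mk (R := ℂ) (k := k + 1) ?_
  rw [LieAlgebra.derivedSeries_def, LieAlgebra.derivedSeriesOfIdeal_add]
  exact hk

/-- radical of the trace form as an ideal -/
def trRad (ρ : g →ₗ[ℂ] Module.End ℂ M) (hρ : IsRep ρ) : LieIdeal ℂ g where
  carrier := {x | ∀ y, trace ℂ M (ρ x * ρ y) = 0}
  zero_mem' := by simp
  add_mem' {x y} hx hy := by
    intro z; simp only [Set.mem_ofPred_eq] at hx hy; simp [add_mul, hx, hy]
  smul_mem' c x hx := by
    intro z; simp only [Set.mem_ofPred_eq] at hx; simp [hx]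
  lie_mem {x m} hm := by
    intro z
    have hm' : ∀ y, trace ℂ M (ρ m * ρ y) = 0 := hm
    have h := hm' ⁅z, x⁆
    rw [hρ, mul_sub, map_sub] at h
    rw [hρ, sub_mul, map_sub, ← h]
    have e1 : trace ℂ M (ρ x * ρ m * ρ z) = trace ℂ M (ρ m * (ρ z * ρ x)) := by
      rw [mul_assoc, LinearMap.trace_mul_comm, mul_assoc]
    rw [e1, mul_assoc]

lemma eq_bot_of_solvable [LieAlgebra.HasTrivialRadical ℂ g] (I : LieIdeal ℂ g)
    (h : LieAlgebra.IsSolvable I) : I = ⊥ := by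
  exact (LieAlgebra.hasTrivialRadical_iff_no_solvable_ideals ℂ g).mp inferInstance I h

lemma casimir_aux {J V : Type*} [AddCommGroup J] [Module ℂ J] [AddCommGroup V] [Module ℂ V]
    [Module.Finite ℂ J] (β : LinearMap.BilinForm ℂ J) (hβ : β.Nondegenerate)
    {ι : Type*} [Fintype ι] [DecidableEq ι] (b : Basis ι ℂ J) (A : J →ₗ[ℂ] J)
    (hA : ∀ x y, β (A x) y = - β x (A y)) (F : J →ₗ[ℂ] J →ₗ[ℂ] V) :
    ∑ i, (F (A (b i)) (β.dualBasis hβ b i) + F (b i) (A (β.dualBasis hβ b i))) = 0 := by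
  have h1 : ∀ x, x = ∑ j, β (β.dualBasis hβ b j) x • b j := by
    intro x
    conv_lhs => rw [← b.sum_repr x]
    refine Finset.sum_congr rfl fun j _ => ?_
    congr 1
    conv_rhs => rw [← b.sum_repr x]
    rw [map_sum]
    simp [LinearMap.BilinForm.apply_dualBasis_left, -Basis.sum_repr]
  have h2 : ∀ x, x = ∑ j, β x (b j) • (β.dualBasis hβ b j) := by
    intro x
    conv_lhs => rw [← (β.dualBasis hβ b).sum_repr x]
    simp [LinearMap.BilinForm.dualBasis_repr_apply]
  rw [Finset.sum_add_distrib]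
  have e1 : ∀ i, F (A (b i)) (β.dualBasis hβ b i) =
      ∑ j, β (β.dualBasis hβ b j) (A (b i)) • F (b j) (β.dualBasis hβ b i) := by
    intro i
    conv_lhs => rw [h1 (A (b i))]
    simp
  have e2 : ∀ i, F (b i) (A (β.dualBasis hβ b i)) =
      ∑ j, β (A (β.dualBasis hβ b i)) (b j) • F (b i) (β.dualBasis hβ b j) := by
    intro i
    conv_lhs => rw [h2 (A (β.dualBasis hβ b i))]
    simp
  simp_rw [e1, e2]
  rw [Finset.sum_comm, ← Finset.sum_add_distrib]
  refine Finset.sum_eq_zero fun j _ => ?_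
  rw [← Finset.sum_add_distrib]
  refine Finset.sum_eq_zero fun i _ => ?_
  rw [← add_smul, hA]; simp

lemma weyl_step [LieAlgebra.HasTrivialRadical ℂ g] [Module.Finite ℂ g] [Module.Finite ℂ M]
    (ρ : g →ₗ[ℂ] Module.End ℂ M) (hρ : IsRep ρ) (h0 : ρ ≠ 0) :
    ∃ Ω : Module.End ℂ M, (∀ x, Commute (ρ x) Ω) ∧ trace ℂ M Ω ≠ 0 ∧
      (∀ m, Ω m ∈ rimg ρ) ∧ (∀ m ∈ rinv ρ, Ω m = 0) := by
  classical
  let K : LieIdeal ℂ g :=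
    { LinearMap.ker ρ with
      lie_mem := by
        intro x m hm
        have hm' : ρ m = 0 := hm
        change ρ ⁅x, m⁆ = 0
        rw [hρ, hm']; simp }
  have hK : ∀ x, x ∈ K ↔ ρ x = 0 := fun x => Iff.rfl
  let J := LieIdeal.killingCompl ℂ g K
  have hc : IsCompl K J := LieIdeal.isCompl_killingCompl K
  have hJK : ∀ x ∈ J, ρ x = 0 → x = 0 := by
    intro x hx h
    have : x ∈ K ⊓ J := ⟨h, hx⟩
    rw [hc.inf_eq_bot] at this
    simpa using this
  have hN : J ⊓ trRad ρ hρ = ⊥ := by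
    apply eq_bot_of_solvable
    apply solvable_of_trace_zero hρ
    · intro x hx; exact hJK x hx.1
    · intro x hx y _; exact hx.2 y
  let β0 : LinearMap.BilinForm ℂ g := (LinearMap.mul ℂ (Module.End ℂ M)).compl₁₂ ρ ρ |>.compr₂ (trace ℂ M)
  have hβ0 : ∀ x y, β0 x y = trace ℂ M (ρ x * ρ y) := fun x y => rfl
  let β : LinearMap.BilinForm ℂ J := β0.restrict J.toSubmodule
  have hβ1 : ∀ x y : J, β x y = trace ℂ M (ρ x * ρ y) := fun x y => rfl
  have hsymm : β.IsSymm := ⟨fun x y => by simp only [hβ1]; rw [LinearMap.trace_mul_comm]⟩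
  have hβ : β.Nondegenerate := by
    refine (hsymm.isRefl.nondegenerate_iff_separatingLeft).mpr ?_
    intro x hx
    have : (x : g) ∈ J ⊓ trRad ρ hρ := by
      refine ⟨x.2, fun y => ?_⟩
      have hy : y ∈ K ⊔ J := by rw [hc.sup_eq_top]; trivial
      obtain ⟨a, ha, b, hb, rfl⟩ := (LieSubmodule.mem_sup _ _ _).mp hy
      have := hx ⟨b, hb⟩
      rw [hβ1] at this
      rw [map_add, (hK a).mp ha, zero_add]
      exact this
    rw [hN] at this
    exact Subtype.ext (by simpa using this)
  let b := Module.finBasis ℂ J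
  let b' := β.dualBasis hβ b
  let F : J →ₗ[ℂ] J →ₗ[ℂ] Module.End ℂ M :=
    (LinearMap.mul ℂ (Module.End ℂ M)).compl₁₂ (ρ ∘ₗ J.toSubmodule.subtype)
      (ρ ∘ₗ J.toSubmodule.subtype)
  have hF : ∀ x y, F x y = ρ x * ρ y := fun x y => rfl
  let Ω := ∑ i, F (b i) (b' i)
  refine ⟨Ω, ?_, ?_, ?_, ?_⟩
  · intro z
    let A : J →ₗ[ℂ] J := (LieModule.toEnd ℂ g J z)
    have hA' : ∀ x : J, ((A x : J) : g) = ⁅z, (x : g)⁆ := fun x => rfl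
    have hA : ∀ x y, β (A x) y = - β x (A y) := by
      intro x y
      rw [hβ1, hβ1, hA', hA', hρ, hρ, mul_sub, sub_mul, map_sub, map_sub]
      have e1 : trace ℂ M (ρ z * ρ x * ρ y) = trace ℂ M (ρ x * (ρ y * ρ z)) := by
        rw [mul_assoc, LinearMap.trace_mul_comm, mul_assoc]
      rw [e1, mul_assoc]; ring
    have := casimir_aux β hβ b A hA F
    have h2 : ρ z * Ω - Ω * ρ z = 0 := by
      rw [← this, Finset.mul_sum, Finset.sum_mul, ← Finset.sum_sub_distrib]
      refine Finset.sum_congr rfl fun i _ => ?_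
      rw [hF, hF, hF, hA', hA', hρ, hρ]
      simp only [b']
      noncomm_ring
    exact sub_eq_zero.mp h2
  · have h1 : trace ℂ M Ω = (finrank ℂ J : ℂ) := by
      simp only [Ω, map_sum]
      have : ∀ i, trace ℂ M (F (b i) (b' i)) = 1 := by
        intro i
        have := LinearMap.BilinForm.apply_dualBasis_right hβ hsymm b i i
        simp only [if_true] at this
        rw [← this]; rfl
      simp [this]
    rw [h1]
    intro h
    have h3 : finrank ℂ J = 0 := by exact_mod_cast h
    apply h0
    have hJ : J = ⊥ := by
      have : Subsingleton J := finrank_zero_iff.mp h3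
      rw [LieSubmodule.eq_bot_iff]
      intro x hx
      have := Subsingleton.elim (⟨x, hx⟩ : J) 0
      exact congrArg Subtype.val this
    have : K = ⊤ := by simpa [hJ] using hc.sup_eq_top
    ext1 x
    have : x ∈ K := by rw [this]; trivial
    exact this
  · intro m
    simp only [Ω, LinearMap.sum_apply]
    exact Submodule.sum_mem _ fun i _ => mem_rimg ρ _ _
  · intro m hm
    rw [mem_rinv] at hm
    simp only [Ω, LinearMap.sum_apply, hF]
    refine Finset.sum_eq_zero fun i _ => ?_
    simp [hm]

theorem weyl [LieAlgebra.HasTrivialRadical ℂ g] [Module.Finite ℂ g] :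
    ∀ (n : ℕ) {M : Type*} [AddCommGroup M] [Module ℂ M] [Module.Finite ℂ M]
    (ρ : g →ₗ[ℂ] Module.End ℂ M) (_ : IsRep ρ) (_ : finrank ℂ M = n),
    IsCompl (rinv ρ) (rimg ρ) := by
  intro n
  induction n using Nat.strong_induction_on with
  | _ n ih =>
  intro M _ _ _ ρ hρ hn
  by_cases h0 : ρ = 0
  · have e1 : rinv ρ = ⊤ := by
      rw [eq_top_iff]; intro m _; rw [mem_rinv]; simp [h0]
    have e2 : rimg ρ = ⊥ := by
      rw [eq_bot_iff]; exact rimg_le (by simp [h0])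
    rw [e1, e2]; exact isCompl_top_bot
  obtain ⟨Ω, hcomm, htr, himg, hinv⟩ := weyl_step ρ hρ h0
  obtain ⟨k, hk, hk1⟩ := (Ω.eventually_isCompl_ker_pow_range_pow.and
    (Filter.eventually_ge_atTop 1)).exists
  set N := LinearMap.ker (Ω ^ k) with hN
  have hNs : ∀ x, ∀ m ∈ N, ρ x m ∈ N := by
    intro x m hm
    rw [hN, LinearMap.mem_ker] at hm ⊢
    have := ((hcomm x).pow_right k).eq
    rw [← Module.End.mul_apply, ← this, Module.End.mul_apply, hm, map_zero]
  have hRs : ∀ x, ∀ m ∈ LinearMap.range (Ω ^ k), ρ x m ∈ LinearMap.range (Ω ^ k) := by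
    rintro x _ ⟨m, rfl⟩
    have := ((hcomm x).pow_right k).eq
    rw [← Module.End.mul_apply, this, Module.End.mul_apply]
    exact ⟨_, rfl⟩
  have hlt : finrank ℂ N < n := by
    rw [← hn]
    refine Submodule.finrank_lt ?_
    intro h
    apply htr
    have : IsNilpotent Ω := ⟨k, LinearMap.ker_eq_top.mp h⟩
    exact (LinearMap.isNilpotent_trace_of_isNilpotent this).eq_zero
  have ih' := ih _ hlt (rrestr ρ N hNs) (hρ.restr N hNs) rfl
  have f1 : (rinv (rrestr ρ N hNs)).map N.subtype ≤ rinv ρ := by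
    rintro _ ⟨m, hm, rfl⟩
    rw [mem_rinv]; intro x
    have := mem_rinv.mp hm x
    exact congrArg Subtype.val this
  have f2 : (rimg (rrestr ρ N hNs)).map N.subtype ≤ rimg ρ := by
    rw [Submodule.map_le_iff_le_comap]
    exact rimg_le fun x m => mem_rimg ρ x m
  constructor
  · rw [Submodule.disjoint_def]
    intro m hm1 hm2
    have hmN : m ∈ N := by
      rw [hN, LinearMap.mem_ker]
      obtain ⟨k, rfl⟩ : ∃ j, k = j + 1 := ⟨k - 1, by omega⟩
      rw [pow_succ, Module.End.mul_apply, hinv m hm1, map_zero]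
    have h3 : rimg ρ ≤ (rimg (rrestr ρ N hNs)).map N.subtype ⊔ LinearMap.range (Ω ^ k) := by
      refine rimg_le fun x m => ?_
      have hm : m ∈ N ⊔ LinearMap.range (Ω ^ k) := by rw [hk.sup_eq_top]; trivial
      obtain ⟨a, ha, b, hb, rfl⟩ := Submodule.mem_sup.mp hm
      rw [map_add]
      exact Submodule.add_mem_sup ⟨_, mem_rimg (rrestr ρ N hNs) x ⟨a, ha⟩, rfl⟩ (hRs x b hb)
    obtain ⟨a, ⟨a, ha, rfl⟩, r, hr, hsum⟩ := Submodule.mem_sup.mp (h3 hm2)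
    have hr0 : r = 0 := by
      have : r ∈ N := by
        have : r = m - a := by rw [← hsum]; simp
        rw [this]; exact N.sub_mem hmN a.2
      exact Submodule.disjoint_def.mp hk.disjoint r this hr
    have ham : (a : M) = m := by rw [← hsum, hr0]; simp
    have : a ∈ rinv (rrestr ρ N hNs) := by
      rw [mem_rinv]; intro x
      apply Subtype.ext
      rw [rrestr_apply, ham]; exact mem_rinv.mp hm1 x
    have := Submodule.disjoint_def.mp ih'.disjoint a this ha
    rw [← ham, this]; rfl
  · rw [codisjoint_iff, eq_top_iff, ← hk.sup_eq_top]
    refine sup_le ?_ ?_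
    · have : N = (⊤ : Submodule ℂ N).map N.subtype := by simp
      rw [this, ← ih'.sup_eq_top, Submodule.map_sup]
      exact sup_le_sup f1 f2
    · refine le_trans ?_ le_sup_right
      rintro _ ⟨m, rfl⟩
      obtain ⟨k, rfl⟩ : ∃ j, k = j + 1 := ⟨k - 1, by omega⟩
      rw [pow_succ', Module.End.mul_apply]
      exact himg _

/-- The projection onto the invariants. -/
theorem exists_pr [LieAlgebra.HasTrivialRadical ℂ g] [Module.Finite ℂ g] [Module.Finite ℂ M]
    (ρ : g →ₗ[ℂ] Module.End ℂ M) (hρ : IsRep ρ) :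
    ∃ p : Module.End ℂ M, (∀ x m, ρ x (p m) = 0) ∧ (∀ m, (∀ x, ρ x m = 0) → p m = m) ∧
      (∀ x m, p (ρ x m) = 0) ∧ (∀ m, m - p m ∈ rimg ρ) := by
  have h := weyl _ ρ hρ rfl
  refine ⟨(rinv ρ).projection (rimg ρ) h, ?_, ?_, ?_, ?_⟩
  · intro x m
    exact mem_rinv.mp (Submodule.projection_apply_mem h m) x
  · intro m hm
    exact Submodule.projection_apply_left h ⟨m, mem_rinv.mpr hm⟩
  · intro x m
    rw [Submodule.projection_apply_eq_zero_iff]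
    exact mem_rimg ρ x m
  · intro m
    rw [← Submodule.projection_apply_eq_zero_iff h, map_sub, sub_eq_zero]
    have := Submodule.projection_apply_left h ⟨_, Submodule.projection_apply_mem h m⟩
    exact this.symm

lemma isRep_ad : IsRep (LieAlgebra.ad ℂ g : g →ₗ[ℂ] Module.End ℂ g) := by
  intro x y
  ext z
  simp

lemma center_zero [LieAlgebra.HasTrivialRadical ℂ g] {x : g} (hx : ∀ y : g, ⁅y, x⁆ = 0) : x = 0 := by
  have : x ∈ LieAlgebra.center ℂ g := by
    rw [LieModule.mem_maxTrivSubmodule]; exact hx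
  rw [LieAlgebra.center_eq_bot] at this
  simpa using this

/-- semisimple Lie algebras are perfect -/
lemma perfect [LieAlgebra.HasTrivialRadical ℂ g] [Module.Finite ℂ g]
    {P : Submodule ℂ g} (h : ∀ x y : g, ⁅x, y⁆ ∈ P) : P = ⊤ := by
  have h1 := (weyl _ (LieAlgebra.ad ℂ g : g →ₗ[ℂ] Module.End ℂ g) isRep_ad rfl).sup_eq_top
  have h2 : rinv (LieAlgebra.ad ℂ g : g →ₗ[ℂ] Module.End ℂ g) = ⊥ := by
    rw [eq_bot_iff]
    intro x hx
    exact center_zero (mem_rinv.mp hx)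
  rw [h2, bot_sup_eq] at h1
  rw [eq_top_iff, ← h1]
  exact rimg_le fun x m => h x m

end Weyl
end Dis
end

section
open Module LieAlgebra

set_option linter.unusedSectionVars false
set_option linter.style.haveILetI false

namespace Dis

section lin
variable {V : Type*} [AddCommGroup V] [Module ℂ V] [Module.Finite ℂ V]

lemma dual_sep (N : Submodule ℂ V) (x : V) (hx : x ∉ N) :
    ∃ f : Module.Dual ℂ V, (∀ n ∈ N, f n = 0) ∧ f x ≠ 0 := by
  obtain ⟨f, hf, hN⟩ := Submodule.exists_dual_map_eq_bot_of_notMem hx inferInstance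
  refine ⟨f, fun n hn => ?_, hf⟩
  have := Submodule.mem_map_of_mem (f := f) hn
  rw [hN] at this; simpa using this

lemma nilp_of_trace (C : End ℂ V)
    (h : ∀ p : Polynomial ℂ, LinearMap.trace ℂ V (C * Polynomial.aeval C p) = 0) :
    IsNilpotent C := by
  obtain ⟨q, hq, hnd⟩ := Polynomial.exists_eq_pow_rootMultiplicity_mul_and_not_dvd
    (minpoly ℂ C) (minpoly.ne_zero (Algebra.IsIntegral.isIntegral C)) 0
  set j := Polynomial.rootMultiplicity 0 (minpoly ℂ C)
  rw [Polynomial.C_0, sub_zero] at hq hnd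
  have hcop : IsCoprime ((Polynomial.X : Polynomial ℂ) ^ (j+1)) q :=
    IsCoprime.pow_left ((Polynomial.irreducible_X).coprime_iff_not_dvd.2 hnd)
  obtain ⟨a, b, hab⟩ := hcop
  have hmin : Polynomial.aeval C (Polynomial.X ^ j * q) = 0 := by
    rw [← hq]; exact minpoly.aeval ℂ C
  set E := Polynomial.aeval C (a * Polynomial.X ^ (j+1)) with hE
  have hEE : IsIdempotentElem E := by
    have h1 : (a * Polynomial.X ^ (j+1)) * (a * Polynomial.X ^ (j+1)) =
        a * Polynomial.X ^ (j+1) - a * b * Polynomial.X * (Polynomial.X ^ j * q) := by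
      linear_combination (a * Polynomial.X ^ (j+1)) * hab
    unfold IsIdempotentElem
    rw [hE, ← map_mul, h1, map_sub, map_mul _ _ (_ * q), hmin, mul_zero, sub_zero]
  have hE0 : E = 0 := by
    refine (LinearMap.IsIdempotentElem.trace_eq_zero_iff hEE).1 ?_
    have h2 : E = C * Polynomial.aeval C (a * Polynomial.X ^ j) := by
      have h3 : a * Polynomial.X ^ (j+1) = Polynomial.X * (a * Polynomial.X ^ j) := by ring
      rw [hE, h3, map_mul _ Polynomial.X, Polynomial.aeval_X]
    rw [h2]; exact h _
  refine ⟨j, ?_⟩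
  have h3 : (Polynomial.X : Polynomial ℂ) ^ j =
      Polynomial.X ^ j * (a * Polynomial.X ^ (j+1)) + b * (Polynomial.X ^ j * q) := by
    linear_combination (-(Polynomial.X : Polynomial ℂ) ^ j) * hab
  have h4 := congrArg (Polynomial.aeval C) h3
  rw [map_add, map_mul, ← hE, hE0, map_mul, hmin, mul_zero, mul_zero, add_zero, map_pow,
    Polynomial.aeval_X] at h4
  exact h4

lemma trace_comm_zero (A Y Z : End ℂ V) (h : A * Z = Z * A) :
    LinearMap.trace ℂ V ((A * Y - Y * A) * Z) = 0 := by
  rw [sub_mul, map_sub, mul_assoc Y, h, ← mul_assoc Y, LinearMap.trace_mul_comm ℂ (Y * Z) A,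
    mul_assoc, sub_self]

lemma nilp_comm (A Y : End ℂ V) (h : A * (A * Y - Y * A) = (A * Y - Y * A) * A) :
    IsNilpotent (A * Y - Y * A) := by
  apply nilp_of_trace
  intro p
  apply trace_comm_zero
  have : Commute A (A * Y - Y * A) := h
  induction p using Polynomial.induction_on' with
  | add p q hp hq => simp only [map_add, mul_add, add_mul, hp, hq]
  | monomial n a =>
    rw [Polynomial.aeval_monomial]
    exact (Algebra.commute_algebraMap_right a A).mul_right (this.pow_right n)

/-- if `C = AY - YA` commutes with nilpotent `A`, then `AY` is nilpotent -/
lemma trace_mul_zero (A Y : End ℂ V) (hA : IsNilpotent A)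
    (h : A * (A * Y - Y * A) = (A * Y - Y * A) * A) :
    LinearMap.trace ℂ V (A * Y) = 0 := by
  set C := A * Y - Y * A with hC
  obtain ⟨N, hN⟩ := nilp_comm A Y h
  have hc : Commute A C := h
  have hYA : A * Y = Y * A + C := by rw [hC]; abel
  have hYA' : Y * A = A * Y - C := by rw [hC]; abel
  have h1 : ∀ i : ℕ, (A * Y) * A ^ i = A ^ (i+1) * Y - (i : ℂ) • (A ^ i * C) := by
    intro i
    induction i with
    | zero => simp
    | succ i ih =>
      rw [pow_succ A i, ← mul_assoc, ih, sub_mul, mul_assoc, hYA', mul_sub, smul_mul_assoc,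
        mul_assoc (A ^ i), ← h, ← mul_assoc, ← mul_assoc, ← pow_succ, ← pow_succ]
      push_cast
      module
  have h2 : ∀ i m : ℕ, ∃ Z : End ℂ V, (A * Y) ^ m * A ^ i =
      A ^ (i+1) * Z + ((-(i : ℂ)) ^ m) • (A ^ i * C ^ m) := by
    intro i m
    induction m with
    | zero => exact ⟨0, by simp⟩
    | succ m ih =>
      obtain ⟨Z, hZ⟩ := ih
      refine ⟨A * Y * Z - ((i+1 : ℕ) : ℂ) • (C * Z) +
        (-(i:ℂ))^m • (Y * C ^ m), ?_⟩
      rw [pow_succ' (A * Y), mul_assoc, hZ, mul_add, ← mul_assoc, h1, mul_smul_comm, ← mul_assoc,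
        h1, pow_succ' C, pow_succ A (i+1)]
      simp only [sub_mul, mul_add, mul_sub, smul_mul_assoc, mul_smul_comm, smul_sub, mul_assoc]
      rw [pow_succ (-(i:ℂ)) m]
      module
  have h3 : ∀ i : ℕ, ∃ m : ℕ, ∃ Z : End ℂ V, (A * Y) ^ m = A ^ i * Z := by
    intro i
    induction i with
    | zero => exact ⟨0, 1, by simp⟩
    | succ i ih =>
      obtain ⟨m, Z, hm⟩ := ih
      obtain ⟨Z', hZ'⟩ := h2 i N
      refine ⟨N + m, Z' * Z, ?_⟩
      rw [pow_add, hm, ← mul_assoc, hZ', hN, mul_zero, smul_zero, add_zero, mul_assoc]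
  obtain ⟨M, hM⟩ := hA
  obtain ⟨m, Z, hm⟩ := h3 M
  have : IsNilpotent (A * Y) := ⟨m, by rw [hm, hM, zero_mul]⟩
  exact (LinearMap.isNilpotent_trace_of_isNilpotent this).eq_zero

end lin

section lie
variable {L : Type*} [LieRing L] [LieAlgebra ℂ L] [Module.Finite ℂ L]

lemma ad_lie' (x y : L) : ad ℂ L ⁅x, y⁆ = ad ℂ L x * ad ℂ L y - ad ℂ L y * ad ℂ L x := isRep_ad x y

/-- exponentials of nilpotent elements -/
lemma exists_exp (c : L) (n : ℕ) (hn : (ad ℂ L c) ^ n = 0) :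
    ∃ g : ℂ → (L ≃ₗ⁅ℂ⁆ L), (∀ t v, g t v = ∑ k ∈ Finset.range n,
        (t ^ k / (k.factorial : ℂ)) • ((ad ℂ L c) ^ k) v) ∧
      (∀ t v, (g t).symm v = ∑ k ∈ Finset.range n,
        ((-t) ^ k / (k.factorial : ℂ)) • ((ad ℂ L c) ^ k) v) := by
  letI : Module ℚ L := Module.compHom L (algebraMap ℚ ℂ)
  haveI : IsScalarTower ℚ ℂ L := ⟨fun a b v => by
    change (a • b) • v = (algebraMap ℚ ℂ a) • (b • v)
    rw [smul_smul, Algebra.smul_def]⟩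
  have hls : ∀ (a : ℚ) (x y : L), ⁅x, a • y⁆ = a • ⁅x, y⁆ := fun a x y => by
    change ⁅x, (algebraMap ℚ ℂ a) • y⁆ = (algebraMap ℚ ℂ a) • ⁅x, y⁆
    rw [lie_smul]
  letI : LieAlgebra ℚ L := { lie_smul := hls }
  have hD : ∀ t : ℂ, (t • LieDerivation.ad ℂ L c).toLinearMap = t • ad ℂ L c := by
    intro t; ext v; simp
  have hpow : ∀ t : ℂ, (t • ad ℂ L c) ^ n = 0 := fun t => by rw [smul_pow, hn, smul_zero]
  have hnil : ∀ t : ℂ, IsNilpotent (t • LieDerivation.ad ℂ L c).toLinearMap := fun t =>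
    ⟨n, by rw [hD, hpow]⟩
  have key : ∀ (t : ℂ) (v : L), IsNilpotent.exp (t • ad ℂ L c) v = ∑ k ∈ Finset.range n,
        (t ^ k / (k.factorial : ℂ)) • ((ad ℂ L c) ^ k) v := by
    intro t v
    rw [IsNilpotent.exp_eq_sum (hpow t), LinearMap.sum_apply]
    refine Finset.sum_congr rfl fun k _ => ?_
    rw [LinearMap.smul_apply, smul_pow, LinearMap.smul_apply]
    rw [div_eq_inv_mul, mul_smul]
    have h5 : ∀ (a : ℚ) (u : L), a • u = (algebraMap ℚ ℂ a) • u := fun _ _ => rfl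
    rw [h5]
    simp
  refine ⟨fun t => LieDerivation.exp _ (hnil t), fun t v => ?_, fun t v => ?_⟩
  · rw [LieDerivation.exp_map_apply, hD, key]
  · rw [← key]
    change IsNilpotent.exp (-(t • LieDerivation.ad ℂ L c).toLinearMap) v = _
    rw [hD, neg_smul]


variable [HasTrivialRadical ℂ L]

lemma kf_apply (x y : L) : killingForm ℂ L x y = LinearMap.trace ℂ L (ad ℂ L x * ad ℂ L y) := rfl

lemma kf_symm (x y : L) : killingForm ℂ L x y = killingForm ℂ L y x := by
  rw [kf_apply, kf_apply, LinearMap.trace_mul_comm]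

lemma kf_lie (x y z : L) : killingForm ℂ L ⁅x, y⁆ z = killingForm ℂ L x ⁅y, z⁆ :=
  LieModule.traceForm_apply_lie_apply ℂ L L x y z

lemma kf_nondeg (x : L) (h : ∀ y, killingForm ℂ L x y = 0) : x = 0 :=
  (LieAlgebra.IsKilling.killingForm_nondegenerate ℂ L).1 x h

lemma kf_sep (N : Submodule ℂ L) (x : L) (hx : x ∉ N) :
    ∃ y, (∀ n ∈ N, killingForm ℂ L y n = 0) ∧ killingForm ℂ L y x ≠ 0 := by
  obtain ⟨f, hN, hf⟩ := dual_sep N x hx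
  refine ⟨(LinearMap.BilinForm.toDual (killingForm ℂ L)
    (LieAlgebra.IsKilling.killingForm_nondegenerate ℂ L)).symm f, fun n hn => ?_, ?_⟩
  · simpa [LinearMap.BilinForm.apply_toDual_symm_apply] using hN n hn
  · simpa [LinearMap.BilinForm.apply_toDual_symm_apply] using hf

lemma nil_range (e : L) (he : IsNilpotent (ad ℂ L e)) : ∃ f : L, ⁅e, ⁅e, f⁆⁆ = e := by
  by_contra hcon
  have : e ∉ LinearMap.range ((ad ℂ L e) * (ad ℂ L e)) := by
    rintro ⟨f, hf⟩; exact hcon ⟨f, hf⟩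
  obtain ⟨y, hy, hye⟩ := kf_sep _ e this
  have h1 : ⁅e, ⁅e, y⁆⁆ = 0 := by
    apply kf_nondeg
    intro z
    have := hy ⁅e, ⁅e, z⁆⁆ ⟨z, rfl⟩
    rw [← kf_lie, ← kf_lie] at this
    have h6 : ⁅e, ⁅e, y⁆⁆ = ⁅⁅y, e⁆, e⁆ := by rw [← lie_skew, ← lie_skew e y, neg_lie, neg_neg]
    rw [h6, this]
  apply hye
  rw [kf_symm, kf_apply]
  apply trace_mul_zero _ _ he
  rw [← ad_lie']
  have := ad_lie' e ⁅e, y⁆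
  rw [h1, map_zero] at this
  exact (sub_eq_zero.1 this.symm)

/-- A nilpotent of a semisimple subalgebra is nilpotent in every representation. -/
lemma nil_rep {V : Type*} [AddCommGroup V] [Module ℂ V] [Module.Finite ℂ V]
    (ρ : L →ₗ[ℂ] End ℂ V) (hρ : IsRep ρ)
    (e : L) (he : IsNilpotent (ad ℂ L e)) : IsNilpotent (ρ e) := by
  obtain ⟨f, hf⟩ := nil_range e he
  have h1 : ρ e = ρ e * ρ ⁅e, f⁆ - ρ ⁅e, f⁆ * ρ e := by rw [← hρ, hf]
  rw [h1]; apply nilp_comm; rw [← h1]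

/-- coefficient extraction -/
lemma coeff_zero (n : ℕ) (a : ℕ → ℂ) (h : ∀ t : ℂ, ∑ k ∈ Finset.range n, t ^ k * a k = 0)
    (k : ℕ) (hk : k < n) : a k = 0 := by
  have : (∑ k ∈ Finset.range n, Polynomial.C (a k) * Polynomial.X ^ k) = 0 := by
    apply Polynomial.funext
    intro t
    rw [Polynomial.eval_finsetSum, Polynomial.eval_zero, ← h t]
    refine Finset.sum_congr rfl fun k _ => ?_
    rw [Polynomial.eval_mul, Polynomial.eval_C, Polynomial.eval_pow, Polynomial.eval_X, mul_comm]
  have h2 := congrArg (fun p => Polynomial.coeff p k) this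
  simpa [Polynomial.finsetSum_coeff, Polynomial.coeff_C_mul, Polynomial.coeff_X_pow, hk] using h2

def nilSpan (L : Type*) [LieRing L] [LieAlgebra ℂ L] : Submodule ℂ L :=
  Submodule.span ℂ {e | IsNilpotent (ad ℂ L e)}

lemma nil_equiv (g : L ≃ₗ⁅ℂ⁆ L) (e : L) (he : IsNilpotent (ad ℂ L e)) :
    IsNilpotent (ad ℂ L (g e)) := by
  obtain ⟨n, hn⟩ := he
  refine ⟨n, ?_⟩
  have : ∀ k v, ((ad ℂ L (g e)) ^ k) (g v) = g (((ad ℂ L e) ^ k) v) := by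
    intro k
    induction k with
    | zero => simp
    | succ k ih =>
      intro v
      rw [pow_succ, pow_succ, Module.End.mul_apply, Module.End.mul_apply, ← ih, ad_apply, ad_apply,
        ← LieEquiv.map_lie]
  ext v
  have h7 := this n (g.symm v)
  rw [LieEquiv.apply_symm_apply, hn] at h7
  rw [h7]; simp

lemma nilSpan_lie (e f : L) (he : IsNilpotent (ad ℂ L e)) (hf : IsNilpotent (ad ℂ L f)) :
    ⁅e, f⁆ ∈ nilSpan L := by
  by_contra hcon
  obtain ⟨ℓ, hN, hℓ⟩ := dual_sep _ _ hcon
  obtain ⟨n, hn⟩ := he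
  have hn2 : (ad ℂ L e) ^ (n+2) = 0 := by rw [pow_add, hn, zero_mul]
  obtain ⟨g, hg, -⟩ := exists_exp e (n+2) hn2
  have h1 : ∀ t : ℂ, ℓ (g t f) = 0 := by
    intro t
    exact hN _ (Submodule.subset_span (nil_equiv (g t) f hf))
  have h2 := coeff_zero (n+2) (fun k => (1 / (k.factorial : ℂ)) * ℓ (((ad ℂ L e) ^ k) f))
    (fun t => by
      rw [← h1 t, hg, map_sum]
      refine Finset.sum_congr rfl fun k _ => ?_
      rw [map_smul, smul_eq_mul]; ring) 1 (by omega)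
  apply hℓ
  simpa using h2

lemma nilSpan_eq_top : nilSpan L = ⊤ := by
  obtain ⟨x, hx⟩ := LieAlgebra.exists_isCartanSubalgebra_engel ℂ L
  set H := LieSubalgebra.engel ℂ x
  have hroot : ∀ (α : LieModule.Weight ℂ H L), α.IsNonZero →
      ∀ v ∈ LieAlgebra.rootSpace H α, IsNilpotent (ad ℂ L v) := by
    intro α hα v hv
    exact LieAlgebra.isNilpotent_ad_of_mem_rootSpace H hα hv
  have hH : H.toSubmodule ≤ nilSpan L := by
    have h8 := LieAlgebra.IsKilling.biSup_corootSpace_eq_top (K := ℂ) (L := L) (H := H)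
    have h9 : (⊤ : Submodule ℂ H) ≤ (nilSpan L).comap H.toSubmodule.subtype := by
      rw [← LieSubmodule.top_toSubmodule (R := ℂ) (L := H) (M := H), ← h8,
        LieSubmodule.iSup_toSubmodule]
      refine iSup_le fun α => ?_
      rw [LieSubmodule.iSup_toSubmodule]
      refine iSup_le fun hα => ?_
      intro v hv
      have h10 := (LieAlgebra.mem_corootSpace (α := α)).1 hv
      refine (Submodule.span_le.2 ?_ : Submodule.span ℂ _ ≤ nilSpan L) h10
      rintro _ ⟨y, hy, z, hz, rfl⟩
      refine nilSpan_lie _ _ (hroot α hα y hy) ?_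
      refine LieAlgebra.isNilpotent_ad_of_mem_rootSpace H ?_ hz
      intro h11
      exact hα (neg_eq_zero.1 h11)
    intro v hv
    exact h9 (x := ⟨v, hv⟩) trivial
  rw [eq_top_iff]
  have h := LieAlgebra.cartan_sup_iSup_rootSpace_eq_top (K := ℂ) (L := L) (H := H)
  have h' := congrArg LieSubmodule.toSubmodule h
  rw [LieSubmodule.sup_toSubmodule, LieSubmodule.top_toSubmodule] at h'
  rw [← h']
  refine sup_le hH ?_
  rw [LieSubmodule.iSup_toSubmodule]
  refine iSup_le fun α => ?_
  rw [LieSubmodule.iSup_toSubmodule]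
  refine iSup_le fun hα => ?_
  intro v hv
  exact Submodule.subset_span (hroot α hα v hv)

end lie
end Dis
end

section
open Module LieAlgebra
set_option linter.unusedSectionVars false

namespace Dis

section hom
variable {g : Type*} [LieRing g] [LieAlgebra ℂ g]
variable {V W : Type*} [AddCommGroup V] [Module ℂ V] [AddCommGroup W] [Module ℂ W]

/-- the representation on `Hom(V, W)` -/
noncomputable def homRep (σ : g →ₗ[ℂ] End ℂ V) (τ : g →ₗ[ℂ] End ℂ W) :
    g →ₗ[ℂ] End ℂ (V →ₗ[ℂ] W) where
  toFun z := LinearMap.llcomp ℂ V W W (τ z) - (LinearMap.llcomp ℂ V V W).flip (σ z)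
  map_add' x y := by ext; simp; abel
  map_smul' c x := by ext; simp [smul_sub]

lemma homRep_apply (σ : g →ₗ[ℂ] End ℂ V) (τ : g →ₗ[ℂ] End ℂ W) (z : g) (f : V →ₗ[ℂ] W) :
    homRep σ τ z f = τ z ∘ₗ f - f ∘ₗ σ z := rfl

lemma isRep_hom {σ : g →ₗ[ℂ] End ℂ V} {τ : g →ₗ[ℂ] End ℂ W} (hσ : IsRep σ) (hτ : IsRep τ) :
    IsRep (homRep σ τ) := by
  intro x y
  ext f v
  simp only [homRep_apply, LinearMap.sub_apply, Module.End.mul_apply, LinearMap.comp_apply, hσ x y,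
    hτ x y, map_sub]
  abel

lemma isRep_zero : IsRep (0 : g →ₗ[ℂ] End ℂ V) := by
  intro x y; simp

/-- restriction of a representation to a subalgebra -/
noncomputable def subRep (s : LieSubalgebra ℂ g) (σ : g →ₗ[ℂ] End ℂ V) : s →ₗ[ℂ] End ℂ V :=
  σ ∘ₗ s.toSubmodule.subtype

lemma subRep_apply (s : LieSubalgebra ℂ g) (σ : g →ₗ[ℂ] End ℂ V) (x : s) :
    subRep s σ x = σ (x : g) := rfl

lemma IsRep.sub (s : LieSubalgebra ℂ g) {σ : g →ₗ[ℂ] End ℂ V} (hσ : IsRep σ) :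
    IsRep (subRep s σ) := by
  intro x y; simp only [subRep_apply, LieSubalgebra.coe_bracket]; exact hσ _ _

end hom

section key
variable {L : Type*} [LieRing L] [LieAlgebra ℂ L] [Module.Finite ℂ L] [HasTrivialRadical ℂ L]
variable (s₁ s₂ : LieSubalgebra ℂ L)
variable {M : Type*} [AddCommGroup M] [Module ℂ M] [Module.Finite ℂ M]

noncomputable def stepN (ρ : L →ₗ[ℂ] End ℂ M) (b : M) : ℕ → Submodule ℂ M
  | 0 => Submodule.span ℂ {b}
  | n+1 => Submodule.span ℂ {m | ∃ z : L, ∃ u ∈ stepN ρ b n, ρ z u = m}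

lemma stepN_mem (ρ : L →ₗ[ℂ] End ℂ M) (b : M) (n : ℕ) (z : L) (u : M) (hu : u ∈ stepN ρ b n) :
    ρ z u ∈ stepN ρ b (n+1) := Submodule.subset_span ⟨z, u, hu, rfl⟩

lemma key_lemma (hsum : ∀ z : L, ∃ x ∈ s₁, ∃ y ∈ s₂, z = x + y)
    (ρ : L →ₗ[ℂ] End ℂ M) (hρ : IsRep ρ) (p : End ℂ M)
    (hp1 : ∀ x m, ρ x (p m) = 0) (hp3 : ∀ x m, p (ρ x m) = 0)
    (hp4 : ∀ m, m - p m ∈ rimg ρ) (hp2 : ∀ m, (∀ x, ρ x m = 0) → p m = m)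
    (a : M) (ha : ∀ x ∈ s₁, ρ x a = 0) (β : M →ₗ[ℂ] ℂ) (hβ : ∀ y ∈ s₂, ∀ m, β (ρ y m) = 0) :
    β a = β (p a) := by
  set b := a - p a with hb
  have hb1 : ∀ x ∈ s₁, ρ x b = 0 := fun x hx => by rw [hb, map_sub, ha x hx, hp1, sub_zero]
  have hbi : b ∈ rimg ρ := hp4 a
  have h1 : ∀ n, ∀ x ∈ s₁, ∀ u ∈ stepN ρ b n, ρ x u ∈ stepN ρ b n := by
    intro n
    induction n with
    | zero =>
      intro x hx u hu
      obtain ⟨c, rfl⟩ := Submodule.mem_span_singleton.1 hu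
      rw [map_smul, hb1 x hx, smul_zero]; exact zero_mem _
    | succ n ih =>
      intro x hx u hu
      induction hu using Submodule.span_induction with
      | mem u hu =>
        obtain ⟨z, u, hu, rfl⟩ := hu
        have : ρ x (ρ z u) = ρ ⁅x, z⁆ u + ρ z (ρ x u) := by
          rw [hρ]; simp
        rw [this]
        exact add_mem (stepN_mem ρ b n _ _ hu) (stepN_mem ρ b n _ _ (ih x hx u hu))
      | zero => rw [map_zero]; exact zero_mem _
      | add u v _ _ hu hv => rw [map_add]; exact add_mem hu hv
      | smul c u _ hu => rw [map_smul]; exact Submodule.smul_mem _ _ hu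
  have h2 : ∀ n, ∀ u ∈ stepN ρ b n, ∀ z, β (ρ z u) = 0 := by
    intro n
    induction n with
    | zero =>
      intro u hu z
      obtain ⟨x, hx, y, hy, rfl⟩ := hsum z
      obtain ⟨c, rfl⟩ := Submodule.mem_span_singleton.1 hu
      rw [map_add, LinearMap.add_apply, map_add, hβ y hy, map_smul, hb1 x hx]; simp
    | succ n ih =>
      intro u hu z
      obtain ⟨x, hx, y, hy, rfl⟩ := hsum z
      rw [map_add, LinearMap.add_apply, map_add, hβ y hy, add_zero]
      have h3 := h1 (n+1) x hx u hu
      generalize ρ x u = v at h3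
      induction h3 using Submodule.span_induction with
      | mem u hu =>
        obtain ⟨z, u, hu, rfl⟩ := hu
        exact ih u hu z
      | zero => simp
      | add u v _ _ hu hv => rw [map_add, hu, hv, add_zero]
      | smul c u _ hu => rw [map_smul, hu, smul_zero]
  set M' : Submodule ℂ M := ⨆ n, stepN ρ b n with hM'
  have hst : ∀ z : L, ∀ m ∈ M', ρ z m ∈ M' := by
    intro z m hm
    have : M' ≤ M'.comap (ρ z) := by
      rw [hM']
      refine iSup_le fun n u hu => ?_
      exact Submodule.mem_iSup_of_mem (n+1) (stepN_mem ρ b n z u hu)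
    exact this hm
  have hle : M' ≤ rimg ρ := by
    rw [hM']
    refine iSup_le fun n => ?_
    rcases n with _ | n
    · exact (Submodule.span_singleton_le_iff_mem _ _).2 hbi
    · refine Submodule.span_le.2 ?_
      rintro _ ⟨z, u, _, rfl⟩
      exact mem_rimg ρ z u
  have hbM : b ∈ M' := Submodule.mem_iSup_of_mem 0 (Submodule.mem_span_singleton_self b)
  have hpb : ∀ m ∈ rimg ρ, p m = 0 := by
    intro m hm
    have : rimg ρ ≤ LinearMap.ker p := rimg_le fun x m => hp3 x m
    exact this hm
  obtain ⟨p', q1, q2, q3, q4⟩ := exists_pr (rrestr ρ M' hst) (hρ.restr M' hst)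
  have h5 : p' ⟨b, hbM⟩ = 0 := by
    have h6 : ∀ x, ρ x (p' ⟨b, hbM⟩ : M') = 0 := fun x => by
      have := congrArg Subtype.val (q1 x ⟨b, hbM⟩); simpa using this
    have h7 := hp2 _ h6
    rw [hpb _ (hle (p' ⟨b, hbM⟩).2)] at h7
    exact Subtype.ext h7.symm
  have h8 := q4 ⟨b, hbM⟩
  rw [h5, sub_zero] at h8
  have h9 : rimg (rrestr ρ M' hst) ≤ LinearMap.ker (β ∘ₗ M'.subtype) := by
    refine rimg_le fun x m => ?_
    have : M' ≤ LinearMap.ker (β ∘ₗ ρ x) := by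
      rw [hM']
      exact iSup_le fun n u hu => h2 n u hu x
    exact this m.2
  have h10 : β b = 0 := h9 h8
  rw [hb, map_sub, sub_eq_zero] at h10
  exact h10


lemma trace_rank_one {W : Type*} [AddCommGroup W] [Module ℂ W] [Module.Finite ℂ W]
    (B : End ℂ W) (φ : W →ₗ[ℂ] ℂ) (a : W) :
    LinearMap.trace ℂ W (B * φ.smulRight a) = φ (B a) := by
  have : B * φ.smulRight a = φ.smulRight (B a) := by
    ext v; simp
  rw [this]
  simp [LinearMap.trace_smulRight]

lemma lemma_D [HasTrivialRadical ℂ s₁] [HasTrivialRadical ℂ s₂]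
    (hsum : ∀ z : L, ∃ x ∈ s₁, ∃ y ∈ s₂, z = x + y)
    {W V : Type*} [AddCommGroup W] [Module ℂ W] [Module.Finite ℂ W]
    [AddCommGroup V] [Module ℂ V] [Module.Finite ℂ V]
    (σ : L →ₗ[ℂ] End ℂ W) (hσ : IsRep σ) (ν : L →ₗ[ℂ] End ℂ V) (hν : IsRep ν)
    (a : W) (ha : ∀ x ∈ s₁, σ x a = 0)
    (hgen : ∀ N : Submodule ℂ W, (∀ z : L, ∀ m ∈ N, σ z m ∈ N) → a ∈ N → N = ⊤)
    (ψ : W →ₗ[ℂ] V) (hψ : ∀ y ∈ s₂, ∀ w, ψ (σ y w) = ν y (ψ w))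
    (hf : ∀ f : V →ₗ[ℂ] ℂ, (∀ κ ∈ s₁, κ ∈ s₂ → ∀ Z, f (ν κ Z) = 0) → f (ψ a) = 0) :
    ψ a = 0 := by
  obtain ⟨P, hP1, hP2, hP3, hP4⟩ := exists_pr (homRep σ σ) (isRep_hom hσ hσ)
  -- invariants commute
  have hcomm : ∀ (Y : End ℂ W) (z : L), σ z * P Y = P Y * σ z := by
    intro Y z
    have := hP1 z Y
    rw [homRep_apply] at this
    exact sub_eq_zero.1 this
  -- trace against invariants
  have htr : ∀ (C : End ℂ W), (∀ z, σ z * C = C * σ z) → ∀ Y : End ℂ W,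
      LinearMap.trace ℂ W (C * Y) = LinearMap.trace ℂ W (C * P Y) := by
    intro C hC Y
    have : rimg (homRep σ σ) ≤
        LinearMap.ker (LinearMap.trace ℂ W ∘ₗ LinearMap.mulLeft ℂ C) := by
      refine rimg_le fun z Y' => ?_
      rw [LinearMap.mem_ker, LinearMap.comp_apply, homRep_apply, LinearMap.mulLeft_apply]
      change LinearMap.trace ℂ W (C * (σ z * Y' - Y' * σ z)) = 0
      rw [mul_sub, map_sub, ← mul_assoc, ← mul_assoc, LinearMap.trace_mul_comm ℂ (C * Y') (σ z),
        ← mul_assoc, hC, sub_self]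
    have h1 := this (hP4 Y)
    rw [LinearMap.mem_ker, LinearMap.comp_apply, LinearMap.mulLeft_apply, mul_sub, map_sub,
      sub_eq_zero] at h1
    exact h1
  -- the main vanishing
  have hmain : ∀ a' : W →ₗ[ℂ] ℂ, ψ ∘ₗ P (a'.smulRight a) = 0 := by
    intro a'
    obtain ⟨P₁, hQ1, hQ2, hQ3, hQ4⟩ := exists_pr (homRep (subRep s₁ σ) (0 : s₁ →ₗ[ℂ] End ℂ ℂ))
      (isRep_hom (hσ.sub s₁) isRep_zero)
    set a'' := P₁ a' with ha''
    have ha1 : ∀ x ∈ s₁, ∀ w, a'' (σ x w) = 0 := by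
      intro x hx w
      have := LinearMap.congr_fun (hQ1 ⟨x, hx⟩ a') w
      simpa [homRep_apply, subRep_apply] using this
    have hPa : P (a'.smulRight a) = P (a''.smulRight a) := by
      have : rimg (homRep (subRep s₁ σ) (0 : s₁ →ₗ[ℂ] End ℂ ℂ)) ≤
          LinearMap.ker (P ∘ₗ (LinearMap.smulRightₗ (R := ℂ) (M₂ := W) (M := W)).flip a) := by
        refine rimg_le fun z f => ?_
        rw [LinearMap.mem_ker, LinearMap.comp_apply]
        have h2 : (LinearMap.smulRightₗ (R := ℂ) (M₂ := W) (M := W)).flip a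
            (homRep (subRep s₁ σ) (0 : s₁ →ₗ[ℂ] End ℂ ℂ) z f) =
            homRep σ σ (z : L) (f.smulRight a) := by
          ext v
          simp [homRep_apply, subRep_apply, ha _ z.2]
        rw [h2]; exact hP3 _ _
      have h1 := this (hQ4 a')
      rw [LinearMap.mem_ker, map_sub, sub_eq_zero] at h1
      exact h1
    rw [hPa]
    set θ := P (a''.smulRight a) with hθ
    -- equivariant χ
    have hχ : ∀ χ : V →ₗ[ℂ] W, (∀ y ∈ s₂, ∀ Z, χ (ν y Z) = σ y (χ Z)) →
        LinearMap.trace ℂ W (χ ∘ₗ ψ ∘ₗ θ) = 0 := by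
      intro χ hχ
      have h3 : a'' (χ (ψ a)) = 0 := hf (a'' ∘ₗ χ) (fun κ h1 h2 Z => by
        rw [LinearMap.comp_apply, hχ κ h2, ha1 κ h1])
      have h4 := key_lemma s₁ s₂ hsum (homRep σ σ) (isRep_hom hσ hσ) P hP1 hP3 hP4 hP2
        (a''.smulRight a) (fun x hx => by
          ext v; simp [homRep_apply, ha x hx, ha1 x hx])
        (LinearMap.trace ℂ W ∘ₗ LinearMap.mulLeft ℂ (χ ∘ₗ ψ : End ℂ W))
        (fun y hy m => by
          have hc : σ y * (χ ∘ₗ ψ : End ℂ W) = (χ ∘ₗ ψ : End ℂ W) * σ y := by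
            ext w; simp [hψ y hy, hχ y hy]
          rw [LinearMap.comp_apply, homRep_apply, LinearMap.mulLeft_apply]
          change LinearMap.trace ℂ W ((χ ∘ₗ ψ : End ℂ W) * (σ y * m - m * σ y)) = 0
          rw [mul_sub, map_sub, ← mul_assoc, ← mul_assoc,
            LinearMap.trace_mul_comm ℂ ((χ ∘ₗ ψ : End ℂ W) * m) (σ y), ← mul_assoc, hc, sub_self])
      rw [LinearMap.comp_apply, LinearMap.mulLeft_apply, trace_rank_one] at h4
      rw [LinearMap.comp_apply, h3] at h4
      exact h4.symm
    obtain ⟨P₂, hR1, hR2, hR3, hR4⟩ := exists_pr (homRep (subRep s₂ ν) (subRep s₂ σ))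
      (isRep_hom (hν.sub s₂) (hσ.sub s₂))
    have hχ' : ∀ χ : V →ₗ[ℂ] W, LinearMap.trace ℂ W (χ ∘ₗ ψ ∘ₗ θ) = 0 := by
      intro χ
      have h5 := hχ (P₂ χ) (fun y hy Z => by
        have := LinearMap.congr_fun (hR1 ⟨y, hy⟩ χ) Z
        simp only [homRep_apply, subRep_apply, LinearMap.sub_apply, LinearMap.comp_apply,
          LinearMap.zero_apply, sub_eq_zero] at this
        exact this.symm)
      have : rimg (homRep (subRep s₂ ν) (subRep s₂ σ)) ≤
          LinearMap.ker (LinearMap.trace ℂ W ∘ₗ (LinearMap.lcomp ℂ W (ψ ∘ₗ θ))) := by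
        refine rimg_le fun y χ' => ?_
        rw [LinearMap.mem_ker, LinearMap.comp_apply, homRep_apply]
        have e : (LinearMap.lcomp ℂ W (ψ ∘ₗ θ)) (subRep s₂ σ y ∘ₗ χ' - χ' ∘ₗ subRep s₂ ν y) =
            σ y * (χ' ∘ₗ ψ ∘ₗ θ : End ℂ W) - (χ' ∘ₗ ψ ∘ₗ θ : End ℂ W) * σ y := by
          ext w
          have h6 := LinearMap.congr_fun (hcomm (a''.smulRight a) y) w
          simp only [Module.End.mul_apply, ← hθ] at h6
          simp [subRep_apply, ← h6, hψ _ y.2]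
        rw [e, map_sub, LinearMap.trace_mul_comm, sub_self]
      have h7 := this (hR4 χ)
      rw [LinearMap.mem_ker, map_sub, LinearMap.comp_apply, LinearMap.comp_apply, sub_eq_zero] at h7
      exact h7.trans h5
    by_contra hne
    obtain ⟨w, hw⟩ : ∃ w, (ψ ∘ₗ θ) w ≠ 0 := by
      by_contra hcon; push Not at hcon
      exact hne (LinearMap.ext hcon)
    obtain ⟨f, -, hfw⟩ := dual_sep (⊥ : Submodule ℂ V) _ (by simpa using hw)
    apply hfw
    have h8 := hχ' (f.smulRight w)
    have h9 : f.smulRight w ∘ₗ ψ ∘ₗ θ = (1 : End ℂ W) * (f ∘ₗ ψ ∘ₗ θ).smulRight w := by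
      ext v; simp
    rw [h9, trace_rank_one] at h8
    simpa using h8
  -- conclusion
  by_contra hne
  obtain ⟨f, -, hfw⟩ := dual_sep (⊥ : Submodule ℂ V) _ (by simpa using hne)
  apply hfw
  set φ := f ∘ₗ ψ with hφ
  have hY : ∀ w, P (φ.smulRight w) a = 0 := by
    intro w
    by_contra hcon
    obtain ⟨a', -, ha'⟩ := dual_sep (⊥ : Submodule ℂ W) _ (by simpa using hcon)
    apply ha'
    have h1 := htr (P (a'.smulRight a)) (fun z => hcomm _ z) (φ.smulRight w)
    rw [trace_rank_one] at h1
    have h2 := htr (P (φ.smulRight w)) (fun z => hcomm _ z) (a'.smulRight a)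
    rw [trace_rank_one, LinearMap.trace_mul_comm, ← h1] at h2
    rw [h2, hφ, LinearMap.comp_apply]
    have := LinearMap.congr_fun (hmain a') w
    rw [LinearMap.comp_apply] at this
    rw [this]; simp
  have hPY : ∀ w, P (φ.smulRight w) = 0 := by
    intro w
    have := hgen (LinearMap.ker (P (φ.smulRight w))) (fun z m hm => by
      rw [LinearMap.mem_ker] at hm ⊢
      have h1 := LinearMap.congr_fun (hcomm (φ.smulRight w) z) m
      simp only [Module.End.mul_apply, hm, map_zero] at h1
      exact h1.symm) (hY w)
    exact LinearMap.ker_eq_top.1 this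
  have h3 := htr 1 (fun z => by simp) (φ.smulRight a)
  rw [hPY, trace_rank_one] at h3
  simpa [hφ] using h3

end key
end Dis
end

section
open Module LieAlgebra
set_option linter.unusedSectionVars false

namespace Dis

section tens
variable {g : Type*} [LieRing g] [LieAlgebra ℂ g]
variable {V W : Type*} [AddCommGroup V] [Module ℂ V] [AddCommGroup W] [Module ℂ W]
open TensorProduct

/-- tensor product representation -/
noncomputable def tensRep (σ : g →ₗ[ℂ] End ℂ V) (τ : g →ₗ[ℂ] End ℂ W) :
    g →ₗ[ℂ] End ℂ (V ⊗[ℂ] W) where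
  toFun z := (σ z).rTensor W + (τ z).lTensor V
  map_add' x y := by
    rw [map_add, map_add, LinearMap.rTensor_add, LinearMap.lTensor_add]; abel
  map_smul' c x := by
    rw [map_smul, map_smul, LinearMap.rTensor_smul, LinearMap.lTensor_smul]; simp

lemma tensRep_tmul (σ : g →ₗ[ℂ] End ℂ V) (τ : g →ₗ[ℂ] End ℂ W) (z : g) (v : V) (w : W) :
    tensRep σ τ z (v ⊗ₜ w) = σ z v ⊗ₜ w + v ⊗ₜ τ z w := rfl

lemma isRep_tens {σ : g →ₗ[ℂ] End ℂ V} {τ : g →ₗ[ℂ] End ℂ W} (hσ : IsRep σ) (hτ : IsRep τ) :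
    IsRep (tensRep σ τ) := by
  intro x y
  refine TensorProduct.ext' fun v w => ?_
  simp only [tensRep_tmul, LinearMap.sub_apply, Module.End.mul_apply, map_add, hσ.apply, hτ.apply,
    TensorProduct.sub_tmul, TensorProduct.tmul_sub]
  abel

/-- product representation -/
noncomputable def prodRep (σ : g →ₗ[ℂ] End ℂ V) (τ : g →ₗ[ℂ] End ℂ W) :
    g →ₗ[ℂ] End ℂ (V × W) where
  toFun z := (σ z).prodMap (τ z)
  map_add' x y := by ext <;> simp
  map_smul' c x := by ext <;> simp

lemma isRep_prod {σ : g →ₗ[ℂ] End ℂ V} {τ : g →ₗ[ℂ] End ℂ W} (hσ : IsRep σ) (hτ : IsRep τ) :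
    IsRep (prodRep σ τ) := by
  intro x y
  refine LinearMap.ext fun v => ?_
  simp [prodRep, hσ x y, hτ x y]

end tens

section orth
variable {L : Type*} [LieRing L] [LieAlgebra ℂ L] [Module.Finite ℂ L] [HasTrivialRadical ℂ L]

lemma exists_oproj (K : Submodule ℂ L)
    (hK : ∀ x ∈ K, (∀ y ∈ K, killingForm ℂ L x y = 0) → x = 0) :
    ∃ p : End ℂ L, (∀ x, p x ∈ K) ∧ (∀ x, ∀ y ∈ K, killingForm ℂ L (x - p x) y = 0) := by
  let r : L →ₗ[ℂ] Dual ℂ K := (LinearMap.lcomp ℂ ℂ K.subtype) ∘ₗ killingForm ℂ L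
  have hr : ∀ x (y : K), r x y = killingForm ℂ L x y := fun x y => rfl
  have hinj : Function.Injective (r ∘ₗ K.subtype) := by
    rw [injective_iff_map_eq_zero]
    intro x hx
    refine Subtype.ext (hK x x.2 fun y hy => ?_)
    exact LinearMap.congr_fun hx ⟨y, hy⟩
  have hdim : finrank ℂ K = finrank ℂ (Dual ℂ K) := (Subspace.dual_finrank_eq).symm
  let e : K ≃ₗ[ℂ] Dual ℂ K := LinearEquiv.ofInjectiveOfFinrankEq (r ∘ₗ K.subtype) hinj hdim
  refine ⟨K.subtype ∘ₗ e.symm.toLinearMap ∘ₗ r, fun x => (e.symm (r x)).2, fun x y hy => ?_⟩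
  have h1 : e (e.symm (r x)) = r x := e.apply_symm_apply _
  have h2 := LinearMap.congr_fun h1 ⟨y, hy⟩
  have h3 : e (e.symm (r x)) ⟨y, hy⟩ = killingForm ℂ L (e.symm (r x) : K) y := rfl
  rw [map_sub, LinearMap.sub_apply, sub_eq_zero]
  rw [h3] at h2
  exact h2.symm

/-- `p` is the orthogonal projection onto `K` -/
structure IsOProj (K : Submodule ℂ L) (p : End ℂ L) : Prop where
  mem : ∀ x, p x ∈ K
  orth : ∀ x, ∀ y ∈ K, killingForm ℂ L (x - p x) y = 0
  nd : ∀ x ∈ K, (∀ y ∈ K, killingForm ℂ L x y = 0) → x = 0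

variable {K : Submodule ℂ L} {p : End ℂ L}

lemma IsOProj.fix (h : IsOProj K p) {x : L} (hx : x ∈ K) : p x = x := by
  have := h.nd (x - p x) (sub_mem hx (h.mem x)) (h.orth x)
  exact (sub_eq_zero.1 this).symm

lemma IsOProj.eq_of (h : IsOProj K p) {x y : L} (hy : y ∈ K)
    (hxy : ∀ z ∈ K, killingForm ℂ L (x - y) z = 0) : p x = y := by
  refine sub_eq_zero.1 (h.nd _ (sub_mem (h.mem x) hy) fun z hz => ?_)
  have h1 := h.orth x z hz
  have h2 := hxy z hz
  rw [map_sub, LinearMap.sub_apply] at *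
  linear_combination h2 - h1

lemma IsOProj.kf (h : IsOProj K p) (x : L) {y : L} (hy : y ∈ K) :
    killingForm ℂ L (p x) y = killingForm ℂ L x y := by
  have h1 := h.orth x y hy
  rw [map_sub, LinearMap.sub_apply, sub_eq_zero] at h1
  exact h1.symm

lemma IsOProj.symm (h : IsOProj K p) (x y : L) :
    killingForm ℂ L (p x) y = killingForm ℂ L x (p y) := by
  rw [← h.kf x (h.mem y), kf_symm, ← h.kf y (h.mem x), kf_symm]

lemma IsOProj.comm (h : IsOProj K p) {c : L} (hc : ∀ x ∈ K, ⁅c, x⁆ ∈ K) (x : L) :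
    p ⁅c, x⁆ = ⁅c, p x⁆ := by
  refine h.eq_of (hc _ (h.mem x)) fun z hz => ?_
  rw [← lie_sub, ← lie_skew, map_neg, LinearMap.neg_apply, kf_lie, h.orth x _ (hc z hz), neg_zero]

lemma nondeg_sub (s : LieSubalgebra ℂ L) [HasTrivialRadical ℂ s] :
    ∀ x ∈ s.toSubmodule, (∀ y ∈ s.toSubmodule, killingForm ℂ L x y = 0) → x = 0 := by
  intro x hx h
  have hρ : IsRep (subRep s (ad ℂ L : L →ₗ[ℂ] End ℂ L)) := isRep_ad.sub s
  have h1 : IsSolvable (trRad _ hρ) := by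
    refine solvable_of_trace_zero hρ _ (fun x _ h0 => ?_) (fun x hx y _ => hx y)
    refine Subtype.ext (center_zero fun y => ?_)
    have := LinearMap.congr_fun h0 y
    rw [subRep_apply] at this
    rw [← lie_skew]
    change -(ad ℂ L (x : L) y) = 0
    rw [show ad ℂ L (x : L) y = 0 from this, neg_zero]
  have h2 := eq_bot_of_solvable _ h1
  have h3 : (⟨x, hx⟩ : s) ∈ trRad _ hρ := fun y => h y y.2
  rw [h2] at h3
  have := (LieSubmodule.mem_bot _).1 h3
  exact congrArg Subtype.val this

lemma exists_isOProj (s : LieSubalgebra ℂ L) [HasTrivialRadical ℂ s] :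
    ∃ p : End ℂ L, IsOProj s.toSubmodule p := by
  obtain ⟨p, h1, h2⟩ := exists_oproj s.toSubmodule (nondeg_sub s)
  exact ⟨p, h1, h2, nondeg_sub s⟩

end orth

end Dis
end

section
open Module LieAlgebra
set_option linter.unusedSectionVars false

namespace Dis
universe u
section alg
variable {L : Type u} [LieRing L] [LieAlgebra ℂ L] [Module.Finite ℂ L] [HasTrivialRadical ℂ L]
variable (s₁ s₂ : LieSubalgebra ℂ L)
open TensorProduct

/-- adjoint representation as a plain linear map -/
noncomputable abbrev adL (L : Type u) [LieRing L] [LieAlgebra ℂ L] : L →ₗ[ℂ] End ℂ L :=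
  (ad ℂ L : L →ₗ[ℂ] End ℂ L)

/-- conjugation representation on `End L` -/
noncomputable abbrev cjL (L : Type u) [LieRing L] [LieAlgebra ℂ L] : L →ₗ[ℂ] End ℂ (End ℂ L) :=
  homRep (adL L) (adL L)

lemma cjL_apply (z : L) (f : End ℂ L) : cjL L z f = ad ℂ L z * f - f * ad ℂ L z := rfl

lemma isRep_cj : IsRep (cjL L) := isRep_hom isRep_ad isRep_ad

/-- algebraic endomorphisms -/
def Alg (Φ : End ℂ L) : Prop :=
  ∃ (W : Type u) (_ : AddCommGroup W) (_ : Module ℂ W) (_ : Module.Finite ℂ W)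
    (σ : L →ₗ[ℂ] End ℂ W) (a : W) (ψ : W →ₗ[ℂ] End ℂ L), IsRep σ ∧ (∀ x ∈ s₁, σ x a = 0) ∧
    (∀ y ∈ s₂, ∀ w, ψ (σ y w) = cjL L y (ψ w)) ∧ ψ a = Φ

variable {s₁ s₂}

lemma Alg.one : Alg s₁ s₂ (1 : End ℂ L) :=
  ⟨End ℂ L, inferInstance, inferInstance, inferInstance, cjL L, 1, LinearMap.id, isRep_cj,
    fun x _ => by rw [cjL_apply]; simp, fun y _ w => rfl, rfl⟩

lemma Alg.smul {Φ : End ℂ L} (c : ℂ) (h : Alg s₁ s₂ Φ) : Alg s₁ s₂ (c • Φ) := by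
  obtain ⟨W, i1, i2, i3, σ, a, ψ, hσ, ha, hψ, rfl⟩ := h
  exact ⟨W, i1, i2, i3, σ, a, c • ψ, hσ, ha, fun y hy w => by
    rw [LinearMap.smul_apply, hψ y hy, LinearMap.smul_apply, map_smul], rfl⟩

lemma Alg.add {Φ Φ' : End ℂ L} (h : Alg s₁ s₂ Φ) (h' : Alg s₁ s₂ Φ') : Alg s₁ s₂ (Φ + Φ') := by
  obtain ⟨W, i1, i2, i3, σ, a, ψ, hσ, ha, hψ, rfl⟩ := h
  obtain ⟨W', i1', i2', i3', σ', a', ψ', hσ', ha', hψ', rfl⟩ := h'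
  refine ⟨W × W', inferInstance, inferInstance, inferInstance, prodRep σ σ', (a, a'),
    ψ.coprod ψ', isRep_prod hσ hσ', fun x hx => ?_, fun y hy w => ?_, ?_⟩
  · change (σ x a, σ' x a') = 0
    rw [ha x hx, ha' x hx]; rfl
  · change ψ (σ y w.1) + ψ' (σ' y w.2) = _
    rw [hψ y hy, hψ' y hy, ← map_add]; rfl
  · rfl

lemma Alg.mul_right {Φ : End ℂ L} (h : Alg s₁ s₂ Φ) (p : End ℂ L)
    (hp : ∀ y ∈ s₂, ad ℂ L y * p = p * ad ℂ L y) : Alg s₁ s₂ (Φ * p) := by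
  obtain ⟨W, i1, i2, i3, σ, a, ψ, hσ, ha, hψ, rfl⟩ := h
  refine ⟨W, i1, i2, i3, σ, a, LinearMap.mulRight ℂ p ∘ₗ ψ, hσ, ha, fun y hy w => ?_, rfl⟩
  simp only [LinearMap.comp_apply, hψ y hy, LinearMap.mulRight_apply, cjL_apply, sub_mul, mul_assoc,
    hp y hy]

lemma Alg.mul_left {Φ : End ℂ L} (h : Alg s₁ s₂ Φ) (p : End ℂ L)
    (hp : ∀ y ∈ s₂, ad ℂ L y * p = p * ad ℂ L y) : Alg s₁ s₂ (p * Φ) := by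
  obtain ⟨W, i1, i2, i3, σ, a, ψ, hσ, ha, hψ, rfl⟩ := h
  refine ⟨W, i1, i2, i3, σ, a, LinearMap.mulLeft ℂ p ∘ₗ ψ, hσ, ha, fun y hy w => ?_, rfl⟩
  simp only [LinearMap.comp_apply, hψ y hy, LinearMap.mulLeft_apply, cjL_apply, mul_sub,
    ← mul_assoc, hp y hy]

lemma Alg.mul_right' {Φ : End ℂ L} (h : Alg s₁ s₂ Φ) (p : End ℂ L)
    (hp : ∀ y ∈ s₁, ad ℂ L y * p = p * ad ℂ L y) : Alg s₁ s₂ (Φ * p) := by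
  obtain ⟨W, i1, i2, i3, σ, a, ψ, hσ, ha, hψ, rfl⟩ := h
  refine ⟨W ⊗[ℂ] End ℂ L, inferInstance, inferInstance, inferInstance, tensRep σ (cjL L),
    a ⊗ₜ p, TensorProduct.lift (LinearMap.mul ℂ (End ℂ L) ∘ₗ ψ), isRep_tens hσ isRep_cj,
    fun x hx => ?_, fun y hy w => ?_, ?_⟩
  · rw [tensRep_tmul, ha x hx, cjL_apply, hp x hx]; simp
  · induction w using TensorProduct.induction_on with
    | zero => simp
    | tmul w f =>
      rw [tensRep_tmul, map_add]
      simp only [TensorProduct.lift.tmul, LinearMap.comp_apply, hψ y hy, LinearMap.mul_apply',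
        cjL_apply]
      noncomm_ring
    | add u v hu hv => simp only [map_add, hu, hv]
  · simp

lemma Alg.dual [HasTrivialRadical ℂ s₁] [HasTrivialRadical ℂ s₂] {Φ : End ℂ L} (h : Alg s₁ s₂ Φ)
    (hsum : ∀ z : L, ∃ x ∈ s₁, ∃ y ∈ s₂, z = x + y)
    (hf : ∀ f : End ℂ L →ₗ[ℂ] ℂ, (∀ κ ∈ s₁, κ ∈ s₂ → ∀ Z, f (cjL L κ Z) = 0) → f Φ = 0) :
    Φ = 0 := by
  obtain ⟨W, i1, i2, i3, σ, a, ψ, hσ, ha, hψ, rfl⟩ := h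
  let N : Submodule ℂ W := sInf {N | (∀ z : L, ∀ m ∈ N, σ z m ∈ N) ∧ a ∈ N}
  have hN : ∀ z : L, ∀ m ∈ N, σ z m ∈ N := by
    intro z m hm
    rw [Submodule.mem_sInf] at hm ⊢
    exact fun N' h' => h'.1 z m (hm N' h')
  have haN : a ∈ N := by
    rw [Submodule.mem_sInf]; exact fun N' h' => h'.2
  have hgen : ∀ N' : Submodule ℂ N, (∀ z : L, ∀ m ∈ N', rrestr σ N hN z m ∈ N') →
      (⟨a, haN⟩ : N) ∈ N' → N' = ⊤ := by
    intro N' h1 h2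
    have h3 : N ≤ N'.map N.subtype := by
      refine sInf_le ⟨?_, ⟨⟨a, haN⟩, h2, rfl⟩⟩
      rintro z _ ⟨m, hm, rfl⟩
      exact ⟨_, h1 z m hm, rfl⟩
    rw [eq_top_iff]
    intro n _
    obtain ⟨m, hm, hmn⟩ := h3 n.2
    rwa [show m = n from Subtype.ext hmn] at hm
  exact lemma_D s₁ s₂ hsum (rrestr σ N hN) (hσ.restr N hN) (cjL L) isRep_cj ⟨a, haN⟩
    (fun x hx => Subtype.ext (ha x hx)) hgen (ψ ∘ₗ N.subtype)
    (fun y hy w => hψ y hy w) hf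

/-- trace duality -/
lemma exists_trace_rep (f : End ℂ L →ₗ[ℂ] ℂ) :
    ∃ Ψ : End ℂ L, ∀ Z, f Z = LinearMap.trace ℂ L (Ψ * Z) := by
  let r : End ℂ L →ₗ[ℂ] Dual ℂ (End ℂ L) :=
    (LinearMap.llcomp ℂ _ _ _ (LinearMap.trace ℂ L)) ∘ₗ (LinearMap.mul ℂ (End ℂ L))
  have hr : ∀ x y, r x y = LinearMap.trace ℂ L (x * y) := fun x y => rfl
  have hinj : Function.Injective r := by
    rw [injective_iff_map_eq_zero]
    intro X hX
    ext v
    by_contra hne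
    obtain ⟨φ, -, hφ⟩ := dual_sep (⊥ : Submodule ℂ L) _ (by simpa using hne)
    apply hφ
    have := LinearMap.congr_fun hX (φ.smulRight v)
    rw [hr, trace_rank_one] at this
    simpa using this
  let e := LinearEquiv.ofInjectiveOfFinrankEq r hinj (Subspace.dual_finrank_eq).symm
  refine ⟨e.symm f, fun Z => ?_⟩
  have h1 : e (e.symm f) = f := e.apply_symm_apply _
  rw [← hr]
  exact (LinearMap.congr_fun h1 Z).symm

lemma Alg.exists_comm [HasTrivialRadical ℂ s₁] [HasTrivialRadical ℂ s₂] {Φ : End ℂ L}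
    (h : Alg s₁ s₂ Φ) (hsum : ∀ z : L, ∃ x ∈ s₁, ∃ y ∈ s₂, z = x + y) (hΦ : Φ ≠ 0) :
    ∃ Ψ : End ℂ L, (∀ κ ∈ s₁, κ ∈ s₂ → ad ℂ L κ * Ψ = Ψ * ad ℂ L κ) ∧
      LinearMap.trace ℂ L (Φ * Ψ) ≠ 0 := by
  by_contra hcon
  push Not at hcon
  refine hΦ (h.dual hsum fun f hf => ?_)
  obtain ⟨Ψ, hΨ⟩ := exists_trace_rep f
  rw [hΨ, LinearMap.trace_mul_comm]
  refine hcon Ψ fun κ h1 h2 => ?_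
  rw [← sub_eq_zero]
  have h3 : ∀ Z, LinearMap.trace ℂ L ((ad ℂ L κ * Ψ - Ψ * ad ℂ L κ) * Z) = 0 := by
    intro Z
    have := hf κ h1 h2 Z
    rw [hΨ, cjL_apply, mul_sub, map_sub, ← mul_assoc, ← mul_assoc,
      LinearMap.trace_mul_comm ℂ (Ψ * Z), ← mul_assoc, ← map_sub, ← sub_mul] at this
    rw [← neg_eq_zero, ← map_neg, ← neg_mul, neg_sub]
    exact this
  ext v
  by_contra hne
  obtain ⟨φ, -, hφ⟩ := dual_sep (⊥ : Submodule ℂ L) _ (by simpa using hne)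
  apply hφ
  have := h3 (φ.smulRight v)
  rwa [trace_rank_one] at this

variable {p₁ p₂ : End ℂ L}

lemma IsOProj.comm_ad {s : LieSubalgebra ℂ L} {p : End ℂ L} (h : IsOProj s.toSubmodule p) :
    ∀ y ∈ s, ad ℂ L y * p = p * ad ℂ L y := by
  intro y hy
  ext v
  exact (h.comm (fun x hx => s.lie_mem hy hx) v).symm

lemma Alg.aeval (h1 : IsOProj s₁.toSubmodule p₁) (h2 : IsOProj s₂.toSubmodule p₂)
    (q : Polynomial ℂ) : Alg s₁ s₂ (Polynomial.aeval ((1 - p₁) + (1 - p₂)) q) := by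
  set T := (1 - p₁) + (1 - p₂) with hT
  have hmul : ∀ Φ : End ℂ L, Alg s₁ s₂ Φ → Alg s₁ s₂ (Φ * T) := by
    intro Φ h
    have e : Φ * T = (2 : ℂ) • Φ + ((-1 : ℂ) • (Φ * p₁) + (-1 : ℂ) • (Φ * p₂)) := by
      rw [hT]; simp only [two_smul, neg_smul, one_smul]; noncomm_ring
    rw [e]
    exact (h.smul _).add (((h.mul_right' _ h1.comm_ad).smul _).add
      ((h.mul_right _ h2.comm_ad).smul _))
  have hpow : ∀ n, Alg s₁ s₂ (T ^ n) := by
    intro n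
    induction n with
    | zero => exact Alg.one
    | succ n ih => rw [pow_succ]; exact hmul _ ih
  induction q using Polynomial.induction_on' with
  | add p q hp hq => rw [map_add]; exact hp.add hq
  | monomial n c => rw [Polynomial.aeval_monomial, ← Algebra.smul_def]; exact (hpow n).smul c

end alg
end Dis
end

section
open Module LieAlgebra
set_option linter.unusedSectionVars false

namespace Dis

section conj
variable {V : Type*} [AddCommGroup V] [Module ℂ V] [Module.Finite ℂ V]

/-- `D` acts by conjugate eigenvalues of `A`. -/
def IsConj (A D : End ℂ V) : Prop :=
  ∀ μ : ℂ, ∀ v ∈ A.maxGenEigenspace μ, D v = (starRingEnd ℂ μ) • v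

lemma exists_conj (A : End ℂ V) : ∃ D ∈ Algebra.adjoin ℂ {A}, IsConj A D := by
  obtain ⟨N, -, S, hS₀, hN, hS, hSN⟩ := A.exists_isNilpotent_isSemisimple
  have hcomm : Commute A S := Algebra.commute_of_mem_adjoin_self hS₀
  rw [eq_sub_of_add_eq hSN.symm] at hN
  have aux : ∀ μ : ℂ, ∀ v ∈ A.maxGenEigenspace μ, S v = μ • v := by
    intro μ v hv
    rw [Module.End.maxGenEigenspace_eq] at hv
    exact Module.End.apply_eq_of_mem_of_comm_of_isFinitelySemisimple_of_isNil hv hcomm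
      hS.isFinitelySemisimple hN
  classical
  let s : Finset ℂ := (minpoly ℂ S).roots.toFinset
  let q : Polynomial ℂ := Lagrange.interpolate s id (fun μ => starRingEnd ℂ μ)
  have hq : ∀ μ ∈ s, q.eval μ = starRingEnd ℂ μ := fun μ hμ =>
    Lagrange.eval_interpolate_at_node (v := id) _ Function.injective_id.injOn hμ
  refine ⟨Polynomial.aeval S q, ?_, fun μ v hv => ?_⟩
  · have h1 : Polynomial.aeval S q ∈ Algebra.adjoin ℂ {S} := Polynomial.aeval_mem_adjoin_singleton _ _
    exact Algebra.adjoin_le (Set.singleton_subset_iff.2 hS₀) h1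
  · by_cases hv0 : v = 0
    · simp [hv0]
    have hev : S.HasEigenvector μ v := ⟨Module.End.mem_eigenspace_iff.2 (aux μ v hv), hv0⟩
    rw [Module.End.aeval_apply_of_hasEigenvector hev, hq]
    rw [Multiset.mem_toFinset, Polynomial.mem_roots (minpoly.ne_zero (Algebra.IsIntegral.isIntegral S))]
    exact Module.End.isRoot_of_hasEigenvalue (Module.End.hasEigenvalue_of_hasEigenvector hev)

lemma internal_max (A : End ℂ V) : DirectSum.IsInternal (fun μ => A.maxGenEigenspace μ) :=
  DirectSum.isInternal_submodule_of_iSupIndep_of_iSup_eq_top A.independent_maxGenEigenspace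
    (Module.End.iSup_maxGenEigenspace_eq_top A)

lemma fin_max (A : End ℂ V) : {μ | A.maxGenEigenspace μ ≠ ⊥}.Finite :=
  WellFoundedGT.finite_ne_bot_of_iSupIndep A.independent_maxGenEigenspace

lemma trace_mul_max (A F : End ℂ V) (h : Commute A F) (μ : ℂ) :
    LinearMap.trace ℂ (A.maxGenEigenspace μ)
      ((A * F).restrict (A.mapsTo_maxGenEigenspace_of_comm ((Commute.refl A).mul_right h) μ)) =
    μ * LinearMap.trace ℂ (A.maxGenEigenspace μ)
      (F.restrict (A.mapsTo_maxGenEigenspace_of_comm h μ)) := by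
  have hf' := A.mapsTo_maxGenEigenspace_of_comm (Commute.refl _) μ
  have hg' := A.mapsTo_maxGenEigenspace_of_comm h μ
  have h_comm : Commute (F.restrict hg') (A.restrict hf') := LinearMap.restrict_commute h.symm _ _
  have hn := A.isNilpotent_restrict_maxGenEigenspace_sub_algebraMap μ
  have := LinearMap.trace_comp_eq_mul_of_commute_of_isNilpotent μ h_comm hn
  rw [← Module.End.mul_eq_comp, h_comm.eq] at this
  exact this

lemma trace_restrict_conj (A D : End ℂ V) (h : IsConj A D) (hD : Commute A D) (μ : ℂ) :
    LinearMap.trace ℂ (A.maxGenEigenspace μ)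
      (D.restrict (A.mapsTo_maxGenEigenspace_of_comm hD μ)) =
      starRingEnd ℂ μ * finrank ℂ (A.maxGenEigenspace μ) := by
  have : D.restrict (A.mapsTo_maxGenEigenspace_of_comm hD μ) = (starRingEnd ℂ μ) • (1 : End ℂ _) := by
    ext v
    exact h μ v v.2
  rw [this, map_smul, LinearMap.trace_one, smul_eq_mul]

lemma trace_A (A : End ℂ V) : LinearMap.trace ℂ V A =
    ∑ μ ∈ (fin_max A).toFinset, μ * finrank ℂ (A.maxGenEigenspace μ) := by
  rw [LinearMap.trace_eq_sum_trace_restrict' (internal_max A) (fin_max A)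
    (fun μ => A.mapsTo_maxGenEigenspace_of_comm ((Commute.refl A)) μ)]
  refine Finset.sum_congr rfl fun μ _ => ?_
  have h := trace_mul_max A 1 (Commute.one_right A) μ
  have h1 : (1 : End ℂ V).restrict (A.mapsTo_maxGenEigenspace_of_comm (Commute.one_right A) μ) =
    1 := rfl
  rw [h1, LinearMap.trace_one] at h
  exact h

lemma trace_conj (A D : End ℂ V) (h : IsConj A D) (hD : Commute A D) :
    LinearMap.trace ℂ V D = starRingEnd ℂ (LinearMap.trace ℂ V A) := by
  rw [LinearMap.trace_eq_sum_trace_restrict' (internal_max A) (fin_max A)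
    (fun μ => A.mapsTo_maxGenEigenspace_of_comm hD μ), trace_A, map_sum]
  refine Finset.sum_congr rfl fun μ _ => ?_
  rw [trace_restrict_conj A D h hD]; simp

lemma trace_mul_conj (A D : End ℂ V) (h : IsConj A D) (hD : Commute A D)
    (h0 : LinearMap.trace ℂ V (A * D) = 0) : IsNilpotent A := by
  rw [LinearMap.trace_eq_sum_trace_restrict' (internal_max A) (fin_max A)
    (fun μ => A.mapsTo_maxGenEigenspace_of_comm ((Commute.refl A).mul_right hD) μ)] at h0
  have h1 : ∑ μ ∈ (fin_max A).toFinset, ‖μ‖ ^ 2 * (finrank ℂ (A.maxGenEigenspace μ) : ℝ) = 0 := by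
    rw [← Complex.ofReal_inj, Complex.ofReal_sum, Complex.ofReal_zero, ← h0]
    refine Finset.sum_congr rfl fun μ _ => ?_
    rw [trace_mul_max A D hD, trace_restrict_conj A D h hD, ← mul_assoc, Complex.mul_conj,
      Complex.normSq_eq_norm_sq]
    push_cast; rfl
  have h2 : ∀ μ : ℂ, μ ≠ 0 → A.maxGenEigenspace μ = ⊥ := by
    intro μ hμ
    by_contra hne
    have := (Finset.sum_eq_zero_iff_of_nonneg (fun μ _ => by positivity)).1 h1 μ
      ((fin_max A).mem_toFinset.2 hne)
    rcases mul_eq_zero.1 this with h | h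
    · exact hμ (by simpa using h)
    · exact hne (Submodule.finrank_eq_zero.1 (by exact_mod_cast h))
  have h3 : A.maxGenEigenspace 0 = ⊤ := by
    rw [← Module.End.iSup_maxGenEigenspace_eq_top A]
    refine le_antisymm (le_iSup (fun μ => A.maxGenEigenspace μ) 0) (iSup_le fun μ => ?_)
    by_cases hμ : μ = 0
    · rw [hμ]
    · rw [h2 μ hμ]; exact bot_le
  rw [Module.End.maxGenEigenspace_eq] at h3
  refine ⟨A.maxGenEigenspaceIndex 0, LinearMap.ext fun v => ?_⟩
  have : v ∈ A.genEigenspace 0 (A.maxGenEigenspaceIndex 0) := by rw [h3]; trivial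
  rw [Module.End.mem_genEigenspace_nat] at this
  simpa using this

lemma restrict_conj (A D : End ℂ V) (h : IsConj A D) (U : Submodule ℂ V)
    (hA : Set.MapsTo A U U) (hDU : Set.MapsTo D U U) : IsConj (A.restrict hA) (D.restrict hDU) := by
  intro μ v hv
  refine Subtype.ext (h μ v ?_)
  rw [Module.End.mem_maxGenEigenspace] at hv ⊢
  obtain ⟨k, hk⟩ := hv
  refine ⟨k, ?_⟩
  have : ∀ (k : ℕ) (u : U), (((A.restrict hA - μ • 1) ^ k) u : U) = ((A - μ • 1) ^ k) (u : V) := by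
    intro k
    induction k with
    | zero => intro u; rfl
    | succ k ih => intro u; rw [pow_succ, pow_succ, Module.End.mul_apply, Module.End.mul_apply, ih]; rfl
  rw [← this, hk]; rfl

lemma trace_zero_conj (A D C : End ℂ V) (h : IsConj A D) (hD : Commute A D) (hAC : Commute C A)
    (hDC : Commute C D)
    (h0 : ∀ ν, LinearMap.trace ℂ (C.maxGenEigenspace ν)
      (A.restrict (C.mapsTo_maxGenEigenspace_of_comm hAC ν)) = 0) :
    LinearMap.trace ℂ V (D * C) = 0 := by
  refine LinearMap.trace_comp_eq_zero_of_commute_of_trace_restrict_eq_zero hDC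
    (Module.End.iSup_maxGenEigenspace_eq_top C) fun ν => ?_
  have h1 := restrict_conj A D h _ (C.mapsTo_maxGenEigenspace_of_comm hAC ν)
    (C.mapsTo_maxGenEigenspace_of_comm hDC ν)
  rw [trace_conj _ _ h1 (LinearMap.restrict_commute hD _ _), h0, map_zero]

end conj

section lie
universe u
variable {L : Type u} [LieRing L] [LieAlgebra ℂ L] [Module.Finite ℂ L] [HasTrivialRadical ℂ L]

lemma conj_der (x : L) (D : End ℂ L) (h : IsConj (ad ℂ L x) D) (y z : L) :
    D ⁅y, z⁆ = ⁅D y, z⁆ + ⁅y, D z⁆ := by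
  have hy : y ∈ ⨆ μ, (ad ℂ L x).maxGenEigenspace μ := by
    rw [Module.End.iSup_maxGenEigenspace_eq_top]; trivial
  have hz : z ∈ ⨆ μ, (ad ℂ L x).maxGenEigenspace μ := by
    rw [Module.End.iSup_maxGenEigenspace_eq_top]; trivial
  induction hy using Submodule.iSup_induction' with
  | mem α y hy =>
    induction hz using Submodule.iSup_induction' with
    | mem β z hz =>
      have hyz : ⁅y, z⁆ ∈ (ad ℂ L x).maxGenEigenspace (α + β) :=
        LieModule.lie_mem_maxGenEigenspace_toEnd (M := L) hy hz
      rw [h _ _ hy, h _ _ hz, h _ _ hyz, smul_lie, lie_smul, ← add_smul, map_add]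
    | zero => simp
    | add _ _ _ _ h h' => simp only [lie_add, map_add, h, h']; abel
  | zero => simp
  | add _ _ _ _ h h' => simp only [add_lie, map_add, h, h']; abel

lemma der_inner {g : Type*} [LieRing g] [LieAlgebra ℂ g] [Module.Finite ℂ g]
    [HasTrivialRadical ℂ g] (D : End ℂ g) (h : ∀ y z : g, D ⁅y, z⁆ = ⁅D y, z⁆ + ⁅y, D z⁆) :
    ∃ y : g, ∀ z, D z = ⁅y, z⁆ := by
  let D' : LieDerivation ℂ g g := ⟨D, fun y z => by
    rw [h, ← lie_skew (D y) z, add_comm, ← sub_eq_add_neg]⟩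
  obtain ⟨y, hy⟩ := LieDerivation.IsKilling.exists_eq_ad D'
  refine ⟨y, fun z => ?_⟩
  have : D' z = D z := rfl
  rw [← this, ← hy, LieDerivation.ad_apply_apply]

lemma adjoin_stable {V : Type*} [AddCommGroup V] [Module ℂ V] (A D : End ℂ V)
    (hD : D ∈ Algebra.adjoin ℂ {A}) (U : Submodule ℂ V) (hU : ∀ u ∈ U, A u ∈ U) :
    ∀ u ∈ U, D u ∈ U := by
  induction hD using Algebra.adjoin_induction with
  | mem D hD => rw [Set.mem_singleton_iff] at hD; rw [hD]; exact hU
  | algebraMap r => intro u hu; exact U.smul_mem r hu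
  | add a b _ _ ha hb => intro u hu; exact U.add_mem (ha u hu) (hb u hu)
  | mul a b _ _ ha hb => intro u hu; exact ha _ (hb u hu)

lemma conj_mem (s : LieSubalgebra ℂ L) [HasTrivialRadical ℂ s] (x : L) (hx : x ∈ s) (D : End ℂ L)
    (hD : D ∈ Algebra.adjoin ℂ {ad ℂ L x}) (h : IsConj (ad ℂ L x) D) (y : L)
    (hy : ∀ z, D z = ⁅y, z⁆) : y ∈ s := by
  have hDy : D = ad ℂ L y := LinearMap.ext hy
  have hDs := adjoin_stable _ _ hD
  have h1 : ∀ u ∈ s.toSubmodule, D u ∈ s.toSubmodule := hDs _ fun u hu => s.lie_mem hx hu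
  obtain ⟨y₁, hy₁⟩ := der_inner (g := s) (D.restrict h1) (fun u v => Subtype.ext (by
    exact conj_der x D h u v))
  have hy₁' : ∀ z ∈ s, ⁅y, z⁆ = ⁅(y₁ : L), z⁆ := by
    intro z hz
    have := congrArg Subtype.val (hy₁ ⟨z, hz⟩)
    rw [← hy]; exact this
  have hu : ∀ z ∈ s, ⁅y - y₁, z⁆ = 0 := fun z hz => by rw [sub_lie, hy₁' z hz, sub_self]
  suffices hz : y - y₁ = 0 by rw [sub_eq_zero.1 hz]; exact y₁.2
  -- decomposition
  have hrep : IsRep (subRep s (adL L)) := isRep_ad.sub s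
  obtain ⟨p, hp1, hp2, hp3, hp4⟩ := exists_pr _ hrep
  refine kf_nondeg _ fun v => ?_
  have hv : v = p v + (v - p v) := by abel
  rw [hv, map_add]
  have e1 : killingForm ℂ L (y - y₁) (v - p v) = 0 := by
    have : rimg (subRep s (adL L)) ≤ LinearMap.ker (killingForm ℂ L (y - y₁)) := by
      refine rimg_le fun z m => ?_
      rw [LinearMap.mem_ker, subRep_apply]
      change killingForm ℂ L (y - y₁) ⁅(z : L), m⁆ = 0
      rw [← kf_lie, hu z z.2, map_zero, LinearMap.zero_apply]
    exact this (hp4 v)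
  rw [e1, add_zero]
  have hc : ∀ z ∈ s, ⁅z, p v⁆ = 0 := fun z hz => hp1 ⟨z, hz⟩ v
  generalize p v = c at hc
  have hcad : ∀ z ∈ s, Commute (ad ℂ L c) (ad ℂ L z) := by
    intro z hz
    have := ad_lie' z c
    rw [hc z hz, map_zero] at this
    exact (sub_eq_zero.1 this.symm).symm
  have e2 : killingForm ℂ L y₁ c = 0 := by
    have : (LinearMap.ker ((killingForm ℂ L).flip c ∘ₗ s.toSubmodule.subtype) : Submodule ℂ s) = ⊤ := by
      refine perfect fun a b => ?_
      rw [LinearMap.mem_ker]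
      change killingForm ℂ L ⁅(a : L), (b : L)⁆ c = 0
      rw [kf_lie, hc b b.2, map_zero]
    have h2 : y₁ ∈ LinearMap.ker ((killingForm ℂ L).flip c ∘ₗ s.toSubmodule.subtype) := by
      rw [this]; trivial
    exact h2
  rw [map_sub, LinearMap.sub_apply, e2, sub_zero, kf_apply, ← hDy]
  have hcomm : Commute (ad ℂ L x) D := Algebra.commute_of_mem_adjoin_self hD
  have hcD : Commute (ad ℂ L c) D := by
    have : D ∈ Subalgebra.centralizer ℂ {ad ℂ L c} := by
      refine Algebra.adjoin_le (Set.singleton_subset_iff.2 ?_) hD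
      rw [SetLike.mem_coe, Subalgebra.mem_centralizer_iff]
      rintro _ rfl
      exact hcad x hx
    rw [Subalgebra.mem_centralizer_iff] at this
    exact this _ rfl
  refine trace_zero_conj (ad ℂ L x) D (ad ℂ L c) h hcomm (hcad x hx) hcD fun ν => ?_
  -- the trace functional
  let U := (ad ℂ L c).maxGenEigenspace ν
  have hU : ∀ z : s, ∀ u ∈ U, subRep s (adL L) z u ∈ U := fun z u hu =>
    (ad ℂ L c).mapsTo_maxGenEigenspace_of_comm (hcad z z.2) ν hu
  let ρ := rrestr (subRep s (adL L)) U hU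
  have hρ : IsRep ρ := hrep.restr U hU
  have : LinearMap.ker (LinearMap.trace ℂ U ∘ₗ ρ) = ⊤ := by
    refine perfect fun a b => ?_
    rw [LinearMap.mem_ker, LinearMap.comp_apply, hρ, map_sub, LinearMap.trace_mul_comm, sub_self]
  have h3 : (⟨x, hx⟩ : s) ∈ LinearMap.ker (LinearMap.trace ℂ U ∘ₗ ρ) := by rw [this]; trivial
  exact h3

lemma conj_contra (s₁ s₂ : LieSubalgebra ℂ L) [HasTrivialRadical ℂ s₁] [HasTrivialRadical ℂ s₂]
    (x : L) (h1 : x ∈ s₁) (h2 : x ∈ s₂)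
    (hB : ∀ y ∈ s₁, y ∈ s₂ → killingForm ℂ L x y = 0) : IsNilpotent (ad ℂ L x) := by
  obtain ⟨D, hD, hc⟩ := exists_conj (ad ℂ L x)
  obtain ⟨y, hy⟩ := der_inner D (conj_der x D hc)
  have e := hB y (conj_mem s₁ x h1 D hD hc y hy) (conj_mem s₂ x h2 D hD hc y hy)
  rw [kf_apply, ← show D = ad ℂ L y from LinearMap.ext hy] at e
  exact trace_mul_conj _ D hc (Algebra.commute_of_mem_adjoin_self hD) e

end lie
end Dis
end

section
open Module LieAlgebra
set_option linter.unusedSectionVars false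

namespace Dis
universe u
section tor
variable {L : Type u} [LieRing L] [LieAlgebra ℂ L] [Module.Finite ℂ L] [HasTrivialRadical ℂ L]

lemma ab_no_nil (k : LieSubalgebra ℂ L) (a : Submodule ℂ L) (Q : End ℂ L)
    (hka : ∀ x ∈ k, ∀ y ∈ a, ⁅x, y⁆ ∈ a) (hak : ∀ y ∈ a, y ∈ k)
    (hab : ∀ x ∈ a, ∀ y ∈ a, ⁅x, y⁆ = 0) (hQk : ∀ v, Q v ∈ k) (hQa : ∀ v ∈ a, Q v = v)
    (hQ : ∀ x ∈ k, ∀ v, Q ⁅x, v⁆ = ⁅x, Q v⁆) (e : L) (he : e ∈ a) (hn : IsNilpotent (ad ℂ L e)) :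
    e = 0 := by
  obtain ⟨f, hf⟩ := nil_range e hn
  have h1 := hQa e he
  rw [← hf, hQ e (hak e he), hQ e (hak e he)] at h1
  rw [← hf, ← h1]
  refine hab _ he _ ?_
  rw [← lie_skew]
  exact neg_mem (hka _ (hQk f) _ he)

lemma ab_central (k : LieSubalgebra ℂ L) (a : Submodule ℂ L) (Q : End ℂ L)
    (hka : ∀ x ∈ k, ∀ y ∈ a, ⁅x, y⁆ ∈ a) (hak : ∀ y ∈ a, y ∈ k)
    (hab : ∀ x ∈ a, ∀ y ∈ a, ⁅x, y⁆ = 0) (hQk : ∀ v, Q v ∈ k) (hQa : ∀ v ∈ a, Q v = v)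
    (hQ : ∀ x ∈ k, ∀ v, Q ⁅x, v⁆ = ⁅x, Q v⁆) (x : L) (hx : x ∈ k) (b : L) (hb : b ∈ a) :
    ⁅x, b⁆ = 0 := by
  refine ab_no_nil k a Q hka hak hab hQk hQa hQ _ (hka x hx b hb) ?_
  have h := nilp_comm (ad ℂ L b) (ad ℂ L x) (by
    rw [← ad_lie']
    have h1 := ad_lie' b ⁅b, x⁆
    rw [hab b hb _ (by rw [← lie_skew]; exact neg_mem (hka x hx b hb)), map_zero] at h1
    exact sub_eq_zero.1 h1.symm)
  rw [← ad_lie', ← lie_skew, map_neg] at h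
  exact (isNilpotent_neg_iff).1 h

variable (s₁ s₂ : LieSubalgebra ℂ L) [HasTrivialRadical ℂ s₁] [HasTrivialRadical ℂ s₂]
variable {p₁ p₂ : End ℂ L}

lemma ker_T (h1 : IsOProj s₁.toSubmodule p₁) (h2 : IsOProj s₂.toSubmodule p₂)
    (hsum : ∀ z : L, ∃ x ∈ s₁, ∃ y ∈ s₂, z = x + y) (v : L)
    (hv : ((1 - p₁) + (1 - p₂)) v = 0) : v ∈ s₁ ⊓ s₂ := by
  have hv' : (v - p₁ v) = - (v - p₂ v) := eq_neg_of_add_eq_zero_left hv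
  have h0 : v - p₁ v = 0 := by
    refine kf_nondeg _ fun z => ?_
    obtain ⟨x, hx, y, hy, rfl⟩ := hsum z
    rw [map_add, h1.orth v x hx, hv', map_neg, LinearMap.neg_apply, h2.orth v y hy]; simp
  have h0' : v - p₂ v = 0 := by rw [h0] at hv'; exact neg_eq_zero.1 hv'.symm
  refine (LieSubalgebra.mem_inf _ _ _).2 ⟨?_, ?_⟩
  · rw [sub_eq_zero.1 h0]; exact h1.mem v
  · rw [sub_eq_zero.1 h0']; exact h2.mem v

lemma im_T (h1 : IsOProj s₁.toSubmodule p₁) (h2 : IsOProj s₂.toSubmodule p₂) (v κ : L)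
    (hκ : κ ∈ s₁ ⊓ s₂) : killingForm ℂ L (((1 - p₁) + (1 - p₂)) v) κ = 0 := by
  change killingForm ℂ L ((v - p₁ v) + (v - p₂ v)) κ = 0
  rw [map_add, LinearMap.add_apply, h1.orth v κ hκ.1, h2.orth v κ hκ.2, add_zero]

lemma comm_T (h1 : IsOProj s₁.toSubmodule p₁) (h2 : IsOProj s₂.toSubmodule p₂) (κ : L)
    (hκ : κ ∈ s₁ ⊓ s₂) (q : Polynomial ℂ) :
    Commute (ad ℂ L κ) (Polynomial.aeval ((1 - p₁) + (1 - p₂)) q) := by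
  have e1 : Commute (ad ℂ L κ) p₁ := h1.comm_ad κ hκ.1
  have e2 : Commute (ad ℂ L κ) p₂ := h2.comm_ad κ hκ.2
  have e3 : Commute (ad ℂ L κ) ((1 - p₁) + (1 - p₂)) :=
    ((Commute.one_right _).sub_right e1).add_right ((Commute.one_right _).sub_right e2)
  induction q using Polynomial.induction_on' with
  | add p q hp hq => rw [map_add]; exact hp.add_right hq
  | monomial n c =>
    rw [Polynomial.aeval_monomial, ← Algebra.smul_def]; exact (e3.pow_right n).smul_right c

/-- dichotomy -/
lemma dicho (h1 : IsOProj s₁.toSubmodule p₁) (h2 : IsOProj s₂.toSubmodule p₂)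
    (hsum : ∀ z : L, ∃ x ∈ s₁, ∃ y ∈ s₂, z = x + y) :
    (∃ q : Polynomial ℂ, (∀ v, Polynomial.aeval ((1 - p₁) + (1 - p₂)) q v ∈ s₁ ⊓ s₂) ∧
      (∀ v ∈ s₁ ⊓ s₂, Polynomial.aeval ((1 - p₁) + (1 - p₂)) q v = v)) ∨
    (∃ q : Polynomial ℂ, Polynomial.aeval ((1 - p₁) + (1 - p₂)) q ≠ 0 ∧
      (∀ v, Polynomial.aeval ((1 - p₁) + (1 - p₂)) q v ∈ s₁ ⊓ s₂) ∧
      (∀ v, ∀ κ ∈ s₁ ⊓ s₂,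
        killingForm ℂ L (Polynomial.aeval ((1 - p₁) + (1 - p₂)) q v) κ = 0)) := by
  have hk := ker_T s₁ s₂ h1 h2 hsum
  have hi := im_T s₁ s₂ h1 h2
  have hk0 : ∀ v ∈ s₁ ⊓ s₂, ((1 - p₁) + (1 - p₂)) v = 0 := by
    intro v hv
    change (v - p₁ v) + (v - p₂ v) = 0
    rw [h1.fix hv.1, h2.fix hv.2]; simp
  generalize (1 - p₁) + (1 - p₂) = T at hk hi hk0
  obtain ⟨q, hq, hnd⟩ := Polynomial.exists_eq_pow_rootMultiplicity_mul_and_not_dvd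
    (minpoly ℂ T) (minpoly.ne_zero (Algebra.IsIntegral.isIntegral T)) 0
  generalize Polynomial.rootMultiplicity 0 (minpoly ℂ T) = j at hq
  rw [Polynomial.C_0, sub_zero] at hq hnd
  have hq0 : q.eval 0 ≠ 0 := by
    intro h0; apply hnd
    have := Polynomial.dvd_iff_isRoot.2 h0
    simpa using this
  have hmin : T ^ j * Polynomial.aeval T q = 0 := by
    have := minpoly.aeval ℂ T
    rw [hq] at this; simpa using this
  by_cases hj : j ≤ 1
  · left
    have hT : T * Polynomial.aeval T q = 0 := by
      interval_cases j
      · simp only [pow_zero, one_mul] at hmin; rw [hmin, mul_zero]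
      · simpa using hmin
    refine ⟨Polynomial.C (q.eval 0)⁻¹ * q, fun v => ?_, fun v hv => ?_⟩
    · refine hk _ ?_
      rw [map_mul, Polynomial.aeval_C, ← Algebra.smul_def, LinearMap.smul_apply, map_smul]
      have := LinearMap.congr_fun hT v
      rw [Module.End.mul_apply] at this
      rw [this]; simp
    · rw [map_mul, Polynomial.aeval_C, ← Algebra.smul_def, LinearMap.smul_apply]
      by_cases hv0 : v = 0
      · simp [hv0]
      have hev : T.HasEigenvector 0 v := ⟨Module.End.mem_eigenspace_iff.2 (by simp [hk0 v hv]), hv0⟩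
      rw [Module.End.aeval_apply_of_hasEigenvector hev, smul_smul, inv_mul_cancel₀ hq0, one_smul]
  · right
    push Not at hj
    obtain ⟨i, rfl⟩ : ∃ i, j = i + 2 := ⟨j - 2, by omega⟩
    refine ⟨Polynomial.X ^ (i+1) * q, ?_, fun v => ?_, fun v κ hκ => ?_⟩
    · intro h0
      have h3 := minpoly.dvd ℂ T h0
      rw [hq] at h3
      have hqne : q ≠ 0 := by rintro rfl; simp at hq0
      have h4 := (mul_dvd_mul_iff_right hqne).1 h3
      have := (pow_dvd_pow_iff Polynomial.X_ne_zero Polynomial.not_isUnit_X).1 h4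
      omega
    · refine hk _ ?_
      have := LinearMap.congr_fun hmin v
      rw [pow_succ'] at this
      simpa using this
    · have e : Polynomial.aeval T (Polynomial.X ^ (i+1) * q) v =
        T (Polynomial.aeval T (Polynomial.X ^ i * q) v) := by
        rw [pow_succ', mul_assoc, map_mul, Polynomial.aeval_X]; rfl
      rw [e]; exact hi _ κ hκ

lemma case_two (h1 : IsOProj s₁.toSubmodule p₁) (h2 : IsOProj s₂.toSubmodule p₂)
    (hsum : ∀ z : L, ∃ x ∈ s₁, ∃ y ∈ s₂, z = x + y) (q : Polynomial ℂ)
    (hne : Polynomial.aeval ((1 - p₁) + (1 - p₂)) q ≠ 0)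
    (hk : ∀ v, Polynomial.aeval ((1 - p₁) + (1 - p₂)) q v ∈ s₁ ⊓ s₂)
    (hB : ∀ v, ∀ κ ∈ s₁ ⊓ s₂,
        killingForm ℂ L (Polynomial.aeval ((1 - p₁) + (1 - p₂)) q v) κ = 0) : False := by
  obtain ⟨Ψ, hΨ, htr⟩ := (Alg.aeval h1 h2 q).exists_comm hsum hne
  have hc := fun κ hκ => comm_T s₁ s₂ h1 h2 κ hκ q
  generalize Polynomial.aeval ((1 - p₁) + (1 - p₂)) q = Φ at *
  set X := Φ * Ψ with hX
  have hXc : ∀ κ ∈ s₁ ⊓ s₂, Commute (ad ℂ L κ) X := fun κ hκ =>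
    (hc κ hκ).mul_right (hΨ κ hκ.1 hκ.2)
  obtain ⟨n, hn, hn1⟩ := (X.eventually_isCompl_ker_pow_range_pow.and
    (Filter.eventually_ge_atTop 1)).exists
  have hXn : X ^ n ≠ 0 := by
    intro h0
    have : IsNilpotent X := ⟨n, h0⟩
    exact htr (LinearMap.isNilpotent_trace_of_isNilpotent this).eq_zero
  set a' := LinearMap.range (X ^ n) with ha'
  have hmem : ∀ v ∈ a', ∃ u, v = Φ u := by
    rintro _ ⟨v, rfl⟩
    obtain ⟨m, rfl⟩ : ∃ m, n = m + 1 := ⟨n - 1, by omega⟩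
    exact ⟨Ψ ((X ^ m) v), by rw [pow_succ']; rfl⟩
  have ha'k : ∀ v ∈ a', v ∈ s₁ ⊓ s₂ := fun v hv => by
    obtain ⟨u, rfl⟩ := hmem v hv; exact hk u
  have ha'B : ∀ v ∈ a', ∀ κ ∈ s₁ ⊓ s₂, killingForm ℂ L v κ = 0 := fun v hv κ hκ => by
    obtain ⟨u, rfl⟩ := hmem v hv; exact hB u κ hκ
  have hXnc : ∀ κ ∈ s₁ ⊓ s₂, ∀ v, (X ^ n) ⁅κ, v⁆ = ⁅κ, (X ^ n) v⁆ := fun κ hκ v =>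
    (LinearMap.congr_fun ((hXc κ hκ).pow_right n).eq v).symm
  have ha'i : ∀ κ ∈ s₁ ⊓ s₂, ∀ v ∈ a', ⁅κ, v⁆ ∈ a' := by
    rintro κ hκ _ ⟨v, rfl⟩
    exact ⟨⁅κ, v⁆, hXnc κ hκ v⟩
  -- the projection
  set Q : End ℂ L := Submodule.projection a' (LinearMap.ker (X ^ n)) hn.symm with hQ
  have hQa : ∀ v ∈ a', Q v = v := fun v hv => Submodule.projection_apply_left hn.symm ⟨v, hv⟩
  have hQm : ∀ v, Q v ∈ a' := fun v => Submodule.projection_apply_mem hn.symm v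
  have hQ0 : ∀ v, (X ^ n) v = 0 → Q v = 0 := fun v hv =>
    (Submodule.projection_apply_eq_zero_iff hn.symm).2 hv
  have hQ1 : ∀ v, (X ^ n) (v - Q v) = 0 := fun v => Submodule.sub_projection_mem hn.symm v
  have hQc : ∀ x ∈ s₁ ⊓ s₂, ∀ v, Q ⁅x, v⁆ = ⁅x, Q v⁆ := by
    intro x hx v
    have e : ⁅x, v⁆ = ⁅x, Q v⁆ + ⁅x, v - Q v⁆ := by rw [← lie_add]; simp
    rw [e, map_add, hQa _ (ha'i x hx _ (hQm v)), hQ0 ⁅x, v - Q v⁆ (by rw [hXnc x hx, hQ1, lie_zero]), add_zero]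
  -- the ideal
  let k := s₁ ⊓ s₂
  let I : LieIdeal ℂ k :=
    { Submodule.comap k.toSubmodule.subtype a' with
      lie_mem := fun {x m} hm => ha'i x x.2 m hm }
  have hIm : ∀ x : k, x ∈ I ↔ (x : L) ∈ a' := fun x => Iff.rfl
  have hsol : IsSolvable I := by
    refine solvable_of_trace_zero (isRep_ad.sub k) I (fun x _ h0 => ?_) (fun x hx y _ =>
      ha'B x hx y y.2)
    refine Subtype.ext (center_zero fun y => ?_)
    have : ⁅(x : L), y⁆ = 0 := LinearMap.congr_fun h0 y
    rw [← lie_skew, this, neg_zero]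
  have hI : I ≠ ⊥ := by
    intro h0
    apply hXn
    ext v
    have hv : (X ^ n) v ∈ a' := ⟨v, rfl⟩
    have : (⟨(X ^ n) v, ha'k _ hv⟩ : k) ∈ I := hv
    rw [h0] at this
    exact congrArg Subtype.val ((LieSubmodule.mem_bot _).1 this)
  set A := derivedAbelianOfIdeal I with hA
  have hAb : IsLieAbelian A := abelian_derivedAbelianOfIdeal I
  have hA0 : A ≠ ⊥ := fun h => hI ((abelian_of_solvable_ideal_eq_bot_iff I).1 h)
  have hAI : A ≤ I := by
    rw [hA, derivedAbelianOfIdeal]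
    split
    · exact bot_le
    · exact derivedSeriesOfIdeal_le_self I _
  obtain ⟨x, hxA, hx0⟩ := (Submodule.ne_bot_iff A.toSubmodule).1 (fun h => hA0 (by simpa using h))
  let a : Submodule ℂ L := Submodule.map k.toSubmodule.subtype A.toSubmodule
  have ham : ∀ v ∈ a, ∃ h : v ∈ k, (⟨v, h⟩ : k) ∈ A := by
    rintro _ ⟨v, hv, rfl⟩; exact ⟨v.2, hv⟩
  refine hx0 (Subtype.ext ?_)
  refine ab_no_nil k a Q ?_ ?_ ?_ (fun v => ha'k _ (hQm v)) ?_ hQc x ⟨x, hxA, rfl⟩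
    (conj_contra s₁ s₂ x x.2.1 x.2.2 (fun y hy1 hy2 => ha'B x (hAI hxA) y ⟨hy1, hy2⟩))
  · rintro x hx _ ⟨y, hy, rfl⟩
    exact ⟨⁅(⟨x, hx⟩ : k), y⁆, A.lie_mem hy, rfl⟩
  · intro y hy; exact (ham y hy).1
  · intro x hx y hy
    obtain ⟨h3, h4⟩ := ham x hx
    obtain ⟨h5, h6⟩ := ham y hy
    have := hAb.trivial ⟨_, h4⟩ ⟨_, h6⟩
    exact congrArg (fun z : A => ((z : k) : L)) this
  · intro v hv
    obtain ⟨h3, h4⟩ := ham v hv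
    exact hQa v (hAI h4)

theorem exists_Q (h1 : IsOProj s₁.toSubmodule p₁) (h2 : IsOProj s₂.toSubmodule p₂)
    (hsum : ∀ z : L, ∃ x ∈ s₁, ∃ y ∈ s₂, z = x + y) :
    ∃ q : Polynomial ℂ, (∀ v, Polynomial.aeval ((1 - p₁) + (1 - p₂)) q v ∈ s₁ ⊓ s₂) ∧
      (∀ v ∈ s₁ ⊓ s₂, Polynomial.aeval ((1 - p₁) + (1 - p₂)) q v = v) := by
  rcases dicho s₁ s₂ h1 h2 hsum with h | ⟨q, hq1, hq2, hq3⟩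
  · exact h
  · exact (case_two s₁ s₂ h1 h2 hsum q hq1 hq2 hq3).elim

end tor
end Dis
end

section
open Module LieAlgebra
set_option linter.unusedSectionVars false

namespace Dis
universe u
section good
variable {L : Type u} [LieRing L] [LieAlgebra ℂ L] [Module.Finite ℂ L] [HasTrivialRadical ℂ L]

/-- admissible pairs `(w, y)` -/
structure Good (s₂ : LieSubalgebra ℂ L) (p₂ : End ℂ L) (q r m : Polynomial ℂ) (w : End ℂ L) (y : L) :
    Prop where
  cl : ∀ a b, ∃ c, ⁅w a, w b⁆ = w c
  co : ∀ a, ad ℂ L (w a) * w = w * ad ℂ L (w a)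
  inv : (w + p₂) * Polynomial.aeval (w + p₂) r = 1
  ky : ∀ a, w a ∈ s₂ → ⁅w a, y⁆ = 0
  q2 : ∀ ξ, Polynomial.aeval ((1 - w) + (1 - p₂)) q ξ ∈ s₂
  q1 : ∀ ξ, ∃ a, Polynomial.aeval ((1 - w) + (1 - p₂)) q ξ = w a
  qy : ∀ ξ, killingForm ℂ L ξ y = killingForm ℂ L (Polynomial.aeval ((1 - w) + (1 - p₂)) q ξ) y
  my : Polynomial.aeval (ad ℂ L y) m = 0

/-- conjugation by a Lie automorphism -/
noncomputable def cjg (g : L ≃ₗ⁅ℂ⁆ L) : End ℂ L ≃ₐ[ℂ] End ℂ L :=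
  g.toLinearEquiv.conjAlgEquiv ℂ

lemma cjg_apply (g : L ≃ₗ⁅ℂ⁆ L) (w : End ℂ L) (v : L) : cjg g w v = g (w (g.symm v)) := rfl

lemma cjg_apply' (g : L ≃ₗ⁅ℂ⁆ L) (w : End ℂ L) (v : L) : cjg g w (g v) = g (w v) := by
  rw [cjg_apply, LieEquiv.symm_apply_apply]

lemma cjg_ad (g : L ≃ₗ⁅ℂ⁆ L) (v : L) : cjg g (ad ℂ L v) = ad ℂ L (g v) := by
  ext u
  rw [cjg_apply, ad_apply, ad_apply, LieEquiv.map_lie, LieEquiv.apply_symm_apply]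

lemma kf_equiv (g : L ≃ₗ⁅ℂ⁆ L) (x y : L) :
    killingForm ℂ L (g x) (g y) = killingForm ℂ L x y := by
  rw [kf_apply, kf_apply, ← cjg_ad, ← cjg_ad, ← map_mul]
  exact LinearMap.trace_conj' _ g.toLinearEquiv

variable {s₂ : LieSubalgebra ℂ L} {p₂ : End ℂ L}

lemma Good.act (h2 : IsOProj s₂.toSubmodule p₂) {q r m : Polynomial ℂ} {w : End ℂ L} {y : L}
    (h : Good s₂ p₂ q r m w y) (g : L ≃ₗ⁅ℂ⁆ L) (hg : cjg g p₂ = p₂) :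
    Good s₂ p₂ q r m (cjg g w) (g y) := by
  have hs : ∀ v, g v ∈ s₂ ↔ v ∈ s₂ := by
    have e : ∀ v, p₂ (g v) = g (p₂ v) := fun v => by rw [← cjg_apply', hg]
    intro v
    constructor
    · intro hv
      have h3 := h2.fix (x := g v) hv
      rw [e] at h3
      rw [← g.injective h3]; exact h2.mem v
    · intro hv
      have h3 := h2.fix (x := v) hv
      rw [← h3, ← e]; exact h2.mem _
  have e1 : cjg g w + p₂ = cjg g (w + p₂) := by rw [map_add, hg]
  have e2 : (1 - cjg g w) + (1 - p₂) = cjg g ((1 - w) + (1 - p₂)) := by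
    rw [map_add, map_sub, map_sub, map_one, hg]
  have e3 : ∀ (A : End ℂ L) (p : Polynomial ℂ), Polynomial.aeval (cjg g A) p =
    cjg g (Polynomial.aeval A p) := fun A p => Polynomial.aeval_algHom_apply (cjg g).toAlgHom A p
  have hsurj : ∀ v, ∃ u, v = g u := fun v => ⟨g.symm v, (g.apply_symm_apply v).symm⟩
  refine ⟨fun a b => ?_, fun a => ?_, ?_, fun a ha => ?_, fun ξ => ?_, fun ξ => ?_, fun ξ => ?_, ?_⟩
  · obtain ⟨a, rfl⟩ := hsurj a
    obtain ⟨b, rfl⟩ := hsurj b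
    obtain ⟨c, hc⟩ := h.cl a b
    exact ⟨g c, by rw [cjg_apply', cjg_apply', cjg_apply', ← LieEquiv.map_lie, hc]⟩
  · obtain ⟨a, rfl⟩ := hsurj a
    rw [cjg_apply', ← cjg_ad, ← map_mul, h.co, map_mul]
  · rw [e1, e3, ← map_mul, h.inv, map_one]
  · obtain ⟨a, rfl⟩ := hsurj a
    rw [cjg_apply'] at ha ⊢
    rw [← LieEquiv.map_lie, h.ky a ((hs _).1 ha), map_zero]
  · obtain ⟨ξ, rfl⟩ := hsurj ξ
    rw [e2, e3, cjg_apply', hs]; exact h.q2 ξ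
  · obtain ⟨ξ, rfl⟩ := hsurj ξ
    obtain ⟨a, ha⟩ := h.q1 ξ
    exact ⟨g a, by rw [e2, e3, cjg_apply', cjg_apply', ha]⟩
  · obtain ⟨ξ, rfl⟩ := hsurj ξ
    rw [e2, e3, cjg_apply', kf_equiv, kf_equiv, h.qy]
  · rw [← cjg_ad, e3, h.my, map_zero]

variable (s₁ : LieSubalgebra ℂ L) [HasTrivialRadical ℂ s₁] [HasTrivialRadical ℂ s₂]
variable {p₁ : End ℂ L}

lemma Q_symm (h1 : IsOProj s₁.toSubmodule p₁) (h2 : IsOProj s₂.toSubmodule p₂) (q : Polynomial ℂ) :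
    ∀ x y, killingForm ℂ L (Polynomial.aeval ((1 - p₁) + (1 - p₂)) q x) y =
      killingForm ℂ L x (Polynomial.aeval ((1 - p₁) + (1 - p₂)) q y) := by
  have hT : ∀ x y, killingForm ℂ L (((1 - p₁) + (1 - p₂)) x) y =
      killingForm ℂ L x (((1 - p₁) + (1 - p₂)) y) := by
    intro x y
    change killingForm ℂ L ((x - p₁ x) + (x - p₂ x)) y = killingForm ℂ L x ((y - p₁ y) + (y - p₂ y))
    simp only [map_add, map_sub, LinearMap.add_apply, LinearMap.sub_apply, h1.symm x y, h2.symm x y]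
  generalize (1 - p₁) + (1 - p₂) = T at hT
  induction q using Polynomial.induction_on' with
  | add p q hp hq =>
    intro x y
    simp only [map_add, LinearMap.add_apply, hp x y, hq x y]
  | monomial n c =>
    have : ∀ x y, killingForm ℂ L ((T ^ n) x) y = killingForm ℂ L x ((T ^ n) y) := by
      induction n with
      | zero => intro x y; rfl
      | succ n ih =>
        intro x y
        rw [pow_succ, Module.End.mul_apply, ih, hT, ← Module.End.mul_apply, ← pow_succ', pow_succ]
    intro x y
    rw [Polynomial.aeval_monomial, ← Algebra.smul_def]
    simp only [LinearMap.smul_apply, map_smul, this x y]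

lemma good_base (h1 : IsOProj s₁.toSubmodule p₁) (h2 : IsOProj s₂.toSubmodule p₂)
    (hsum : ∀ z : L, ∃ x ∈ s₁, ∃ y ∈ s₂, z = x + y) :
    (∀ κ ∈ s₁ ⊓ s₂, (∀ κ' ∈ s₁ ⊓ s₂, killingForm ℂ L κ κ' = 0) → κ = 0) ∧
    ∀ x ∈ s₁ ⊓ s₂, (∀ κ ∈ s₁ ⊓ s₂, ⁅κ, x⁆ = 0) →
      ∃ q r m : Polynomial ℂ, m ≠ 0 ∧ Good s₂ p₂ q r m p₁ x := by
  obtain ⟨q, hq1, hq2⟩ := exists_Q s₁ s₂ h1 h2 hsum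
  have hnd : ∀ κ ∈ s₁ ⊓ s₂, (∀ κ' ∈ s₁ ⊓ s₂, killingForm ℂ L κ κ' = 0) → κ = 0 := by
    intro κ hκ h
    refine kf_nondeg κ fun z => ?_
    rw [← hq2 κ hκ, Q_symm s₁ h1 h2, h _ (hq1 z)]
  refine ⟨hnd, fun x hx hxc => ?_⟩
  have hinj : Function.Injective (p₁ + p₂) := by
    rw [← LinearMap.ker_eq_bot, LinearMap.ker_eq_bot']
    intro v hv
    have hv1 : p₁ v = - p₂ v := eq_neg_of_add_eq_zero_left hv
    have hv0 : p₁ v = 0 := by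
      refine hnd _ ((LieSubalgebra.mem_inf _ _ _).2 ⟨h1.mem v, ?_⟩) fun κ hκ => ?_
      · rw [hv1]; exact neg_mem (h2.mem v)
      · have e1 := h1.kf v hκ.1
        have e2 := h2.kf v hκ.2
        have e3 : killingForm ℂ L (p₁ v) κ = - killingForm ℂ L (p₂ v) κ := by
          rw [hv1, map_neg, LinearMap.neg_apply]
        rw [e1, e2] at e3
        rw [e1]; linear_combination e3 / 2
    have hv0' : p₂ v = 0 := by rw [hv0] at hv1; exact neg_eq_zero.1 hv1.symm
    refine kf_nondeg v fun z => ?_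
    obtain ⟨a, ha, b, hb, rfl⟩ := hsum z
    rw [map_add, ← h1.kf v ha, ← h2.kf v hb, hv0, hv0']; simp
  set P := p₁ + p₂ with hP
  have hf := LinearMap.minpoly_coeff_zero_of_injective hinj
  have hf2 := minpoly.aeval ℂ P
  rw [← Polynomial.divX_mul_X_add (minpoly ℂ P)] at hf2
  rw [map_add, map_mul, Polynomial.aeval_X, Polynomial.aeval_C] at hf2
  set c := (minpoly ℂ P).coeff 0
  refine ⟨q, Polynomial.C (-c⁻¹) * (minpoly ℂ P).divX, minpoly ℂ (ad ℂ L x),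
    minpoly.ne_zero (Algebra.IsIntegral.isIntegral _), fun a b => ?_, fun a => ?_, ?_,
    fun a ha => hxc _ ((LieSubalgebra.mem_inf _ _ _).2 ⟨h1.mem a, ha⟩), fun ξ => (hq1 ξ).2,
    fun ξ => ⟨_, (h1.fix (hq1 ξ).1).symm⟩, fun ξ => ?_, minpoly.aeval _ _⟩
  · exact ⟨⁅p₁ a, p₁ b⁆, (h1.fix (s₁.lie_mem (h1.mem a) (h1.mem b))).symm⟩
  · exact h1.comm_ad _ (h1.mem a)
  · have hc : P * Polynomial.aeval P (minpoly ℂ P).divX = - algebraMap ℂ _ c := by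
      rw [← eq_neg_iff_add_eq_zero] at hf2
      rw [← hf2]
      have hcm := (Polynomial.commute_X (minpoly ℂ P).divX).map (Polynomial.aeval P)
      rw [Polynomial.aeval_X] at hcm
      exact hcm.eq
    rw [map_mul, Polynomial.aeval_C, ← Algebra.smul_def, mul_smul_comm, hc,
      ← map_neg, Algebra.algebraMap_eq_smul_one, smul_smul]
    rw [neg_mul_neg, inv_mul_cancel₀ hf, one_smul]
  · rw [Q_symm s₁ h1 h2, hq2 x hx]

theorem radical_of_center (h1 : IsOProj s₁.toSubmodule p₁) (h2 : IsOProj s₂.toSubmodule p₂)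
    (hsum : ∀ z : L, ∃ x ∈ s₁, ∃ y ∈ s₂, z = x + y)
    (hz : ∀ x ∈ s₁ ⊓ s₂, (∀ κ ∈ s₁ ⊓ s₂, ⁅κ, x⁆ = 0) → x = 0) :
    HasTrivialRadical ℂ ↥(s₁ ⊓ s₂) := by
  obtain ⟨q, hq1, hq2⟩ := exists_Q s₁ s₂ h1 h2 hsum
  rw [hasTrivialRadical_iff_no_abelian_ideals]
  intro A hAb
  rw [LieSubmodule.eq_bot_iff]
  intro x hx
  let k := s₁ ⊓ s₂
  let a : Submodule ℂ L := Submodule.map k.toSubmodule.subtype A.toSubmodule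
  have ham : ∀ v ∈ a, ∃ h : v ∈ k, (⟨v, h⟩ : k) ∈ A := by
    rintro _ ⟨v, hv, rfl⟩; exact ⟨v.2, hv⟩
  refine Subtype.ext (hz x x.2 fun κ hκ => ?_)
  refine ab_central k a (Polynomial.aeval ((1 - p₁) + (1 - p₂)) q) ?_ ?_ ?_ hq1 ?_ ?_ κ hκ x ⟨x, hx, rfl⟩
  · rintro x hx _ ⟨y, hy, rfl⟩
    exact ⟨⁅(⟨x, hx⟩ : k), y⁆, A.lie_mem hy, rfl⟩
  · intro y hy; exact (ham y hy).1
  · intro x hx y hy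
    obtain ⟨h3, h4⟩ := ham x hx
    obtain ⟨h5, h6⟩ := ham y hy
    have := hAb.trivial ⟨_, h4⟩ ⟨_, h6⟩
    exact congrArg (fun z : A => ((z : k) : L)) this
  · intro v hv
    exact hq2 v (ham v hv).1
  · intro x hx v
    exact (LinearMap.congr_fun (comm_T s₁ s₂ h1 h2 x hx q).eq v).symm

end good
end Dis
end

section
open Module LieAlgebra
set_option linter.unusedSectionVars false

namespace Dis
universe u
section vf
variable {W : Type u} [AddCommGroup W] [Module ℂ W] (O : Set W)

/-- evaluation of formal polynomials in linear functionals -/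
noncomputable def evO : MvPolynomial (Dual ℂ W) ℂ →ₐ[ℂ] (O → ℂ) :=
  MvPolynomial.aeval (fun ℓ => fun o => ℓ o)

/-- regular functions on `O` -/
noncomputable def Reg : Subalgebra ℂ (O → ℂ) := (evO O).range

variable {O}

lemma reg_lin (ℓ : Dual ℂ W) : (fun o : O => ℓ o) ∈ Reg O :=
  ⟨MvPolynomial.X ℓ, by simp [evO]⟩

/-- velocity vectors at a point -/
def IsVel (o : O) (v : W) : Prop :=
  ∃ γ : ℂ → O, γ 0 = o ∧ ∀ ℓ : Dual ℂ W, HasDerivAt (fun t => ℓ (γ t)) (ℓ v) 0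

lemma reg_induct {S : Submodule ℂ (Reg O)} (h1 : 1 ∈ S)
    (hm : ∀ a ∈ S, ∀ ℓ : Dual ℂ W, a * ⟨_, reg_lin ℓ⟩ ∈ S) : S = ⊤ := by
  rw [eq_top_iff]
  rintro ⟨_, φ, rfl⟩ -
  have key : ∀ φ : MvPolynomial (Dual ℂ W) ℂ, (⟨evO O φ, φ, rfl⟩ : Reg O) ∈ S := by
    intro φ
    induction φ using MvPolynomial.induction_on with
    | C c =>
      have : (⟨evO O (MvPolynomial.C c), _, rfl⟩ : Reg O) = c • 1 := by
        apply Subtype.ext; funext o; simp [evO]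
      rw [this]; exact S.smul_mem c h1
    | add p q hp hq =>
      have : (⟨evO O (p + q), _, rfl⟩ : Reg O) = ⟨evO O p, _, rfl⟩ + ⟨evO O q, _, rfl⟩ := by
        apply Subtype.ext; exact map_add _ _ _
      rw [this]; exact S.add_mem hp hq
    | mul_X p ℓ hp =>
      have : (⟨evO O (p * MvPolynomial.X ℓ), _, rfl⟩ : Reg O) =
        ⟨evO O p, _, rfl⟩ * ⟨_, reg_lin ℓ⟩ := by
        apply Subtype.ext; funext o; simp [evO]
      rw [this]; exact hm _ hp _
  exact key φ

theorem exists_D (ξ : O → W) (hξ : ∀ ℓ : Dual ℂ W, (fun o => ℓ (ξ o)) ∈ Reg O)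
    (ht : ∀ o, ξ o ∈ Submodule.span ℂ {v | IsVel o v}) :
    ∃ D : Reg O →ₗ[ℂ] Reg O, (∀ a b, D (a * b) = a * D b + D a * b) ∧
      ∀ ℓ : Dual ℂ W, D ⟨_, reg_lin ℓ⟩ = ⟨_, hξ ℓ⟩ := by
  have hξ2 := hξ
  choose P hP using hξ2
  let D' : Derivation ℂ (MvPolynomial (Dual ℂ W) ℂ) (MvPolynomial (Dual ℂ W) ℂ) :=
    MvPolynomial.mkDerivation ℂ P
  have hD'X : ∀ ℓ, D' (MvPolynomial.X ℓ) = P ℓ := fun ℓ => MvPolynomial.mkDerivation_X _ _ _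
  have hevX : ∀ ℓ o, evO O (MvPolynomial.X ℓ) o = ℓ o := fun ℓ o => by simp [evO]
  have hP' : ∀ ℓ o, evO O (P ℓ) o = ℓ (ξ o) := fun ℓ o => congrFun (hP ℓ) o
  have key : ∀ (o : O) (φ : MvPolynomial (Dual ℂ W) ℂ), ∃ d : W →ₗ[ℂ] ℂ,
      (∀ (γ : ℂ → O) (v : W), γ 0 = o →
        (∀ ℓ : Dual ℂ W, HasDerivAt (fun t => ℓ (γ t)) (ℓ v) 0) →
        HasDerivAt (fun t => evO O φ (γ t)) (d v) 0) ∧ evO O (D' φ) o = d (ξ o) := by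
    intro o φ
    induction φ using MvPolynomial.induction_on with
    | C c =>
      refine ⟨0, fun γ v _ _ => ?_, ?_⟩
      · simpa [evO] using hasDerivAt_const (0 : ℂ) c
      · rw [show D' (MvPolynomial.C c) = 0 from MvPolynomial.derivation_C _ _]; simp
    | add p q hp hq =>
      obtain ⟨d, h1, h2⟩ := hp
      obtain ⟨d', h3, h4⟩ := hq
      refine ⟨d + d', fun γ v h5 h6 => ?_, ?_⟩
      · simp only [map_add, Pi.add_apply]; exact (h1 γ v h5 h6).add (h3 γ v h5 h6)
      · simp [h2, h4]
    | mul_X p ℓ hp =>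
      obtain ⟨d, h1, h2⟩ := hp
      refine ⟨evO O p o • ℓ + ℓ o • d, fun γ v h5 h6 => ?_, ?_⟩
      · have := (h1 γ v h5 h6).mul (h6 ℓ)
        rw [h5] at this
        simp only [map_mul, Pi.mul_apply, hevX]
        have e : (evO O p o • ℓ + ℓ o • d) v = d v * ℓ o + evO O p o * ℓ v := by
          change evO O p o * ℓ v + ℓ o * d v = d v * ℓ o + evO O p o * ℓ v
          ring
        rw [e]; exact this
      · simp [hD'X, h2, hevX, hP']
  have hker : ∀ φ, evO O φ = 0 → evO O (D' φ) = 0 := by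
    intro φ hφ
    funext o
    obtain ⟨d, h1, h2⟩ := key o φ
    rw [h2]
    have hle : Submodule.span ℂ {v | IsVel o v} ≤ LinearMap.ker d := by
      rw [Submodule.span_le]
      rintro v ⟨γ, h3, h4⟩
      have h5 := h1 γ v h3 h4
      rw [hφ] at h5
      exact h5.unique (hasDerivAt_const (0 : ℂ) (0 : ℂ))
    exact hle (ht o)
  have hwd : ∀ φ ψ, evO O φ = evO O ψ → evO O (D' φ) = evO O (D' ψ) := by
    intro φ ψ h
    have := hker (φ - ψ) (by rw [map_sub, h, sub_self])
    rwa [map_sub, map_sub, sub_eq_zero] at this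
  choose lift hlift using fun a : Reg O => a.2
  have hl : ∀ a φ, evO O φ = a.1 → evO O (D' (lift a)) = evO O (D' φ) := fun a φ h =>
    hwd _ _ ((hlift a).trans h.symm)
  let D : Reg O →ₗ[ℂ] Reg O :=
    { toFun := fun a => ⟨evO O (D' (lift a)), _, rfl⟩
      map_add' := fun a b => Subtype.ext (by
        change evO O (D' (lift (a + b))) = evO O (D' (lift a)) + evO O (D' (lift b))
        rw [hl (a + b) (lift a + lift b) (by rw [map_add]; exact congrArg₂ _ (hlift a) (hlift b)),
          map_add, map_add])
      map_smul' := fun c a => Subtype.ext (by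
        change evO O (D' (lift (c • a))) = c • evO O (D' (lift a))
        rw [hl (c • a) (c • lift a) (by rw [map_smul]; exact congrArg _ (hlift a)),
          Derivation.map_smul, map_smul]) }
  refine ⟨D, fun a b => Subtype.ext ?_, fun ℓ => Subtype.ext ?_⟩
  · change evO O (D' (lift (a * b))) = a.1 * evO O (D' (lift b)) + evO O (D' (lift a)) * b.1
    rw [hl (a * b) (lift a * lift b) (by rw [map_mul]; exact congrArg₂ _ (hlift a) (hlift b)),
      Derivation.leibniz, map_add, smul_eq_mul, smul_eq_mul, map_mul, map_mul]
    have ha : evO O (lift a) = a.1 := hlift a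
    have hb : evO O (lift b) = b.1 := hlift b
    rw [ha, hb, mul_comm b.1]
  · change evO O (D' (lift _)) = _
    rw [hl _ (MvPolynomial.X ℓ) (by funext o; exact hevX ℓ o), hD'X]
    exact hP ℓ

end vf
end Dis
end

section
open Module LieAlgebra
set_option linter.unusedSectionVars false

namespace Dis
universe u
section vd
variable {W : Type u} [AddCommGroup W] [Module ℂ W] {O : Set W}
variable {V V' V'' : Type*} [AddCommGroup V] [Module ℂ V] [AddCommGroup V'] [Module ℂ V']
  [AddCommGroup V''] [Module ℂ V'']

/-- `v'` is the derivative of the regular vector valued function `v` -/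
def VD (D : Reg O →ₗ[ℂ] Reg O) (v v' : O → V) : Prop :=
  ∀ ℓ : Dual ℂ V, ∃ (h : (fun o => ℓ (v o)) ∈ Reg O) (h' : (fun o => ℓ (v' o)) ∈ Reg O),
    D ⟨_, h⟩ = ⟨_, h'⟩

/-- regular vector valued functions -/
def AV (v : O → V) : Prop := ∀ ℓ : Dual ℂ V, (fun o => ℓ (v o)) ∈ Reg O

variable {D : Reg O →ₗ[ℂ] Reg O} {v v' u u' : O → V}

lemma vd_aux {f f' : O → ℂ} (a a' : Reg O) (h : D a = a') (e : ∀ o, a.1 o = f o)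
    (e' : ∀ o, a'.1 o = f' o) : ∃ (h : f ∈ Reg O) (h' : f' ∈ Reg O), D ⟨f, h⟩ = ⟨f', h'⟩ := by
  obtain ⟨a, ha⟩ := a
  obtain ⟨a', ha'⟩ := a'
  obtain rfl : a = f := funext e
  obtain rfl : a' = f' := funext e'
  exact ⟨ha, ha', h⟩

lemma AV.vd (h : AV v) : VD (0 : Reg O →ₗ[ℂ] Reg O) v 0 := fun ℓ =>
  vd_aux ⟨_, h ℓ⟩ 0 rfl (fun _ => rfl) (fun _ => (map_zero ℓ).symm)

lemma VD.av (h : VD D v v') : AV v := fun ℓ => (h ℓ).1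
lemma VD.av' (h : VD D v v') : AV v' := fun ℓ => (h ℓ).2.1

lemma VD.eq (h : VD D v v') (ℓ : Dual ℂ V) (h1 : (fun o => ℓ (v o)) ∈ Reg O)
    (h2 : (fun o => ℓ (v' o)) ∈ Reg O) : D ⟨_, h1⟩ = ⟨_, h2⟩ := (h ℓ).2.2

lemma VD.congr (h : VD D v v') (e : ∀ o, v' o = u' o) : VD D v u' := by
  rwa [show u' = v' from (funext e).symm]

lemma VD.congr_left (h : VD D v v') (e : ∀ o, v o = u o) : VD D u v' := by
  rwa [show u = v from (funext e).symm]

lemma VD.add (h : VD D v v') (h' : VD D u u') : VD D (fun o => v o + u o) (fun o => v' o + u' o) := by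
  intro ℓ
  obtain ⟨a, b, c⟩ := h ℓ
  obtain ⟨a', b', c'⟩ := h' ℓ
  exact vd_aux (⟨_, a⟩ + ⟨_, a'⟩) _ (by rw [map_add, c, c']) (fun o => (map_add ℓ _ _).symm)
    (fun o => (map_add ℓ _ _).symm)

lemma VD.lin (h : VD D v v') (f : V →ₗ[ℂ] V') : VD D (fun o => f (v o)) (fun o => f (v' o)) :=
  fun ℓ => h (ℓ ∘ₗ f)

lemma VD.neg (h : VD D v v') : VD D (fun o => - v o) (fun o => - v' o) := h.lin (-LinearMap.id)

lemma VD.sub (h : VD D v v') (h' : VD D u u') : VD D (fun o => v o - u o) (fun o => v' o - u' o) := by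
  simpa only [sub_eq_add_neg] using h.add h'.neg

lemma VD.sum {ι : Type*} (s : Finset ι) (f f' : ι → O → V) (h : ∀ i, VD D (f i) (f' i)) (h0 : VD D (0 : O → V) 0) :
    VD D (fun o => ∑ i ∈ s, f i o) (fun o => ∑ i ∈ s, f' i o) := by
  classical
  induction s using Finset.induction_on with
  | empty => exact h0
  | insert a s ha ih => simpa [Finset.sum_insert ha] using (h a).add ih

/-- the derivation property -/
def Leib (D : Reg O →ₗ[ℂ] Reg O) : Prop := ∀ a b, D (a * b) = a * D b + D a * b

lemma Leib.one (hD : Leib D) : D 1 = 0 := by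
  have := hD 1 1
  simp only [mul_one, one_mul] at this
  simpa using this

lemma leib_zero : Leib (0 : Reg O →ₗ[ℂ] Reg O) := fun a b => by simp

lemma VD.const (hD : Leib D) (c : V) : VD D (fun _ => c) (fun _ => 0) := by
  intro ℓ
  exact vd_aux (ℓ c • 1) 0 (by rw [map_smul, hD.one, smul_zero]) (fun o => mul_one _)
    (fun o => (map_zero ℓ).symm)

lemma VD.zero (hD : Leib D) : VD D (0 : O → V) 0 := VD.const hD 0

lemma VD.smul (hD : Leib D) {a a' : O → ℂ} (h : VD D a a') (h' : VD D u u') :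
    VD D (fun o => a o • u o) (fun o => a o • u' o + a' o • u o) := by
  intro ℓ
  obtain ⟨h1, h2, h3⟩ := h LinearMap.id
  obtain ⟨h4, h5, h6⟩ := h' ℓ
  exact vd_aux (⟨_, h1⟩ * ⟨_, h4⟩) _ (by rw [hD, h3, h6]) (fun o => by rw [map_smul]; rfl)
    (fun o => by rw [map_add, map_smul, map_smul]; rfl)

lemma VD.bilin [Module.Finite ℂ V] (hD : Leib D) {t t' : O → V'}
    (h : VD D v v') (h' : VD D t t') (β : V →ₗ[ℂ] V' →ₗ[ℂ] V'') :
    VD D (fun o => β (v o) (t o)) (fun o => β (v' o) (t o) + β (v o) (t' o)) := by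
  let b := Module.finBasis ℂ V
  have key : ∀ (x : V) (y : V'), β x y = ∑ i, b.coord i x • β (b i) y := by
    intro x y
    conv_lhs => rw [← b.sum_repr x]
    rw [map_sum, LinearMap.sum_apply]
    simp
  have := VD.sum Finset.univ (fun i o => b.coord i (v o) • β (b i) (t o))
    (fun i o => b.coord i (v o) • β (b i) (t' o) + b.coord i (v' o) • β (b i) (t o))
    (fun i => (h.lin (b.coord i)).smul hD (h'.lin (β (b i)))) (VD.zero hD)
  refine (this.congr_left fun o => (key _ _).symm).congr fun o => ?_
  rw [key (v' o), key (v o), ← Finset.sum_add_distrib]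
  exact Finset.sum_congr rfl fun i _ => add_comm _ _

lemma VD.mul [Module.Finite ℂ V] (hD : Leib D) {A A' B B' : O → End ℂ V} (h : VD D A A') (h' : VD D B B') :
    VD D (fun o => A o * B o) (fun o => A' o * B o + A o * B' o) :=
  h.bilin hD h' (LinearMap.mul ℂ (End ℂ V))

lemma VD.app [Module.Finite ℂ V] (hD : Leib D) {A A' : O → End ℂ V} (h : VD D A A') (h' : VD D v v') :
    VD D (fun o => A o (v o)) (fun o => A' o (v o) + A o (v' o)) :=
  h.bilin hD h' LinearMap.id

lemma VD.aeval [Module.Finite ℂ V] (hD : Leib D) {A C : O → End ℂ V}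
    (h : VD D A (fun o => C o * A o - A o * C o)) (p : Polynomial ℂ) :
    VD D (fun o => Polynomial.aeval (A o) p)
      (fun o => C o * Polynomial.aeval (A o) p - Polynomial.aeval (A o) p * C o) := by
  have hpow : ∀ n : ℕ, VD D (fun o => A o ^ n) (fun o => C o * A o ^ n - A o ^ n * C o) := by
    intro n
    induction n with
    | zero =>
      refine (VD.const hD (1 : End ℂ V)).congr fun o => ?_
      simp
    | succ n ih =>
      refine ((ih.mul hD h).congr_left fun o => (pow_succ _ _).symm).congr fun o => ?_
      rw [pow_succ]; noncomm_ring
  induction p using Polynomial.induction_on' with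
  | add p q hp hq =>
    refine ((hp.add hq).congr_left fun o => ?_).congr fun o => ?_
    · rw [map_add]
    · rw [map_add]; noncomm_ring
  | monomial n c =>
    have := (hpow n).lin (c • LinearMap.id)
    refine (this.congr_left fun o => ?_).congr fun o => ?_
    · rw [Polynomial.aeval_monomial, ← Algebra.smul_def]; rfl
    · rw [Polynomial.aeval_monomial, ← Algebra.smul_def]
      simp [smul_sub]

lemma AV.bilin [Module.Finite ℂ V] {t : O → V'} (h : AV v) (h' : AV t) (β : V →ₗ[ℂ] V' →ₗ[ℂ] V'') :
    AV (fun o => β (v o) (t o)) := (h.vd.bilin leib_zero h'.vd β).av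
lemma AV.add (h : AV v) (h' : AV u) : AV (fun o => v o + u o) := (h.vd.add h'.vd).av
lemma AV.sub (h : AV v) (h' : AV u) : AV (fun o => v o - u o) := (h.vd.sub h'.vd).av
lemma AV.const (c : V) : AV (fun _ : O => c) := (VD.const (D := (0 : Reg O →ₗ[ℂ] Reg O)) leib_zero c).av
lemma AV.lin (h : AV v) (f : V →ₗ[ℂ] V') : AV (fun o => f (v o)) := (h.vd.lin f).av
lemma AV.mul [Module.Finite ℂ V] {A B : O → End ℂ V} (h : AV A) (h' : AV B) :
    AV (fun o => A o * B o) := h.bilin h' (LinearMap.mul ℂ (End ℂ V))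
lemma AV.app [Module.Finite ℂ V] {A : O → End ℂ V} (h : AV A) (h' : AV v) :
    AV (fun o => A o (v o)) := h.bilin h' LinearMap.id
lemma AV.aeval [Module.Finite ℂ V] {A : O → End ℂ V} (h : AV A) (p : Polynomial ℂ) :
    AV (fun o => Polynomial.aeval (A o) p) := by
  have : VD (0 : Reg O →ₗ[ℂ] Reg O) A (fun o => 0 * A o - A o * 0) := h.vd.congr fun o => by simp
  exact (VD.aeval (C := fun _ => 0) leib_zero this p).av

lemma av_id [Module.Finite ℂ W] : AV (fun o : O => (o : W)) := fun ℓ => reg_lin ℓ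

end vd
end Dis
end

section
open Module LieAlgebra
set_option linter.unusedSectionVars false

namespace Dis
universe u

lemma hda_u (i : ℕ) : HasDerivAt (fun t : ℂ => t ^ i / (i.factorial : ℂ)) (if i = 1 then 1 else 0) 0 := by
  have h := (hasDerivAt_pow i (0 : ℂ)).div_const (i.factorial : ℂ)
  have e : ((i : ℂ) * 0 ^ (i - 1) / (i.factorial : ℂ)) = if i = 1 then 1 else 0 := by
    rcases i with _ | _ | i
    · simp
    · simp
    · simp
  rw [e] at h
  exact h

lemma hda_v (i : ℕ) : HasDerivAt (fun t : ℂ => (-t) ^ i / (i.factorial : ℂ)) (if i = 1 then -1 else 0) 0 := by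
  have h0 : HasDerivAt (fun t : ℂ => t ^ i / (i.factorial : ℂ)) (if i = 1 then 1 else 0) (-0) := by
    rw [neg_zero]; exact hda_u i
  have h := h0.comp (0 : ℂ) (hasDerivAt_neg (0 : ℂ))
  have e : (if i = 1 then (1 : ℂ) else 0) * -1 = if i = 1 then -1 else 0 := by split <;> simp
  rw [e] at h
  exact h

lemma u_zero (i : ℕ) : (0 : ℂ) ^ i / (i.factorial : ℂ) = if i = 0 then 1 else 0 := by
  rcases i with _ | i <;> simp

lemma v_zero (i : ℕ) : (-0 : ℂ) ^ i / (i.factorial : ℂ) = if i = 0 then 1 else 0 := by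
  rw [neg_zero, u_zero]

lemma hda1 (k : ℕ) (a : ℕ → ℂ) :
    HasDerivAt (fun t : ℂ => ∑ i ∈ Finset.range (k+2), t ^ i / (i.factorial : ℂ) * a i) (a 1) 0 := by
  have h := HasDerivAt.fun_sum (u := Finset.range (k+2)) (fun i _ => (hda_u i).mul_const (a i))
  have e : ∑ i ∈ Finset.range (k+2), (if i = 1 then (1:ℂ) else 0) * a i = a 1 := by
    simp
  rw [e] at h
  exact h

lemma hda2 (k : ℕ) (a : ℕ → ℕ → ℂ) :
    HasDerivAt (fun t : ℂ => ∑ i ∈ Finset.range (k+2), ∑ j ∈ Finset.range (k+2),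
      t ^ i / (i.factorial : ℂ) * ((-t) ^ j / (j.factorial : ℂ)) * a i j) (a 1 0 - a 0 1) 0 := by
  have h := HasDerivAt.fun_sum (u := Finset.range (k+2)) (fun i _ =>
    HasDerivAt.fun_sum (u := Finset.range (k+2)) (fun j _ =>
    (((hda_u i).mul (hda_v j)).mul_const (a i j))))
  simp only [u_zero, v_zero] at h
  have e : ∑ i ∈ Finset.range (k+2), ∑ j ∈ Finset.range (k+2),
    ((if i = 1 then (1:ℂ) else 0) * (if j = 0 then (1:ℂ) else 0) +
      (if i = 0 then (1:ℂ) else 0) * (if j = 1 then (-1:ℂ) else 0)) * a i j = a 1 0 - a 0 1 := by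
    simp [add_mul, Finset.sum_add_distrib, Finset.sum_ite_eq, sub_eq_add_neg]
  rw [e] at h
  exact h

section setup
variable {L : Type u} [LieRing L] [LieAlgebra ℂ L] [Module.Finite ℂ L] [HasTrivialRadical ℂ L]

lemma nil_span_sub (s : LieSubalgebra ℂ L) [HasTrivialRadical ℂ s] (c : L) (hc : c ∈ s) :
    c ∈ Submodule.span ℂ {e : L | e ∈ s ∧ IsNilpotent (ad ℂ L e)} := by
  have h : (⟨c, hc⟩ : s) ∈ nilSpan s := by rw [nilSpan_eq_top]; trivial
  have h2 : (⊤ : Submodule ℂ s) ≤ (Submodule.span ℂ {e : L | e ∈ s ∧ IsNilpotent (ad ℂ L e)}).comap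
      s.toSubmodule.subtype := by
    rw [← nilSpan_eq_top (L := s), nilSpan, Submodule.span_le]
    intro e he
    exact Submodule.subset_span ⟨e.2, nil_rep (subRep s (ad ℂ L : L →ₗ[ℂ] End ℂ L)) (isRep_ad.sub s) e he⟩
  exact h2 (x := ⟨c, hc⟩) trivial

variable (s₂ : LieSubalgebra ℂ L) (p₂ : End ℂ L) (q r m : Polynomial ℂ)

/-- the variety of admissible pairs -/
def Og : Set (End ℂ L × L) := {o | Good s₂ p₂ q r m o.1 o.2}

variable {s₂ p₂ q r m}
/-- the operator `τ` -/
noncomputable def tau (o : Og s₂ p₂ q r m) : End ℂ L := p₂ * Polynomial.aeval (o.1.1 + p₂) r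

lemma tau_mem (h2 : IsOProj s₂.toSubmodule p₂) (o : Og s₂ p₂ q r m) (z : L) : tau o z ∈ s₂ := h2.mem _

lemma tau_diff (o : Og s₂ p₂ q r m) (z : L) : ∃ a, z - tau o z = o.1.1 a := by
  refine ⟨Polynomial.aeval (o.1.1 + p₂) r z, ?_⟩
  have := LinearMap.congr_fun o.2.inv z
  change o.1.1 _ + p₂ _ = z at this
  rw [sub_eq_iff_eq_add]; exact this.symm

lemma vel (h2 : IsOProj s₂.toSubmodule p₂) (o : Og s₂ p₂ q r m) (c : L) (hc : c ∈ s₂)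
    (hn : IsNilpotent (ad ℂ L c)) :
    IsVel o (ad ℂ L c * o.1.1 - o.1.1 * ad ℂ L c, ⁅c, o.1.2⁆) := by
  obtain ⟨k, hk⟩ := hn
  obtain ⟨g, hg, hg'⟩ := exists_exp c (k + 2) (by rw [pow_add, hk, zero_mul])
  have hp : ∀ t, cjg (g t) p₂ = p₂ := by
    intro t
    have hc : Commute (ad ℂ L c) p₂ := h2.comm_ad c hc
    have h3 : ∀ v, g t (p₂ v) = p₂ (g t v) := by
      intro v
      rw [hg, hg, map_sum]
      refine Finset.sum_congr rfl fun i _ => ?_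
      rw [map_smul]
      congr 1
      exact LinearMap.congr_fun (hc.pow_left i).eq v
    ext v
    rw [cjg_apply, h3, LieEquiv.apply_symm_apply]
  have hw : ∀ t, cjg (g t) o.1.1 = ∑ i ∈ Finset.range (k+2), ∑ j ∈ Finset.range (k+2),
      (t ^ i / (i.factorial : ℂ) * ((-t) ^ j / (j.factorial : ℂ))) •
        ((ad ℂ L c) ^ i * o.1.1 * (ad ℂ L c) ^ j) := by
    intro t
    ext v
    rw [cjg_apply, hg, hg', LinearMap.sum_apply]
    refine Finset.sum_congr rfl fun i _ => ?_
    rw [map_sum, map_sum, Finset.smul_sum, LinearMap.sum_apply]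
    refine Finset.sum_congr rfl fun j _ => ?_
    rw [map_smul, map_smul, smul_smul]
    rfl
  have hy : ∀ t, g t o.1.2 = ∑ i ∈ Finset.range (k+2), (t ^ i / (i.factorial : ℂ)) •
    ((ad ℂ L c) ^ i) o.1.2 := fun t => hg t _
  have hg0 : ∀ v, g 0 v = v := by
    intro v
    rw [hg]
    simp only [u_zero]
    simp
  refine ⟨fun t => ⟨(cjg (g t) o.1.1, g t o.1.2), o.2.act h2 (g t) (hp t)⟩, ?_, fun ℓ => ?_⟩
  · refine Subtype.ext (Prod.ext ?_ (hg0 _))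
    ext v
    change cjg (g 0) o.1.1 v = _
    obtain ⟨v, rfl⟩ : ∃ u, v = g 0 u := ⟨v, (hg0 v).symm⟩
    rw [cjg_apply', hg0, hg0]
  · have e : ∀ a b, ℓ (a, b) = ℓ (a, 0) + ℓ (0, b) := fun a b => by
      rw [← map_add]; simp
    have h3 := hda2 k (fun i j => ℓ ((ad ℂ L c) ^ i * o.1.1 * (ad ℂ L c) ^ j, 0))
    have h4 := hda1 k (fun i => ℓ (0, ((ad ℂ L c) ^ i) o.1.2))
    have h5 := h3.add h4
    have h6 : (fun t => ℓ (cjg (g t) o.1.1, g t o.1.2)) =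
      (fun t : ℂ => ∑ i ∈ Finset.range (k+2), ∑ j ∈ Finset.range (k+2),
      t ^ i / (i.factorial : ℂ) * ((-t) ^ j / (j.factorial : ℂ)) *
        ℓ ((ad ℂ L c) ^ i * o.1.1 * (ad ℂ L c) ^ j, 0)) +
      (fun t : ℂ => ∑ i ∈ Finset.range (k+2), t ^ i / (i.factorial : ℂ) *
        ℓ (0, ((ad ℂ L c) ^ i) o.1.2)) := by
      funext t
      rw [e]
      have e1 : ∀ a, ℓ (a, 0) = (ℓ ∘ₗ LinearMap.inl ℂ _ _) a := fun a => rfl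
      have e2 : ∀ a, ℓ (0, a) = (ℓ ∘ₗ LinearMap.inr ℂ _ _) a := fun a => rfl
      rw [hw, hy, e1, e2, map_sum, map_sum]
      simp only [map_sum, map_smul]
      rfl
    change HasDerivAt (fun t => ℓ (cjg (g t) o.1.1, g t o.1.2)) _ 0
    have e1 : ∀ a b, ℓ (a - b, 0) = ℓ (a, 0) - ℓ (b, 0) := fun a b => by
      rw [← map_sub]; simp
    have e7 : ℓ (ad ℂ L c * o.1.1 - o.1.1 * ad ℂ L c, ⁅c, o.1.2⁆) =
        ℓ ((ad ℂ L c) ^ 1 * o.1.1 * (ad ℂ L c) ^ 0, 0) -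
        ℓ ((ad ℂ L c) ^ 0 * o.1.1 * (ad ℂ L c) ^ 1, 0) + ℓ (0, ((ad ℂ L c) ^ 1) o.1.2) := by
      rw [e, e1]; simp
    rw [e7, h6]
    exact h5

end setup
end Dis
end

section
open Module LieAlgebra
set_option linter.unusedSectionVars false

namespace Dis
universe u

section vdmore
variable {W : Type u} [AddCommGroup W] [Module ℂ W] {O : Set W}
variable {V : Type*} [AddCommGroup V] [Module ℂ V]
variable {D D' : Reg O →ₗ[ℂ] Reg O} {v v' v'' : O → V}

lemma VD.comp (h : VD D v v') (h' : VD D' v' v'') : VD (D' ∘ₗ D) v v'' := by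
  intro ℓ
  obtain ⟨a, b, c⟩ := h ℓ
  obtain ⟨a', b', c'⟩ := h' ℓ
  exact ⟨a, b', by rw [LinearMap.comp_apply, c, c']⟩

lemma VD.addD (h : VD D v v') (h' : VD D' v v'') : VD (D + D') v (fun o => v' o + v'' o) := by
  intro ℓ
  obtain ⟨a, b, c⟩ := h ℓ
  obtain ⟨a', b', c'⟩ := h' ℓ
  exact vd_aux ⟨_, a⟩ (⟨_, b⟩ + ⟨_, b'⟩) (by rw [LinearMap.add_apply, c, c']) (fun o => rfl)
    (fun o => (map_add ℓ _ _).symm)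

lemma VD.smulD (h : VD D v v') (k : ℂ) : VD (k • D) v (fun o => k • v' o) := by
  intro ℓ
  obtain ⟨a, b, c⟩ := h ℓ
  exact vd_aux ⟨_, a⟩ (k • ⟨_, b⟩) (by rw [LinearMap.smul_apply, c]) (fun o => rfl)
    (fun o => (map_smul ℓ _ _).symm)

lemma VD.subD (h : VD D v v') (h' : VD D' v v'') : VD (D - D') v (fun o => v' o - v'' o) := by
  intro ℓ
  obtain ⟨a, b, c⟩ := h ℓ
  obtain ⟨a', b', c'⟩ := h' ℓ
  exact vd_aux ⟨_, a⟩ (⟨_, b⟩ - ⟨_, b'⟩) (by rw [LinearMap.sub_apply, c, c']) (fun o => rfl)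
    (fun o => (map_sub ℓ _ _).symm)

lemma Leib.comm (h : Leib D) (h' : Leib D') : Leib (D ∘ₗ D' - D' ∘ₗ D) := by
  intro a b
  simp only [LinearMap.sub_apply, LinearMap.comp_apply]
  rw [h, h', map_add, map_add, h, h', h, h']
  ring

lemma Leib.add (h : Leib D) (h' : Leib D') : Leib (D + D') := by
  intro a b
  simp only [LinearMap.add_apply]
  rw [h, h']; ring

lemma Leib.sub (h : Leib D) (h' : Leib D') : Leib (D - D') := by
  intro a b
  simp only [LinearMap.sub_apply]
  rw [h, h']; ring

lemma Leib.smul (h : Leib D) (k : ℂ) : Leib (k • D) := by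
  intro a b
  simp only [LinearMap.smul_apply]
  rw [h, smul_add, mul_smul_comm, smul_mul_assoc]

lemma Leib.eq_zero (h : Leib D) (h0 : VD D (fun o : O => (o : W)) 0) : D = 0 := by
  have : LinearMap.ker D = ⊤ := by
    refine reg_induct h.one fun a ha ℓ => ?_
    have e : D ⟨_, reg_lin ℓ⟩ = 0 := by
      obtain ⟨a', b', c'⟩ := h0 ℓ
      rw [c']
      exact Subtype.ext (funext fun o => map_zero ℓ)
    rw [LinearMap.mem_ker] at ha ⊢
    rw [h, e, ha, mul_zero, zero_mul, add_zero]
  exact LinearMap.ker_eq_top.1 this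

end vdmore

section setup
variable {L : Type u} [LieRing L] [LieAlgebra ℂ L] [Module.Finite ℂ L] [HasTrivialRadical ℂ L]
variable {s₂ : LieSubalgebra ℂ L} {p₂ : End ℂ L} {q r m : Polynomial ℂ}

lemma av_w : AV (fun o : Og s₂ p₂ q r m => o.1.1) :=
  AV.lin (v := fun o : Og s₂ p₂ q r m => o.1) av_id (LinearMap.fst ℂ (End ℂ L) L)
lemma av_y : AV (fun o : Og s₂ p₂ q r m => o.1.2) :=
  AV.lin (v := fun o : Og s₂ p₂ q r m => o.1) av_id (LinearMap.snd ℂ (End ℂ L) L)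
lemma av_tau : AV (fun o : Og s₂ p₂ q r m => tau o) :=
  (AV.const p₂).mul ((av_w.add (AV.const p₂)).aeval r)

lemma tau_app (o : Og s₂ p₂ q r m) (z : L) : tau o z = p₂ (Polynomial.aeval (o.1.1 + p₂) r z) := rfl

/-- bilinear bracket -/
noncomputable def brk : L →ₗ[ℂ] L →ₗ[ℂ] L := (ad ℂ L : L →ₗ[ℂ] End ℂ L)

@[simp] lemma brk_apply (x y : L) : brk x y = ⁅x, y⁆ := rfl

lemma av_tau_app (z : L) : AV (fun o : Og s₂ p₂ q r m => tau o z) := av_tau.app (AV.const z)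

lemma VD.pair {V V' : Type*} [AddCommGroup V] [Module ℂ V] [AddCommGroup V'] [Module ℂ V']
    {W : Type u} [AddCommGroup W] [Module ℂ W] {O : Set W}
    {D : Reg O →ₗ[ℂ] Reg O} {v v' : O → V} {u u' : O → V'} (h : VD D v v') (h' : VD D u u') :
    VD D (fun o => (v o, u o)) (fun o => (v' o, u' o)) := by
  have := (h.lin (LinearMap.inl ℂ V V')).add (h'.lin (LinearMap.inr ℂ V V'))
  refine (this.congr_left fun o => ?_).congr fun o => ?_ <;> simp

lemma exists_Dz [HasTrivialRadical ℂ s₂] (h2 : IsOProj s₂.toSubmodule p₂) (z : L) :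
    ∃ D : Reg (Og s₂ p₂ q r m) →ₗ[ℂ] Reg (Og s₂ p₂ q r m), Leib D ∧
      VD D (fun o => o.1.1) (fun o => ad ℂ L (tau o z) * o.1.1 - o.1.1 * ad ℂ L (tau o z)) ∧
      VD D (fun o => o.1.2) (fun o => ⁅tau o z, o.1.2⁆) := by
  have hξ : AV (fun o : Og s₂ p₂ q r m =>
      ((ad ℂ L (tau o z) * o.1.1 - o.1.1 * ad ℂ L (tau o z), ⁅tau o z, o.1.2⁆) : End ℂ L × L)) := by
    have h1 := ((av_tau_app (s₂ := s₂) (p₂ := p₂) (q := q) (r := r) (m := m) z).lin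
      (ad ℂ L : L →ₗ[ℂ] End ℂ L))
    have h3 := (h1.mul av_w).sub (av_w.mul h1)
    have h4 := (av_tau_app (s₂ := s₂) (p₂ := p₂) (q := q) (r := r) (m := m) z).bilin av_y (brk (L := L))
    exact (h3.vd.pair h4.vd).av
  obtain ⟨D, hD, hD2⟩ := exists_D _ hξ (fun o => by
    have hc := nil_span_sub s₂ _ (tau_mem h2 o z)
    let F : L →ₗ[ℂ] End ℂ L × L :=
      { toFun := fun c => (ad ℂ L c * o.1.1 - o.1.1 * ad ℂ L c, ⁅c, o.1.2⁆)
        map_add' := fun c c' => by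
          refine Prod.ext ?_ (add_lie _ _ _)
          simp only [map_add, Prod.fst_add]
          noncomm_ring
        map_smul' := fun k c => by
          refine Prod.ext ?_ (smul_lie _ _ _)
          simp [smul_sub] }
    have hF : Submodule.span ℂ {e : L | e ∈ s₂ ∧ IsNilpotent (ad ℂ L e)} ≤
        (Submodule.span ℂ {v | IsVel o v}).comap F := by
      rw [Submodule.span_le]
      rintro c ⟨h3, h4⟩
      exact Submodule.subset_span (vel h2 o c h3 h4)
    exact hF hc)
  have hV : VD D (fun o => o.1) _ := fun ℓ => ⟨reg_lin ℓ, hξ ℓ, hD2 ℓ⟩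
  exact ⟨D, hD, hV.lin (LinearMap.fst ℂ _ _), hV.lin (LinearMap.snd ℂ _ _)⟩

/-- elements of `s₂ ∩ im w` -/
def Kw (o : Og s₂ p₂ q r m) : Submodule ℂ L := s₂.toSubmodule ⊓ LinearMap.range o.1.1

lemma Kw_y {o : Og s₂ p₂ q r m} {u : L} (h : u ∈ Kw o) : ⁅u, o.1.2⁆ = 0 := by
  obtain ⟨h1, a, rfl⟩ := h
  exact o.2.ky a h1

lemma Im_w {o : Og s₂ p₂ q r m} {u : L} (h : u ∈ LinearMap.range o.1.1) :
    ad ℂ L u * o.1.1 - o.1.1 * ad ℂ L u = 0 := by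
  obtain ⟨a, rfl⟩ := h
  exact sub_eq_zero.2 (o.2.co a)

lemma tau_diff' (o : Og s₂ p₂ q r m) (z : L) : z - tau o z ∈ LinearMap.range o.1.1 := by
  obtain ⟨a, ha⟩ := tau_diff o z; exact ⟨a, ha.symm⟩

lemma tau_s2 (h2 : IsOProj s₂.toSubmodule p₂) (o : Og s₂ p₂ q r m) (z : L) (hz : z ∈ s₂) :
    z - tau o z ∈ Kw o := ⟨s₂.sub_mem hz (tau_mem h2 o z), tau_diff' o z⟩

lemma tau_im (h2 : IsOProj s₂.toSubmodule p₂) (o : Og s₂ p₂ q r m) (z : L)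
    (hz : z ∈ LinearMap.range o.1.1) : tau o z ∈ Kw o := by
  refine ⟨tau_mem h2 o z, ?_⟩
  have := Submodule.sub_mem _ hz (tau_diff' o z)
  rwa [sub_sub_cancel] at this

lemma im_lie (o : Og s₂ p₂ q r m) {u v : L} (hu : u ∈ LinearMap.range o.1.1)
    (hv : v ∈ LinearMap.range o.1.1) : ⁅u, v⁆ ∈ LinearMap.range o.1.1 := by
  obtain ⟨a, rfl⟩ := hu
  obtain ⟨b, rfl⟩ := hv
  obtain ⟨c, hc⟩ := o.2.cl a b
  exact ⟨c, hc.symm⟩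

lemma ad_tau_w (o : Og s₂ p₂ q r m) (z : L) :
    ad ℂ L (tau o z) * o.1.1 - o.1.1 * ad ℂ L (tau o z) = ad ℂ L z * o.1.1 - o.1.1 * ad ℂ L z := by
  have := Im_w (tau_diff' o z)
  rw [map_sub, sub_mul, mul_sub] at this
  rw [← sub_eq_zero, ← neg_eq_zero, ← this]
  abel

lemma VD_tau [HasTrivialRadical ℂ s₂] (h2 : IsOProj s₂.toSubmodule p₂) (z : L)
    {D : Reg (Og s₂ p₂ q r m) →ₗ[ℂ] Reg (Og s₂ p₂ q r m)} (hD : Leib D)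
    (hw : VD D (fun o => o.1.1) (fun o => ad ℂ L (tau o z) * o.1.1 - o.1.1 * ad ℂ L (tau o z))) :
    VD D (fun o => tau o) (fun o => ad ℂ L (tau o z) * tau o - tau o * ad ℂ L (tau o z)) := by
  have hc : ∀ o : Og s₂ p₂ q r m, ad ℂ L (tau o z) * p₂ = p₂ * ad ℂ L (tau o z) := fun o =>
    h2.comm_ad _ (tau_mem h2 o z)
  have h3 : VD D (fun o => o.1.1 + p₂)
      (fun o => ad ℂ L (tau o z) * (o.1.1 + p₂) - (o.1.1 + p₂) * ad ℂ L (tau o z)) :=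
    (hw.add (VD.const hD p₂)).congr fun o => by rw [mul_add, add_mul, hc]; abel
  have h4 := (VD.const hD p₂).mul hD (VD.aeval hD h3 r)
  refine h4.congr fun o => ?_
  have hh := hc o
  have e : tau o = p₂ * Polynomial.aeval (o.1.1 + p₂) r := rfl
  generalize ad ℂ L (tau o z) = c at hh ⊢
  rw [e, zero_mul, zero_add, mul_sub, ← mul_assoc, ← hh, mul_assoc, mul_assoc]

/-- all the vector field data -/
structure VF (D : L →ₗ[ℂ] (Reg (Og s₂ p₂ q r m) →ₗ[ℂ] Reg (Og s₂ p₂ q r m))) : Prop where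
  leib : ∀ z, Leib (D z)
  w : ∀ z, VD (D z) (fun o => o.1.1) (fun o => ad ℂ L z * o.1.1 - o.1.1 * ad ℂ L z)
  y : ∀ z, VD (D z) (fun o => o.1.2) (fun o => ⁅tau o z, o.1.2⁆)
  t : ∀ z, VD (D z) (fun o => tau o) (fun o => ad ℂ L (tau o z) * tau o - tau o * ad ℂ L (tau o z))
  br : ∀ z z', D ⁅z, z'⁆ = D z' ∘ₗ D z - D z ∘ₗ D z'

theorem exists_VF [HasTrivialRadical ℂ s₂] (h2 : IsOProj s₂.toSubmodule p₂) :
    ∃ D : L →ₗ[ℂ] (Reg (Og s₂ p₂ q r m) →ₗ[ℂ] Reg (Og s₂ p₂ q r m)), VF D := by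
  choose D hD hw hy using fun z => exists_Dz (q := q) (r := r) (m := m) h2 z
  have ht := fun z => VD_tau h2 z (hD z) (hw z)
  replace hw := fun z => (hw z).congr fun o => ad_tau_w o z
  have hE : ∀ E : Reg (Og s₂ p₂ q r m) →ₗ[ℂ] Reg (Og s₂ p₂ q r m), Leib E →
      VD E (fun o => o.1.1) (fun _ => 0) → VD E (fun o => o.1.2) (fun _ => 0) → E = 0 := by
    intro E h3 h4 h5
    exact h3.eq_zero (h4.pair h5)
  have hadd : ∀ z z', D (z + z') = D z + D z' := by
    intro z z'
    rw [← sub_eq_zero]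
    refine hE _ ((hD _).sub ((hD _).add (hD _))) ?_ ?_
    · refine ((hw _).subD ((hw _).addD (hw _))).congr fun o => ?_
      rw [map_add, add_mul, mul_add]; abel
    · refine ((hy _).subD ((hy _).addD (hy _))).congr fun o => ?_
      rw [map_add, add_lie, sub_self]
  have hsmul : ∀ (k : ℂ) z, D (k • z) = k • D z := by
    intro k z
    rw [← sub_eq_zero]
    refine hE _ ((hD _).sub ((hD _).smul k)) ?_ ?_
    · refine ((hw _).subD ((hw _).smulD k)).congr fun o => ?_
      rw [map_smul, smul_mul_assoc, mul_smul_comm, smul_sub, sub_self]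
    · refine ((hy _).subD ((hy _).smulD k)).congr fun o => ?_
      rw [map_smul, smul_lie, sub_self]
  refine ⟨{ toFun := D, map_add' := hadd, map_smul' := hsmul }, hD, hw, hy, ht, fun z z' => ?_⟩
  change D ⁅z, z'⁆ = D z' ∘ₗ D z - D z ∘ₗ D z'
  rw [← sub_eq_zero]
  have hyy : ∀ z z', VD (D z ∘ₗ D z') (fun o => o.1.2) (fun o =>
      ⁅⁅tau o z, tau o z'⁆ - tau o ⁅tau o z, z'⁆, o.1.2⁆ + ⁅tau o z', ⁅tau o z, o.1.2⁆⁆) := by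
    intro z z'
    refine (hy z').comp ?_
    have h3 := ((ht z).app (hD z) (VD.const (hD z) z'))
    exact (h3.bilin (hD z) (hy z) brk).congr fun o => by simp
  have hww : ∀ z z', VD (D z ∘ₗ D z') (fun o => o.1.1) (fun o =>
      ad ℂ L z' * (ad ℂ L z * o.1.1 - o.1.1 * ad ℂ L z) -
        (ad ℂ L z * o.1.1 - o.1.1 * ad ℂ L z) * ad ℂ L z') := by
    intro z z'
    refine (hw z').comp ?_
    have h3 := (hw z).lin (LinearMap.mulLeft ℂ (ad ℂ L z'))
    have h4 := (hw z).lin (LinearMap.mulRight ℂ (ad ℂ L z'))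
    exact h3.sub h4
  refine hE _ ((hD _).sub ((hD _).comm (hD _))) ?_ ?_
  · refine ((hw _).subD ((hww _ _).subD (hww _ _))).congr fun o => ?_
    rw [ad_lie']
    noncomm_ring
  · refine ((hy _).subD ((hyy _ _).subD (hyy _ _))).congr fun o => ?_
    set c := tau o z with hc
    set c' := tau o z' with hc'
    have hn := tau_diff' o z
    have hn' := tau_diff' o z'
    rw [← hc] at hn
    rw [← hc'] at hn'
    have k1 := Kw_y (tau_s2 h2 o ⁅c, c'⁆ (s₂.lie_mem (tau_mem h2 o z) (tau_mem h2 o z')))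
    have k2 := Kw_y (tau_im h2 o _ (im_lie o hn hn'))
    have e : ⁅z - c, z' - c'⁆ = ⁅z, z'⁆ + ⁅c', z⁆ - ⁅c, z'⁆ + ⁅c, c'⁆ := by
      simp only [lie_sub, sub_lie]
      rw [← lie_skew c' z]; abel
    have e2 : ⁅⁅c, c'⁆, o.1.2⁆ = ⁅c, ⁅c', o.1.2⁆⁆ - ⁅c', ⁅c, o.1.2⁆⁆ := lie_lie _ _ _
    have e3 : ⁅⁅c', c⁆, o.1.2⁆ = ⁅c', ⁅c, o.1.2⁆⁆ - ⁅c, ⁅c', o.1.2⁆⁆ := lie_lie _ _ _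
    rw [e, map_add, map_sub, map_add] at k2
    simp only [add_lie, sub_lie] at k1 k2 ⊢
    rw [e2] at k1
    rw [e2, e3]
    have k3 := congrArg₂ (· + ·) k1 k2
    simp only [add_zero] at k3
    rw [← k3]
    abel

end setup
end Dis
end

section
open Module LieAlgebra
set_option linter.unusedSectionVars false

namespace Dis
universe u

section tay
variable {W : Type u} [AddCommGroup W] [Module ℂ W] {O : Set W}
variable (D : Reg O →ₗ[ℂ] Reg O) (o : O)

/-- Taylor series along `D` -/
noncomputable def Tay (φ : Reg O) : PowerSeries ℂ :=
  PowerSeries.mk fun n => ((D ^ n) φ).1 o / (n.factorial : ℂ)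

lemma coeff_Tay (φ : Reg O) (n : ℕ) :
    PowerSeries.coeff n (Tay D o φ) = ((D ^ n) φ).1 o / (n.factorial : ℂ) := by
  rw [Tay, PowerSeries.coeff_mk]

lemma Tay_add (φ ψ : Reg O) : Tay D o (φ + ψ) = Tay D o φ + Tay D o ψ := by
  ext n
  rw [map_add, coeff_Tay, coeff_Tay, coeff_Tay, map_add, ← add_div]; rfl

lemma Tay_smul (c : ℂ) (φ : Reg O) : Tay D o (c • φ) = c • Tay D o φ := by
  ext n
  rw [map_smul, coeff_Tay, coeff_Tay, map_smul, smul_eq_mul, ← mul_div_assoc]; rfl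

lemma coeff_Tay_succ (φ : Reg O) (n : ℕ) :
    PowerSeries.coeff (n+1) (Tay D o φ) * (n + 1) = PowerSeries.coeff n (Tay D o (D φ)) := by
  rw [coeff_Tay, coeff_Tay, pow_succ, Nat.factorial_succ]
  have : (n.factorial : ℂ) ≠ 0 := by exact_mod_cast n.factorial_ne_zero
  have h2 : (n + 1 : ℂ) ≠ 0 := by exact_mod_cast n.succ_ne_zero
  push_cast
  field_simp
  rfl

variable {D}
lemma Tay_mul (hD : Leib D) (φ ψ : Reg O) : Tay D o (φ * ψ) = Tay D o φ * Tay D o ψ := by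
  ext n
  induction n generalizing φ ψ with
  | zero =>
    rw [PowerSeries.coeff_zero_eq_constantCoeff_apply, PowerSeries.coeff_zero_eq_constantCoeff_apply,
      map_mul]
    have : ∀ φ, PowerSeries.constantCoeff (Tay D o φ) = φ.1 o := by
      intro φ
      rw [← PowerSeries.coeff_zero_eq_constantCoeff_apply, coeff_Tay]
      simp
    rw [this, this, this]; rfl
  | succ n ih =>
    have h2 : (n + 1 : ℂ) ≠ 0 := by exact_mod_cast n.succ_ne_zero
    apply mul_right_cancel₀ h2
    rw [coeff_Tay_succ, hD, Tay_add, map_add, ih, ih, ← PowerSeries.coeff_derivative]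
    have hd : ∀ φ, PowerSeries.derivative ℂ (Tay D o φ) = Tay D o (D φ) := by
      intro φ; ext n; rw [PowerSeries.coeff_derivative, coeff_Tay_succ]
    rw [Derivation.leibniz, hd, hd, map_add, smul_eq_mul, smul_eq_mul, mul_comm (Tay D o ψ)]

lemma Tay_eq {D : Reg O →ₗ[ℂ] Reg O} {n : ℕ} {φ : Reg O}
    (h : ∀ o, PowerSeries.coeff n (Tay D o φ) = 0) : (D ^ n) φ = 0 := by
  apply Subtype.ext; funext o
  have := h o
  rw [coeff_Tay, div_eq_zero_iff] at this
  rcases this with h | h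
  · exact h
  · exact absurd h (by exact_mod_cast n.factorial_ne_zero)

lemma Tay_coeff_zero {n k : ℕ} {φ : Reg O} (h : (D ^ n) φ = 0) (hk : n ≤ k) :
    PowerSeries.coeff k (Tay D o φ) = 0 := by
  obtain ⟨j, rfl⟩ := Nat.exists_eq_add_of_le' hk
  rw [coeff_Tay, pow_add, Module.End.mul_apply, h, map_zero]; exact zero_div _

lemma Tay_one (hD : Leib D) : Tay D o 1 = 1 := by
  ext n
  rw [coeff_Tay, PowerSeries.coeff_one]
  rcases n with _ | n
  · simp
  · rw [pow_succ, Module.End.mul_apply, hD.one, map_zero]; simp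

/-- locally nilpotent elements -/
noncomputable def LN (hD : Leib D) : Subalgebra ℂ (Reg O) where
  carrier := {φ | ∃ n : ℕ, (D ^ n) φ = 0}
  mul_mem' := by
    rintro a b ⟨n, hn⟩ ⟨k, hk⟩
    refine ⟨n + k, Tay_eq fun o => ?_⟩
    rw [Tay_mul o hD, PowerSeries.coeff_mul]
    refine Finset.sum_eq_zero fun ij hij => ?_
    rw [Finset.HasAntidiagonal.mem_antidiagonal] at hij
    rcases le_or_gt n ij.1 with h | h
    · rw [Tay_coeff_zero o hn h, zero_mul]
    · rw [Tay_coeff_zero o hk (k := ij.2) (by omega), mul_zero]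
  add_mem' := by
    rintro a b ⟨n, hn⟩ ⟨k, hk⟩
    refine ⟨n + k, ?_⟩
    have h1 : (D ^ (n + k)) a = 0 := by
      rw [add_comm, pow_add, Module.End.mul_apply, hn, map_zero]
    have h2 : (D ^ (n + k)) b = 0 := by
      rw [pow_add, Module.End.mul_apply, hk, map_zero]
    rw [map_add, h1, h2, add_zero]
  algebraMap_mem' := by
    intro c
    refine ⟨1, ?_⟩
    rw [Algebra.algebraMap_eq_smul_one, pow_one, map_smul, hD.one, smul_zero]

lemma mem_LN (hD : Leib D) (φ : Reg O) : φ ∈ LN hD ↔ ∃ n : ℕ, (D ^ n) φ = 0 := Iff.rfl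

end tay

section sv
variable {O : Type u} (S : Subalgebra ℂ (O → ℂ))
variable {V V' V'' : Type*} [AddCommGroup V] [Module ℂ V] [AddCommGroup V'] [Module ℂ V']
  [AddCommGroup V''] [Module ℂ V'']

/-- vector valued functions with coordinates in `S` -/
def SV (v : O → V) : Prop := ∀ ℓ : Dual ℂ V, (fun o => ℓ (v o)) ∈ S

variable {S} {v u : O → V} {t : O → V'}

lemma SV.add (h : SV S v) (h' : SV S u) : SV S (fun o => v o + u o) := fun ℓ => by
  simp only [map_add]; exact S.add_mem (h ℓ) (h' ℓ)
lemma SV.lin (h : SV S v) (f : V →ₗ[ℂ] V') : SV S (fun o => f (v o)) := fun ℓ => h (ℓ ∘ₗ f)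
lemma SV.sub (h : SV S v) (h' : SV S u) : SV S (fun o => v o - u o) := fun ℓ => by
  simp only [map_sub]; exact S.sub_mem (h ℓ) (h' ℓ)
lemma SV.const (c : V) : SV S (fun _ => c) := fun ℓ => S.algebraMap_mem (ℓ c)
lemma SV.smul {a : O → ℂ} (h : a ∈ S) (h' : SV S u) : SV S (fun o => a o • u o) := fun ℓ => by
  simp only [map_smul]; exact S.mul_mem h (h' ℓ)
lemma SV.sum {ι : Type*} (s : Finset ι) (f : ι → O → V) (h : ∀ i, SV S (f i)) :
    SV S (fun o => ∑ i ∈ s, f i o) := by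
  classical
  induction s using Finset.induction_on with
  | empty => simpa using SV.const (S := S) (0 : V)
  | insert a s ha ih => simpa [Finset.sum_insert ha] using (h a).add ih
lemma SV.bilin [Module.Finite ℂ V] (h : SV S v) (h' : SV S t) (β : V →ₗ[ℂ] V' →ₗ[ℂ] V'') :
    SV S (fun o => β (v o) (t o)) := by
  let b := Module.finBasis ℂ V
  have key : ∀ (x : V) (y : V'), β x y = ∑ i, b.coord i x • β (b i) y := by
    intro x y
    conv_lhs => rw [← b.sum_repr x]
    rw [map_sum, LinearMap.sum_apply]
    simp
  have e : (fun o => β (v o) (t o)) = fun o => ∑ i, b.coord i (v o) • β (b i) (t o) :=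
    funext fun o => key _ _
  rw [e]
  exact SV.sum _ _ fun i => SV.smul (h (b.coord i)) (h'.lin (β (b i)))
lemma SV.mul [Module.Finite ℂ V] {A B : O → End ℂ V} (h : SV S A) (h' : SV S B) :
    SV S (fun o => A o * B o) := h.bilin h' (LinearMap.mul ℂ (End ℂ V))
lemma SV.app [Module.Finite ℂ V] {A : O → End ℂ V} (h : SV S A) (h' : SV S v) :
    SV S (fun o => A o (v o)) := h.bilin h' LinearMap.id
lemma SV.aeval [Module.Finite ℂ V] {A : O → End ℂ V} (h : SV S A) (p : Polynomial ℂ) :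
    SV S (fun o => Polynomial.aeval (A o) p) := by
  have hpow : ∀ n : ℕ, SV S (fun o => A o ^ n) := by
    intro n
    induction n with
    | zero => simpa using SV.const (S := S) (1 : End ℂ V)
    | succ n ih => simpa only [pow_succ] using ih.mul h
  induction p using Polynomial.induction_on' with
  | add p q hp hq => simpa only [map_add] using hp.add hq
  | monomial n c =>
    simp only [Polynomial.aeval_monomial, ← Algebra.smul_def]
    exact (hpow n).lin (c • LinearMap.id)
end sv

end Dis
end

section
open Module LieAlgebra
set_option linter.unusedSectionVars false

namespace Dis
universe u

lemma growth_coeff (c : ℕ → ℂ) (hs : ∀ R : NNReal, Summable (fun n => ‖c n‖ * (R : ℝ) ^ n))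
    (C : ℝ) (N : ℕ) (h : ∀ t : ℂ, ‖∑' n, c n * t ^ n‖ ≤ C * (1 + ‖t‖) ^ N) :
    ∀ n, N < n → c n = 0 := by
  intro n hn
  let p := FormalMultilinearSeries.ofScalars ℂ c
  have hr : p.radius = ⊤ := by
    refine p.radius_eq_top_of_summable_norm fun R => ?_
    simpa [p, FormalMultilinearSeries.ofScalars_norm] using hs R
  have hp := p.hasFPowerSeriesOnBall (by rw [hr]; exact ENNReal.zero_lt_top)
  have hsum : ∀ t, p.sum t = ∑' n, c n * t ^ n := by
    intro t
    refine tsum_congr fun n => ?_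
    simp [p, mul_comm]
  have hd : Differentiable ℂ p.sum := by
    have := hp.differentiableOn
    rw [hr, Metric.eball_top] at this
    exact differentiableOn_univ.1 this
  have hid : iteratedDeriv n p.sum 0 = n.factorial * c n := by
    rw [iteratedDeriv_eq_iteratedFDeriv, ← hp.factorial_smul]
    simp [p]
  have hb : ∀ R : ℝ, 1 ≤ R → ‖c n‖ * R ≤ C * 2 ^ N := by
    intro R hR
    have hR0 : 0 < R := by linarith
    have h1 := Complex.norm_iteratedDeriv_le_of_forall_mem_sphere_norm_le (c := 0) (R := R)
      (C := C * (1 + R) ^ N) n hR0 hd.diffContOnCl (fun z hz => by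
        rw [hsum]
        have := h z
        rw [mem_sphere_zero_iff_norm] at hz
        rwa [hz] at this)
    rw [hid, norm_mul, Complex.norm_natCast, mul_div_assoc] at h1
    have hf : (0 : ℝ) < n.factorial := by exact_mod_cast n.factorial_pos
    have h2 := le_of_mul_le_mul_left h1 hf
    rw [le_div_iff₀ (by positivity)] at h2
    have hC : 0 ≤ C := by
      have := (norm_nonneg _).trans (h 0)
      simpa using this
    have h3 : C * (1 + R) ^ N ≤ C * (2 ^ N * R ^ N) := by
      rw [← mul_pow]
      gcongr
      linarith
    obtain ⟨k, rfl⟩ : ∃ k, n = N + 1 + k := ⟨n - (N + 1), by omega⟩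
    have h4 : ‖c (N + 1 + k)‖ * R * R ^ N ≤ C * 2 ^ N * R ^ N := by
      calc _ = ‖c (N + 1 + k)‖ * (R ^ (N + 1)) := by ring
        _ ≤ ‖c (N + 1 + k)‖ * (R ^ (N + 1 + k)) := by
          exact mul_le_mul_of_nonneg_left (pow_le_pow_right₀ hR (by omega)) (norm_nonneg _)
        _ ≤ _ := by linarith
    exact le_of_mul_le_mul_right h4 (by positivity)
  by_contra hne
  have hpos : 0 < ‖c n‖ := norm_pos_iff.2 hne
  have h5 := hb (max 1 ((C * 2 ^ N + 1) / ‖c n‖)) (le_max_left _ _)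
  have h6 : ‖c n‖ * ((C * 2 ^ N + 1) / ‖c n‖) ≤ ‖c n‖ * (max 1 ((C * 2 ^ N + 1) / ‖c n‖)) := by
    gcongr
    exact le_max_right _ _
  rw [mul_div_cancel₀ _ hpos.ne'] at h6
  linarith

lemma seq_bound (a : ℕ → ℝ) (ha : ∀ n, 0 ≤ a n) (S : ℝ) (hS : 0 ≤ S) (d : ℕ)
    (h : ∀ n : ℕ, a (n+1) * (n + 1) ≤ S * ∑ ij ∈ Finset.HasAntidiagonal.antidiagonal n,
      if ij.1 < d then a ij.2 else 0) :
    ∀ R : NNReal, Summable (fun n => a n * (R : ℝ) ^ n) := by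
  have hb : ∀ R : ℝ, 1 ≤ R → ∃ K, ∀ n, a n * R ^ n ≤ K := by
    intro R hR
    have hR0 : 0 < R := by linarith
    obtain ⟨n0, hn0⟩ := exists_nat_ge (S * (d * R ^ d))
    refine ⟨∑ k ∈ Finset.range (n0 + 1), a k * R ^ k, fun n => ?_⟩
    have hterm : ∀ k, 0 ≤ a k * R ^ k := fun k => mul_nonneg (ha k) (by positivity)
    set K := ∑ k ∈ Finset.range (n0 + 1), a k * R ^ k with hK
    have hK0 : 0 ≤ K := Finset.sum_nonneg fun k _ => hterm k
    induction n using Nat.strong_induction_on with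
    | _ n ih =>
      rcases lt_or_ge n (n0 + 1) with hlt | hge
      · exact Finset.single_le_sum (f := fun k => a k * R ^ k) (fun k _ => hterm k)
          (Finset.mem_range.2 hlt)
      · obtain ⟨n, rfl⟩ : ∃ k, n = k + 1 := ⟨n - 1, by omega⟩
        have h1 : (∑ ij ∈ Finset.HasAntidiagonal.antidiagonal n, if ij.1 < d then a ij.2 else 0) * R ^ (n + 1) ≤
            d * R ^ d * K := by
          rw [Finset.sum_mul]
          have h2 : ∀ ij ∈ Finset.HasAntidiagonal.antidiagonal n, (if ij.1 < d then a ij.2 else 0) * R ^ (n + 1) ≤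
              if ij.1 < d then R ^ d * K else 0 := by
            intro ij hij
            rw [Finset.HasAntidiagonal.mem_antidiagonal] at hij
            split
            · rename_i hd
              have h3 := ih ij.2 (by omega)
              calc a ij.2 * R ^ (n+1) = R ^ (ij.1 + 1) * (a ij.2 * R ^ ij.2) := by
                    rw [← hij]; ring
                _ ≤ R ^ d * K := by
                  gcongr
                  · exact hterm _
                  exact hd
            · simp
          refine (Finset.sum_le_sum h2).trans ?_
          rw [← Finset.sum_filter, Finset.sum_const, nsmul_eq_mul, mul_assoc]
          gcongr
          have : ((Finset.HasAntidiagonal.antidiagonal n).filter fun ij => ij.1 < d).card ≤ (Finset.range d).card := by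
            refine Finset.card_le_card_of_injOn Prod.fst (fun ij hij => ?_) ?_
            · simp at hij ⊢; exact hij.2
            · intro x hx y hy hxy
              simp at hx hy
              exact Prod.ext hxy (by omega)
          simpa using this
        have h4 := h n
        have hn1 : (0 : ℝ) < n + 1 := by positivity
        have h5 : (a (n+1) * R ^ (n+1)) * (n + 1) ≤ K * (n + 1) := by
          calc (a (n+1) * R ^ (n+1)) * (n + 1) = (a (n+1) * (n+1)) * R ^ (n+1) := by ring
            _ ≤ (S * ∑ ij ∈ Finset.HasAntidiagonal.antidiagonal n, if ij.1 < d then a ij.2 else 0) * R ^ (n+1) := by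
              gcongr
            _ = S * ((∑ ij ∈ Finset.HasAntidiagonal.antidiagonal n, if ij.1 < d then a ij.2 else 0) * R ^ (n+1)) := by
              ring
            _ ≤ S * (d * R ^ d * K) := by gcongr
            _ = K * (S * (d * R ^ d)) := by ring
            _ ≤ K * (n + 1) := by
              gcongr
              refine hn0.trans ?_
              have : n0 ≤ n := by omega
              have : (n0 : ℝ) ≤ n := by exact_mod_cast this
              linarith
        exact le_of_mul_le_mul_right h5 hn1
  intro R
  obtain ⟨K, hK⟩ := hb (2 * R + 1) (by have := R.2; linarith)
  have hR := R.coe_nonneg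
  have hK0 : 0 ≤ K := by have := hK 0; simp at this; exact (ha 0).trans this
  refine Summable.of_nonneg_of_le (fun n => mul_nonneg (ha n) (by positivity)) (fun n => ?_)
    ((summable_geometric_of_lt_one (r := (1/2 : ℝ)) (by norm_num) (by norm_num)).mul_left K)
  have h1 : (R : ℝ) ^ n ≤ (2 * R + 1) ^ n * (1/2) ^ n := by
    rw [← mul_pow]
    gcongr
    linarith
  calc a n * (R : ℝ) ^ n ≤ a n * ((2 * R + 1) ^ n * (1/2) ^ n) := by
        gcongr
        exact ha n
    _ = (a n * (2 * R + 1) ^ n) * (1/2) ^ n := by ring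
    _ ≤ K * (1/2) ^ n := by
      gcongr
      exact hK n

/-- entire power series -/
def Ent (F : PowerSeries ℂ) : Prop :=
  ∀ R : NNReal, Summable (fun n => ‖PowerSeries.coeff n F‖ * (R : ℝ) ^ n)

/-- evaluation -/
noncomputable def evP (t : ℂ) (F : PowerSeries ℂ) : ℂ := ∑' n, PowerSeries.coeff n F * t ^ n

lemma Ent.norm {F : PowerSeries ℂ} (h : Ent F) (t : ℂ) :
    Summable (fun n => ‖PowerSeries.coeff n F * t ^ n‖) := by
  simpa [norm_mul, norm_pow] using h ‖t‖₊

lemma Ent.of_norm {F : PowerSeries ℂ}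
    (h : ∀ t : ℂ, Summable (fun n => ‖PowerSeries.coeff n F * t ^ n‖)) : Ent F := fun R => by
  simpa [norm_mul, norm_pow] using h ((R : ℝ) : ℂ)

lemma Ent.add {F G : PowerSeries ℂ} (hF : Ent F) (hG : Ent G) : Ent (F + G) :=
  Ent.of_norm fun t => by
    refine Summable.of_nonneg_of_le (fun n => norm_nonneg _) (fun n => ?_)
      ((hF.norm t).add (hG.norm t))
    rw [map_add, add_mul]
    exact norm_add_le _ _

lemma evP_add {F G : PowerSeries ℂ} (hF : Ent F) (hG : Ent G) (t : ℂ) :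
    evP t (F + G) = evP t F + evP t G := by
  rw [evP, evP, evP, ← (hF.norm t).of_norm.tsum_add (hG.norm t).of_norm]
  refine tsum_congr fun n => ?_
  rw [map_add, add_mul]

lemma coeff_mul_t (F G : PowerSeries ℂ) (t : ℂ) (n : ℕ) : PowerSeries.coeff n (F * G) * t ^ n =
    ∑ ij ∈ Finset.HasAntidiagonal.antidiagonal n,
      (PowerSeries.coeff ij.1 F * t ^ ij.1) * (PowerSeries.coeff ij.2 G * t ^ ij.2) := by
  rw [PowerSeries.coeff_mul, Finset.sum_mul]
  refine Finset.sum_congr rfl fun ij hij => ?_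
  rw [Finset.HasAntidiagonal.mem_antidiagonal] at hij
  rw [← hij]; ring

lemma sum_aux (f g h : ℕ → ℂ) (hf : Summable fun n => ‖f n‖) (hg : Summable fun n => ‖g n‖)
    (e : ∀ n, h n = ∑ ij ∈ Finset.HasAntidiagonal.antidiagonal n, f ij.1 * g ij.2) :
    Summable fun n => ‖h n‖ := by
  have := summable_norm_sum_mul_antidiagonal_of_summable_norm hf hg
  refine this.congr fun n => ?_
  rw [e]

lemma Ent.mul {F G : PowerSeries ℂ} (hF : Ent F) (hG : Ent G) : Ent (F * G) :=
  Ent.of_norm fun t => sum_aux _ _ _ (hF.norm t) (hG.norm t) (coeff_mul_t F G t)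

lemma evP_mul {F G : PowerSeries ℂ} (hF : Ent F) (hG : Ent G) (t : ℂ) :
    evP t (F * G) = evP t F * evP t G := by
  have h := tsum_mul_tsum_eq_tsum_sum_antidiagonal_of_summable_norm (hF.norm t) (hG.norm t)
  refine Eq.trans ?_ h.symm
  rw [evP]
  refine tsum_congr fun n => ?_
  rw [coeff_mul_t]

lemma Ent.smul {F : PowerSeries ℂ} (hF : Ent F) (c : ℂ) : Ent (c • F) :=
  Ent.of_norm fun t => by
    have := (hF.norm t).mul_left ‖c‖
    refine this.congr fun n => ?_
    rw [map_smul, smul_eq_mul, mul_assoc, norm_mul c]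

lemma evP_smul (F : PowerSeries ℂ) (c t : ℂ) : evP t (c • F) = c * evP t F := by
  rw [evP, evP, ← tsum_mul_left]
  refine tsum_congr fun n => ?_
  simp [mul_assoc]

lemma Ent.of_fin {F : PowerSeries ℂ} (N : ℕ) (h : ∀ n, N ≤ n → PowerSeries.coeff n F = 0) : Ent F := by
  intro R
  refine summable_of_hasFiniteSupport ((Finset.range N).finite_toSet.subset fun n hn => ?_)
  by_contra h'
  simp at h'
  exact hn (by simp [h n h'])

lemma evP_fin {F : PowerSeries ℂ} (N : ℕ) (h : ∀ n, N ≤ n → PowerSeries.coeff n F = 0) (t : ℂ) :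
    evP t F = ∑ n ∈ Finset.range N, PowerSeries.coeff n F * t ^ n := by
  refine tsum_eq_sum fun n hn => ?_
  simp at hn
  rw [h n hn, zero_mul]

lemma Ent.one : Ent 1 := Ent.of_fin 1 fun n hn => by
  rw [PowerSeries.coeff_one, if_neg (by omega)]

lemma evP_one (t : ℂ) : evP t 1 = 1 := by
  rw [evP_fin 1 (fun n hn => by rw [PowerSeries.coeff_one, if_neg (by omega)])]
  simp

section bound
open Module.End
variable {ι : Type*} [Fintype ι] [DecidableEq ι]

lemma eig_bound (A : Matrix ι ι ℂ) (α : ℂ) (v : ι → ℂ) (hv : v ≠ 0) (h : A.mulVec v = α • v) :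
    ‖α‖ ≤ ∑ i, ∑ j, ‖A i j‖ := by
  obtain ⟨i0, hi0⟩ : ∃ i, v i ≠ 0 := by
    by_contra! h; exact hv (funext h)
  obtain ⟨i, -, hi⟩ := Finset.exists_max_image Finset.univ (fun i => ‖v i‖) ⟨i0, Finset.mem_univ _⟩
  have hpos : 0 < ‖v i‖ := (norm_pos_iff.2 hi0).trans_le (hi i0 (Finset.mem_univ _))
  have h1 : ‖α‖ * ‖v i‖ ≤ (∑ j, ‖A i j‖) * ‖v i‖ := by
    rw [← norm_mul]
    have : α * v i = ∑ j, A i j * v j := (congrFun h i).symm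
    rw [this, Finset.sum_mul]
    refine (norm_sum_le _ _).trans (Finset.sum_le_sum fun j _ => ?_)
    rw [norm_mul]
    gcongr
    exact hi j (Finset.mem_univ _)
  refine (le_of_mul_le_mul_right h1 hpos).trans ?_
  exact Finset.single_le_sum (f := fun i => ∑ j, ‖A i j‖)
    (fun i _ => Finset.sum_nonneg fun j _ => norm_nonneg _) (Finset.mem_univ i)

lemma inv_eig {V : Type*} [AddCommGroup V] [Module ℂ V] [Module.Finite ℂ V] (A : End ℂ V)
    (E : Submodule ℂ V) (hE : E ≠ ⊥) (hA : ∀ v ∈ E, A v ∈ E) :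
    ∃ α : ℂ, ∃ v ∈ E, v ≠ 0 ∧ A v = α • v := by
  have := (Submodule.nontrivial_iff_ne_bot).2 hE
  obtain ⟨α, hα⟩ := Module.End.exists_eigenvalue (A.restrict hA)
  obtain ⟨v, hv⟩ := hα.exists_hasEigenvector
  refine ⟨α, v.1, v.2, fun h => hv.2 (Subtype.ext h), ?_⟩
  exact congrArg Subtype.val hv.apply_eq_smul

lemma common_eig {V : Type*} [AddCommGroup V] [Module ℂ V] [Module.Finite ℂ V] (A B : End ℂ V)
    (h : A * B = B * A) (l : ℂ) (hl : (A * B).HasEigenvalue l) :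
    ∃ α μ : ℂ, ∃ v : V, v ≠ 0 ∧ A v = α • v ∧ B v = μ • v ∧ l = α * μ := by
  have h' : ∀ v, A (B v) = B (A v) := fun v => LinearMap.congr_fun h v
  obtain ⟨α, v, hv, hv0, hv1⟩ := inv_eig A (eigenspace (A * B) l) hl (fun v hv => by
    rw [mem_eigenspace_iff, mul_apply] at hv ⊢
    rw [← h', hv, map_smul])
  obtain ⟨μ, v, hv, hv0, hv1⟩ := inv_eig B (eigenspace (A * B) l ⊓ eigenspace A α)
    (fun h => hv0 ((Submodule.mem_bot ℂ).1 (h ▸ ⟨hv, mem_eigenspace_iff.2 hv1⟩))) (fun v hv => by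
      obtain ⟨h1, h2⟩ := hv
      refine ⟨?_, ?_⟩
      · change _ ∈ eigenspace (A * B) l
        rw [mem_eigenspace_iff, mul_apply, h',
          show A (B v) = l • v from mem_eigenspace_iff.1 h1, map_smul]
      · change _ ∈ eigenspace A α
        rw [mem_eigenspace_iff, h', mem_eigenspace_iff.1 h2, map_smul])
  refine ⟨α, μ, v, hv0, mem_eigenspace_iff.1 hv.2, hv1, ?_⟩
  have h1 := mem_eigenspace_iff.1 hv.1
  rw [mul_apply, hv1, map_smul, mem_eigenspace_iff.1 hv.2, smul_smul] at h1
  rw [mul_comm]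
  exact (smul_left_injective ℂ hv0 h1).symm

lemma trace_bound (A Y : Matrix ι ι ℂ) (h : A * Y = Y * A) (m : Polynomial ℂ) (hm : m ≠ 0)
    (hY : Polynomial.aeval Y m = 0) :
    ‖(A * Y).trace‖ ≤ (Fintype.card ι * (m.roots.map norm).sum) * ∑ i, ∑ j, ‖A i j‖ := by
  rw [Matrix.trace_eq_sum_roots_charpoly]
  set S := ∑ i, ∑ j, ‖A i j‖ with hS
  set K := (m.roots.map norm).sum with hK
  have hcard : Multiset.card (A * Y).charpoly.roots = Fintype.card ι := by
    rw [← (IsAlgClosed.splits _).natDegree_eq_card_roots, Matrix.charpoly_natDegree_eq_dim]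
  have key : ∀ l ∈ (A * Y).charpoly.roots, ‖l‖ ≤ K * S := by
    intro l hl
    have hr := (Polynomial.mem_roots'.1 hl).2
    let Φ : Matrix ι ι ℂ ≃ₐ[ℂ] End ℂ (ι → ℂ) := Matrix.toLinAlgEquiv'
    have he : (Φ A * Φ Y).HasEigenvalue l := by
      rw [← map_mul, Module.End.hasEigenvalue_iff_mem_spectrum, AlgEquiv.spectrum_eq,
        Matrix.mem_spectrum_iff_isRoot_charpoly]
      exact hr
    obtain ⟨α, μ, v, hv, h1, h2, rfl⟩ := common_eig (Φ A) (Φ Y) (by rw [← map_mul, h, map_mul]) l he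
    rw [norm_mul, mul_comm]
    have hμ : Polynomial.eval μ m • v = 0 := by
      rw [← aeval_apply_of_hasEigenvector (f := Φ Y) ⟨mem_eigenspace_iff.2 h2, hv⟩,
        Polynomial.aeval_algHom_apply Φ Y m, hY, map_zero, LinearMap.zero_apply]
    have hμ' : μ ∈ m.roots := by
      rw [Polynomial.mem_roots hm]
      exact (smul_eq_zero.1 hμ).resolve_right hv
    refine mul_le_mul ?_ (eig_bound A α v hv h1) (norm_nonneg _) ?_
    · refine Multiset.single_le_sum (fun x hx => ?_) _ (Multiset.mem_map_of_mem norm hμ')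
      obtain ⟨y, -, rfl⟩ := Multiset.mem_map.1 hx
      exact norm_nonneg y
    · refine Multiset.sum_nonneg (fun x hx => ?_)
      obtain ⟨y, -, rfl⟩ := Multiset.mem_map.1 hx
      exact norm_nonneg y
  refine (norm_multiset_sum_le _).trans ?_
  have := Multiset.sum_le_card_nsmul ((A * Y).charpoly.roots.map norm) (K * S) (fun x hx => by
    obtain ⟨y, hy, rfl⟩ := Multiset.mem_map.1 hx
    exact key y hy)
  rw [Multiset.card_map, hcard, nsmul_eq_mul] at this
  rw [mul_assoc]; exact this

end bound

end Dis
end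

section
open Module LieAlgebra
set_option linter.unusedSectionVars false

namespace Dis
universe u

section ode
variable {W : Type u} [AddCommGroup W] [Module ℂ W] {O : Set W}
variable {D : Reg O →ₗ[ℂ] Reg O}

lemma Tay_sum (o : O) {ι : Type*} (s : Finset ι) (f : ι → Reg O) :
    Tay D o (∑ i ∈ s, f i) = ∑ i ∈ s, Tay D o (f i) := by
  classical
  induction s using Finset.induction_on with
  | empty =>
    rw [Finset.sum_empty, Finset.sum_empty]
    have := Tay_smul D o 0 0
    simpa using this
  | insert a s ha ih => rw [Finset.sum_insert ha, Finset.sum_insert ha, Tay_add, ih]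

lemma LN_unif {ι : Type*} [Finite ι] (hD : Leib D) (C : ι → Reg O) (hC : ∀ i, C i ∈ LN hD) :
    ∃ d : ℕ, ∀ (o : O) i k, d ≤ k → PowerSeries.coeff k (Tay D o (C i)) = 0 := by
  cases nonempty_fintype ι
  choose n hn using hC
  refine ⟨∑ i, n i, fun o i k hk => Tay_coeff_zero o (hn i) (le_trans ?_ hk)⟩
  exact Finset.single_le_sum (f := n) (fun _ _ => Nat.zero_le _) (Finset.mem_univ i)

lemma ent_ode {ι : Type*} [Fintype ι] (hD : Leib D) (o : O) (y : ι → Reg O) (C : ι → ι → Reg O)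
    (hC : ∀ i j, C i j ∈ LN hD) (hy : ∀ i, D (y i) = ∑ j, C i j * y j) (i : ι) :
    Ent (Tay D o (y i)) := by
  obtain ⟨d, hd'⟩ := LN_unif hD (fun ij : ι × ι => C ij.1 ij.2) (fun ij => hC _ _)
  have hd : ∀ i j k, d ≤ k → PowerSeries.coeff k (Tay D o (C i j)) = 0 := fun i j => hd' o (i, j)
  let a : ℕ → ℝ := fun n => ∑ i, ‖PowerSeries.coeff n (Tay D o (y i))‖
  let γ : ℕ → ℝ := fun k => ∑ i, ∑ j, ‖PowerSeries.coeff k (Tay D o (C i j))‖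
  have hγ : ∀ k, 0 ≤ γ k := fun k =>
    Finset.sum_nonneg fun i _ => Finset.sum_nonneg fun j _ => norm_nonneg _
  have ha : ∀ n, 0 ≤ a n := fun n => Finset.sum_nonneg fun i _ => norm_nonneg _
  have hya : ∀ n i, ‖PowerSeries.coeff n (Tay D o (y i))‖ ≤ a n := fun n i =>
    Finset.single_le_sum (f := fun i => ‖PowerSeries.coeff n (Tay D o (y i))‖)
      (fun i _ => norm_nonneg _) (Finset.mem_univ i)
  let S : ℝ := ∑ k ∈ Finset.range d, γ k
  have hS : 0 ≤ S := Finset.sum_nonneg fun k _ => hγ k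
  have hγS : ∀ k, k < d → γ k ≤ S := fun k hk =>
    Finset.single_le_sum (f := γ) (fun k _ => hγ k) (Finset.mem_range.2 hk)
  have key : ∀ n : ℕ, a (n+1) * (n + 1) ≤ S * ∑ ij ∈ Finset.HasAntidiagonal.antidiagonal n,
      if ij.1 < d then a ij.2 else 0 := by
    intro n
    have h1 : ∀ i, ‖PowerSeries.coeff (n+1) (Tay D o (y i))‖ * (n + 1) ≤
        ∑ kl ∈ Finset.HasAntidiagonal.antidiagonal n,
          if kl.1 < d then (∑ j, ‖PowerSeries.coeff kl.1 (Tay D o (C i j))‖) * a kl.2 else 0 := by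
      intro i
      have e1 : ‖PowerSeries.coeff (n+1) (Tay D o (y i))‖ * (n + 1) =
          ‖PowerSeries.coeff (n+1) (Tay D o (y i)) * (n + 1)‖ := by
        rw [norm_mul]
        congr 1
        rw [← Nat.cast_succ, ← Nat.cast_succ, Complex.norm_natCast]
      rw [e1, coeff_Tay_succ, hy, Tay_sum, map_sum]
      simp only [Tay_mul o hD, PowerSeries.coeff_mul]
      rw [Finset.sum_comm]
      refine (norm_sum_le _ _).trans (Finset.sum_le_sum fun kl _ => ?_)
      split
      · rw [Finset.sum_mul]
        refine (norm_sum_le _ _).trans (Finset.sum_le_sum fun j _ => ?_)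
        rw [norm_mul]
        gcongr
        exact hya _ _
      · rename_i h
        rw [Finset.sum_eq_zero fun j _ => by rw [hd i j _ (not_lt.1 h), zero_mul], norm_zero]
    calc a (n+1) * (n+1) = ∑ i, ‖PowerSeries.coeff (n+1) (Tay D o (y i))‖ * (n + 1) := Finset.sum_mul _ _ _
      _ ≤ _ := Finset.sum_le_sum fun i _ => h1 i
      _ = ∑ kl ∈ Finset.HasAntidiagonal.antidiagonal n, if kl.1 < d then γ kl.1 * a kl.2 else 0 := by
        rw [Finset.sum_comm]
        refine Finset.sum_congr rfl fun kl _ => ?_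
        split
        · rw [← Finset.sum_mul]
        · simp
      _ ≤ _ := by
        rw [Finset.mul_sum]
        refine Finset.sum_le_sum fun kl _ => ?_
        split
        · rename_i h
          exact mul_le_mul_of_nonneg_right (hγS _ h) (ha _)
        · simp
  have := seq_bound a ha S hS d key
  intro R
  refine Summable.of_nonneg_of_le (fun n => by positivity) (fun n => ?_) (this R)
  exact mul_le_mul_of_nonneg_right (hya n i) (by positivity)

/-- evaluation at a point -/
noncomputable def evR (o : O) : Reg O →ₐ[ℂ] ℂ := (Pi.evalAlgHom ℂ (fun _ : O => ℂ) o).comp (Reg O).val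

lemma evR_apply (o : O) (φ : Reg O) : evR o φ = φ.1 o := rfl

/-- evaluation along the flow -/
noncomputable def chi (hD : Leib D) (o : O) (hE : ∀ φ, Ent (Tay D o φ)) (t : ℂ) : Reg O →ₐ[ℂ] ℂ :=
  AlgHom.ofLinearMap
    { toFun := fun φ => evP t (Tay D o φ)
      map_add' := fun φ ψ => by rw [Tay_add, evP_add (hE _) (hE _)]
      map_smul' := fun c φ => by rw [Tay_smul, evP_smul]; rfl }
    (by change evP t (Tay D o 1) = 1; rw [Tay_one o hD, evP_one])
    (fun φ ψ => by
      change evP t (Tay D o (φ * ψ)) = evP t (Tay D o φ) * evP t (Tay D o ψ)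
      rw [Tay_mul o hD, evP_mul (hE _) (hE _)])

lemma chi_apply (hD : Leib D) (o : O) (hE : ∀ φ, Ent (Tay D o φ)) (t : ℂ) (φ : Reg O) :
    chi hD o hE t φ = evP t (Tay D o φ) := rfl

/-- the key local nilpotence criterion -/
theorem trace_LN {ι : Type*} [Fintype ι] [DecidableEq ι] (hD : Leib D)
    (hE : ∀ o φ, Ent (Tay D o φ)) (A Y : Matrix ι ι (Reg O)) (hA : ∀ i j, A i j ∈ LN hD)
    (hAY : A * Y = Y * A) (m : Polynomial ℂ) (hm : m ≠ 0) (hY : Polynomial.aeval Y m = 0) :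
    (A * Y).trace ∈ LN hD := by
  obtain ⟨N, hN⟩ := LN_unif hD (fun ij : ι × ι => A ij.1 ij.2) (fun ij => hA _ _)
  refine ⟨N + 1, Tay_eq fun o => ?_⟩
  let K : ℝ := Fintype.card ι * (m.roots.map norm).sum
  have hK : 0 ≤ K := mul_nonneg (by positivity) (Multiset.sum_nonneg (fun x hx => by
      obtain ⟨y, -, rfl⟩ := Multiset.mem_map.1 hx
      exact norm_nonneg y))
  refine growth_coeff _ (hE o _) (K * ∑ i, ∑ j, ∑ n ∈ Finset.range N,
    ‖PowerSeries.coeff n (Tay D o (A i j))‖) N (fun t => ?_) (N + 1) (by omega)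
  change ‖evP t _‖ ≤ _
  rw [← chi_apply hD o (hE o)]
  let χ := chi hD o (hE o) t
  have h1 : χ (A * Y).trace = (χ.mapMatrix A * χ.mapMatrix Y).trace := by
    rw [← map_mul, Matrix.trace, Matrix.trace, map_sum]
    rfl
  have h2 := trace_bound (χ.mapMatrix A) (χ.mapMatrix Y) (by rw [← map_mul, hAY, map_mul]) m hm
    (by rw [Polynomial.aeval_algHom_apply, hY, map_zero])
  rw [← h1] at h2
  refine h2.trans ?_
  refine le_trans ?_ (le_of_eq (mul_assoc _ _ _).symm)
  refine mul_le_mul_of_nonneg_left (a := K) ?_ hK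
  rw [Finset.sum_mul]
  refine Finset.sum_le_sum fun i _ => ?_
  rw [Finset.sum_mul]
  refine Finset.sum_le_sum fun j _ => ?_
  rw [Finset.sum_mul]
  change ‖evP t (Tay D o (A i j))‖ ≤ _
  rw [evP_fin N (fun n hn => hN o (i, j) n hn)]
  refine (norm_sum_le _ _).trans (Finset.sum_le_sum fun n hn => ?_)
  rw [norm_mul, norm_pow]
  refine mul_le_mul_of_nonneg_left ?_ (norm_nonneg _)
  calc ‖t‖ ^ n ≤ (1 + ‖t‖) ^ n := by gcongr; linarith
    _ ≤ (1 + ‖t‖) ^ N := pow_le_pow_right₀ (by linarith [norm_nonneg t])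
      (Finset.mem_range.1 hn).le

end ode
end Dis
end

section
open Module LieAlgebra
set_option linter.unusedSectionVars false

namespace Dis
universe u

section mat
variable {W : Type u} [AddCommGroup W] [Module ℂ W] {O : Set W}
variable {V : Type*} [AddCommGroup V] [Module ℂ V] {ι : Type*} [Fintype ι] [DecidableEq ι]

/-- matrix coefficient functional -/
noncomputable def mco (b : Basis ι ℂ V) (i j : ι) : Dual ℂ (End ℂ V) :=
  b.coord i ∘ₗ LinearMap.applyₗ (b j)

lemma mco_apply (b : Basis ι ℂ V) (i j : ι) (f : End ℂ V) : mco b i j f = b.coord i (f (b j)) := rfl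

/-- matrix of a regular operator-valued function -/
noncomputable def rmat (b : Basis ι ℂ V) {A : O → End ℂ V} (h : AV A) : Matrix ι ι (Reg O) :=
  fun i j => ⟨_, h (mco b i j)⟩

lemma rmat_ev (b : Basis ι ℂ V) {A : O → End ℂ V} (h : AV A) (o : O) :
    (evR o).mapMatrix (rmat b h) = LinearMap.toMatrixAlgEquiv b (A o) := by
  ext i j
  rw [LinearMap.toMatrixAlgEquiv_apply]
  rfl

lemma mat_ext {M N : Matrix ι ι (Reg O)}
    (h : ∀ o : O, (evR o).mapMatrix M = (evR o).mapMatrix N) : M = N := by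
  ext i j o
  exact congrFun (congrFun (h o) i) j

end mat

section setup
variable {L : Type u} [LieRing L] [LieAlgebra ℂ L] [Module.Finite ℂ L] [HasTrivialRadical ℂ L]
variable {s₂ : LieSubalgebra ℂ L} {p₂ : End ℂ L} {q r m : Polynomial ℂ}
variable {D : L →ₗ[ℂ] (Reg (Og s₂ p₂ q r m) →ₗ[ℂ] Reg (Og s₂ p₂ q r m))}

/-- the image of the locally nilpotent subalgebra -/
noncomputable def LS (hV : VF D) (e : L) : Subalgebra ℂ (Og s₂ p₂ q r m → ℂ) :=
  (LN (hV.leib e)).map (Reg (Og s₂ p₂ q r m)).val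

lemma mem_LS (hV : VF D) (e : L) (φ : Reg (Og s₂ p₂ q r m)) : φ.1 ∈ LS hV e ↔ φ ∈ LN (hV.leib e) := by
  constructor
  · rintro ⟨ψ, h, e⟩
    obtain rfl : ψ = φ := Subtype.ext e
    exact h
  · exact fun h => ⟨φ, h, rfl⟩

lemma sv_w (hV : VF D) {e : L} (he : IsNilpotent (ad ℂ L e)) : SV (LS hV e) (fun o => o.1.1) := by
  have h1 : ∀ n : ℕ, VD (D e ^ n) (fun o => o.1.1) (fun o => ((cjL L e) ^ n) o.1.1) := by
    intro n
    induction n with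
    | zero => intro ℓ; exact ⟨av_w ℓ, av_w ℓ, rfl⟩
    | succ n ih =>
      rw [pow_succ, pow_succ]
      exact (hV.w e).comp (v' := fun o => cjL L e o.1.1) (by
        have : VD (D e ^ n) (fun o => cjL L e o.1.1) (fun o => cjL L e (((cjL L e) ^ n) o.1.1)) :=
          ih.lin (cjL L e)
        refine this.congr fun o => ?_
        exact LinearMap.congr_fun (pow_mul_comm' (cjL L e) n).symm o.1.1)
  obtain ⟨n, hn⟩ := nil_rep (cjL L) isRep_cj e he
  intro ℓ
  refine (mem_LS hV e ⟨_, av_w ℓ⟩).2 ⟨n, ?_⟩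
  obtain ⟨a, b, c⟩ := h1 n ℓ
  rw [c]
  refine Subtype.ext (funext fun o => ?_)
  change ℓ (((cjL L e) ^ n) o.1.1) = 0
  rw [hn, LinearMap.zero_apply, map_zero]

lemma sv_tau (hV : VF D) {e : L} (he : IsNilpotent (ad ℂ L e)) : SV (LS hV e) (fun o => tau o) :=
  (SV.const p₂).mul (((sv_w hV he).add (SV.const p₂)).aeval r)

/-- the operator `Q` -/
noncomputable def Qo (o : Og s₂ p₂ q r m) : End ℂ L :=
  Polynomial.aeval ((1 - o.1.1) + (1 - p₂)) q

lemma sv_Q (hV : VF D) {e : L} (he : IsNilpotent (ad ℂ L e)) (ξ : L) :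
    SV (LS hV e) (fun o => Qo o ξ) :=
  ((((SV.const 1).sub (sv_w hV he)).add (SV.const (1 - p₂))).aeval q).app (SV.const ξ)

lemma av_Q (ξ : L) : AV (fun o : Og s₂ p₂ q r m => Qo o ξ) :=
  ((((AV.const 1).sub av_w).add (AV.const (1 - p₂))).aeval q).app (AV.const ξ)

lemma ent_y (hV : VF D) {e : L} (he : IsNilpotent (ad ℂ L e)) (o : Og s₂ p₂ q r m) (ℓ : Dual ℂ L) :
    Ent (Tay (D e) o ⟨_, av_y ℓ⟩) := by
  let b := Module.finBasis ℂ L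
  have hA : AV (fun o : Og s₂ p₂ q r m => ad ℂ L (tau o e)) :=
    (av_tau_app e).lin (ad ℂ L : L →ₗ[ℂ] End ℂ L)
  have hS : SV (LS hV e) (fun o : Og s₂ p₂ q r m => ad ℂ L (tau o e)) :=
    ((sv_tau hV he).app (SV.const e)).lin (ad ℂ L : L →ₗ[ℂ] End ℂ L)
  have h1 := ent_ode (hV.leib e) o (fun i => ⟨_, av_y (b.coord i)⟩) (rmat b hA)
    (fun i j => (mem_LS hV e _).1 (hS (mco b i j))) (fun i => by
      rw [(hV.y e).eq _ _ ((hV.y e).av' _)]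
      refine Subtype.ext (funext fun o => ?_)
      rw [AddSubmonoidClass.coe_finsetSum, Finset.sum_apply]
      change b.coord i (ad ℂ L (tau o e) o.1.2) = ∑ j, b.coord i (ad ℂ L (tau o e) (b j)) * b.coord j o.1.2
      conv_lhs => rw [← b.sum_repr o.1.2]
      rw [map_sum, map_sum]
      refine Finset.sum_congr rfl fun j _ => ?_
      rw [map_smul, map_smul, smul_eq_mul, mul_comm]; rfl)
  have h2 : (⟨_, av_y ℓ⟩ : Reg (Og s₂ p₂ q r m)) = ∑ i, ℓ (b i) • ⟨_, av_y (b.coord i)⟩ := by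
    refine Subtype.ext (funext fun o => ?_)
    rw [AddSubmonoidClass.coe_finsetSum, Finset.sum_apply]
    change ℓ o.1.2 = ∑ i, ℓ (b i) * b.coord i o.1.2
    conv_lhs => rw [← b.sum_repr o.1.2]
    rw [map_sum]
    refine Finset.sum_congr rfl fun j _ => ?_
    rw [map_smul, smul_eq_mul, mul_comm]; rfl
  rw [h2]
  have h3 : ∀ s : Finset (Fin (finrank ℂ L)), Ent (Tay (D e) o
      (∑ i ∈ s, ℓ (b i) • (⟨_, av_y (b.coord i)⟩ : Reg (Og s₂ p₂ q r m)))) := by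
    intro s
    induction s using Finset.induction_on with
    | empty =>
      rw [Finset.sum_empty]
      exact Ent.of_fin 0 fun n hn => Tay_coeff_zero o (n := 0) (by simp) hn
    | insert a s ha ih =>
      rw [Finset.sum_insert ha, Tay_add, Tay_smul]
      exact ((h1 a).smul _).add ih
  exact h3 _

lemma split_lin (ℓ : Dual ℂ (End ℂ L × L)) : (⟨_, reg_lin ℓ⟩ : Reg (Og s₂ p₂ q r m)) =
    ⟨_, av_w (ℓ ∘ₗ LinearMap.inl ℂ _ _)⟩ + ⟨_, av_y (ℓ ∘ₗ LinearMap.inr ℂ _ _)⟩ := by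
  refine Subtype.ext (funext fun o => ?_)
  change ℓ o.1 = ℓ (o.1.1, 0) + ℓ (0, o.1.2)
  rw [← map_add]; simp

lemma ent_all (hV : VF D) {e : L} (he : IsNilpotent (ad ℂ L e)) (o : Og s₂ p₂ q r m)
    (φ : Reg (Og s₂ p₂ q r m)) : Ent (Tay (D e) o φ) := by
  let S : Submodule ℂ (Reg (Og s₂ p₂ q r m)) :=
    { carrier := {φ | Ent (Tay (D e) o φ)}
      add_mem' := fun {a b} ha hb => by
        change Ent (Tay (D e) o (a + b)); rw [Tay_add]; exact Ent.add ha hb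
      zero_mem' := Ent.of_fin 0 fun n hn => Tay_coeff_zero o (n := 0) (by simp) hn
      smul_mem' := fun c a ha => by
        change Ent (Tay (D e) o (c • a)); rw [Tay_smul]; exact Ent.smul ha c }
  have : S = ⊤ := by
    refine reg_induct ?_ fun a ha ℓ => ?_
    · change Ent (Tay (D e) o 1)
      rw [Tay_one o (hV.leib e)]; exact Ent.one
    · change Ent (Tay (D e) o (a * _))
      rw [Tay_mul o (hV.leib e)]
      refine Ent.mul ha ?_
      rw [split_lin, Tay_add]
      refine Ent.add ?_ (ent_y hV he o _)
      obtain ⟨n, hn⟩ := (mem_LS hV e ⟨_, av_w (ℓ ∘ₗ LinearMap.inl ℂ _ _)⟩).1 (sv_w hV he _)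
      exact Ent.of_fin n fun k hk => Tay_coeff_zero o hn hk
  have h : φ ∈ S := by rw [this]; trivial
  exact h

lemma ln_kf (hV : VF D) {e : L} (he : IsNilpotent (ad ℂ L e)) (hm : m ≠ 0) (ξ : L) :
    (⟨_, av_y (killingForm ℂ L ξ)⟩ : Reg (Og s₂ p₂ q r m)) ∈ LN (hV.leib e) := by
  let b := Module.finBasis ℂ L
  have hA : AV (fun o : Og s₂ p₂ q r m => ad ℂ L (Qo o ξ)) :=
    (av_Q ξ).lin (ad ℂ L : L →ₗ[ℂ] End ℂ L)
  have hS : SV (LS hV e) (fun o : Og s₂ p₂ q r m => ad ℂ L (Qo o ξ)) :=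
    (sv_Q hV he ξ).lin (ad ℂ L : L →ₗ[ℂ] End ℂ L)
  have hY : AV (fun o : Og s₂ p₂ q r m => ad ℂ L o.1.2) :=
    av_y.lin (ad ℂ L : L →ₗ[ℂ] End ℂ L)
  have h := trace_LN (hV.leib e) (ent_all hV he) (rmat b hA) (rmat b hY)
    (fun i j => (mem_LS hV e _).1 (hS (mco b i j)))
    (mat_ext fun o => by
      rw [map_mul, map_mul, rmat_ev, rmat_ev, ← map_mul (LinearMap.toMatrixAlgEquiv b),
        ← map_mul (LinearMap.toMatrixAlgEquiv b)]
      congr 1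
      obtain ⟨a, ha⟩ := o.2.q1 ξ
      have h1 : ⁅Qo o ξ, o.1.2⁆ = 0 := by
        have h2 := o.2.q2 ξ
        rw [ha] at h2
        have h3 := o.2.ky a h2
        rw [← ha] at h3
        exact h3
      have := ad_lie' (Qo o ξ) o.1.2
      rw [h1, map_zero] at this
      exact (sub_eq_zero.1 this.symm)) m hm
    (mat_ext fun o => by
      rw [← Polynomial.aeval_algHom_apply, rmat_ev, Polynomial.aeval_algHom_apply, o.2.my, map_zero, map_zero])
  convert h using 1
  refine Subtype.ext (funext fun o => ?_)
  change killingForm ℂ L ξ o.1.2 = evR o _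
  have h4 : evR o (rmat b hA * rmat b hY).trace = ((evR o).mapMatrix (rmat b hA * rmat b hY)).trace := by
    rw [Matrix.trace, Matrix.trace, map_sum]
    rfl
  rw [h4, map_mul, rmat_ev, rmat_ev, ← map_mul (LinearMap.toMatrixAlgEquiv b)]
  rw [o.2.qy ξ, kf_apply, LinearMap.trace_eq_matrix_trace ℂ b]
  rfl

theorem ln_all (hV : VF D) {e : L} (he : IsNilpotent (ad ℂ L e)) (hm : m ≠ 0)
    (φ : Reg (Og s₂ p₂ q r m)) : ∃ n : ℕ, (D e ^ n) φ = 0 := by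
  have : Subalgebra.toSubmodule (LN (hV.leib e)) = ⊤ := by
    refine reg_induct (Subalgebra.one_mem _) fun a ha ℓ => ?_
    refine Subalgebra.mul_mem _ ha ?_
    rw [split_lin]
    refine Subalgebra.add_mem _ ((mem_LS hV e _).1 (sv_w hV he _)) ?_
    have hs : Function.Surjective (killingForm ℂ L : L →ₗ[ℂ] Dual ℂ L) := by
      refine (LinearMap.injective_iff_surjective_of_finrank_eq_finrank
        (Subspace.dual_finrank_eq (K := ℂ) (V := L)).symm).1 ?_
      rw [injective_iff_map_eq_zero]
      exact fun x hx => kf_nondeg x fun y => by rw [hx]; rfl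
    obtain ⟨ξ, hξ⟩ := hs (ℓ ∘ₗ LinearMap.inr ℂ _ _)
    rw [← hξ]
    exact ln_kf hV he hm ξ
  have h : φ ∈ Subalgebra.toSubmodule (LN (hV.leib e)) := by rw [this]; trivial
  exact h

end setup
end Dis
end

section
open Module LieAlgebra
set_option linter.unusedSectionVars false

namespace Dis
universe u

section locfin
variable {A : Type*} [AddCommGroup A] [Module ℂ A] {ι : Type*} [Fintype ι] [DecidableEq ι]
variable (E : ι → End ℂ A) (φ : A)

/-- span of words of length less than `n` applied to `φ` -/
def Uw (n : ℕ) : Submodule ℂ A :=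
  Submodule.span ℂ ((fun w : List ι => (w.map E).prod φ) '' {w | w.length < n})

variable {E φ}
lemma Uw_mem {n : ℕ} {w : List ι} (h : w.length < n) : (w.map E).prod φ ∈ Uw E φ n :=
  Submodule.subset_span ⟨w, h, rfl⟩

lemma Uw_mono {n k : ℕ} (h : n ≤ k) : Uw E φ n ≤ Uw E φ k :=
  Submodule.span_mono (Set.image_mono fun _ hw => lt_of_lt_of_le hw h)

lemma Uw_E {n : ℕ} (i : ι) {x : A} (h : x ∈ Uw E φ n) : E i x ∈ Uw E φ (n+1) := by
  have : Uw E φ n ≤ (Uw E φ (n+1)).comap (E i) := by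
    rw [Uw, Submodule.span_le]
    rintro _ ⟨w, hw, rfl⟩
    have := Uw_mem (E := E) (φ := φ) (n := n + 1) (w := i :: w) (by simpa using hw)
    simpa using this
  exact this h

lemma Uw_perm (hE : ∀ i j, E i * E j - E j * E i ∈ Submodule.span ℂ (Set.range E))
    {w w' : List ι} (h : w.Perm w') :
    (w.map E).prod φ - (w'.map E).prod φ ∈ Uw E φ w.length := by
  induction h with
  | nil => simp
  | cons a h ih =>
    have := Uw_E a ih
    simpa using this
  | swap a b l =>
    have h1 : ∀ F ∈ Submodule.span ℂ (Set.range E), F ((l.map E).prod φ) ∈ Uw E φ (l.length + 2) := by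
      intro F hF
      induction hF using Submodule.span_induction with
      | mem x hx =>
        obtain ⟨i, rfl⟩ := hx
        have := Uw_mem (E := E) (φ := φ) (n := l.length + 2) (w := i :: l) (by simp)
        simpa using this
      | zero => simp
      | add x y _ _ hx hy => exact Submodule.add_mem _ hx hy
      | smul c x _ hx => exact Submodule.smul_mem _ c hx
    have := h1 _ (hE b a)
    simpa using this
  | trans h1 h2 ih1 ih2 =>
    rw [← h1.length_eq] at ih2
    have := Submodule.add_mem _ ih1 ih2
    simpa using this

lemma loc_fin (hE : ∀ i j, E i * E j - E j * E i ∈ Submodule.span ℂ (Set.range E))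
    (hn : ∀ i, ∃ n : ℕ, (E i ^ n) φ = 0) :
    ∃ V : Submodule ℂ A, V.FG ∧ φ ∈ V ∧ ∀ i, ∀ x ∈ V, E i x ∈ V := by
  choose a ha using hn
  let N := ∑ i, a i + 1
  have h1 : ∀ w : List ι, N ≤ w.length → (w.map E).prod φ ∈ Uw E φ w.length := by
    intro w hw
    obtain ⟨i, hi⟩ : ∃ i, a i ≤ w.count i := by
      by_contra! hc
      have : w.length ≤ ∑ i, a i := by
        rw [← Multiset.coe_card, ← Multiset.toFinset_sum_count_eq]
        refine (Finset.sum_le_sum_of_subset (Finset.subset_univ _)).trans ?_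
        exact Finset.sum_le_sum fun i _ => by rw [Multiset.coe_count]; exact (hc i).le
      omega
    have hp : w.Perm (w.filter (fun j => !(j == i)) ++ List.replicate (w.count i) i) := by
      have := (List.filter_append_perm (fun j => !(j == i)) w).symm
      refine this.trans ?_
      rw [← List.filter_eq]
      simp only [Bool.not_not]
      rfl
    have h2 := Uw_perm (φ := φ) hE hp
    have h3 : ((w.filter (fun j => !(j == i)) ++ List.replicate (w.count i) i).map E).prod φ = 0 := by
      obtain ⟨k, hk⟩ := Nat.exists_eq_add_of_le' hi
      rw [hk]
      simp only [List.map_append, List.map_replicate, List.prod_append, List.prod_replicate,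
        Module.End.mul_apply]
      rw [pow_add, Module.End.mul_apply, ha, map_zero, map_zero]
    rwa [h3, sub_zero] at h2
  have h2 : Uw E φ (N + 1) ≤ Uw E φ N := by
    rw [Uw, Submodule.span_le]
    rintro _ ⟨w, hw, rfl⟩
    rcases lt_or_ge w.length N with h | h
    · exact Uw_mem h
    · have e : w.length = N := le_antisymm (Nat.lt_succ_iff.1 hw) h
      have := h1 w h
      rwa [e] at this
  refine ⟨Uw E φ N, ?_, ?_, fun i x hx => h2 (Uw_E i hx)⟩
  · exact Submodule.fg_span ((List.finite_length_lt ι N).image _)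
  · have := Uw_mem (E := E) (φ := φ) (n := N) (w := []) (by simp [N])
    simpa using this

end locfin

section setup
variable {L : Type u} [LieRing L] [LieAlgebra ℂ L] [Module.Finite ℂ L] [HasTrivialRadical ℂ L]
variable {s₂ : LieSubalgebra ℂ L} {p₂ : End ℂ L} {q r m : Polynomial ℂ}
variable {D : L →ₗ[ℂ] (Reg (Og s₂ p₂ q r m) →ₗ[ℂ] Reg (Og s₂ p₂ q r m))}

lemma loc_fin_one (hV : VF D) (hm : m ≠ 0) (φ : Reg (Og s₂ p₂ q r m)) :
    ∃ V : Submodule ℂ (Reg (Og s₂ p₂ q r m)), V.FG ∧ φ ∈ V ∧ ∀ z, ∀ x ∈ V, D z x ∈ V := by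
  classical
  have h0 : (Submodule.span ℂ {e : L | IsNilpotent (ad ℂ L e)}).FG := IsNoetherian.noetherian _
  obtain ⟨t, ht, hts⟩ := (Submodule.fg_span_iff_fg_span_finset_subset _).1 h0
  have htop : Submodule.span ℂ (t : Set L) = ⊤ := by
    rw [← hts]; exact nilSpan_eq_top
  have hspan : ∀ z, D z ∈ Submodule.span ℂ (Set.range (fun e : t => D e)) := by
    intro z
    have hz : z ∈ Submodule.span ℂ (t : Set L) := by rw [htop]; trivial
    have := Submodule.mem_map_of_mem (f := D) hz
    rw [Submodule.map_span] at this
    refine Submodule.span_mono ?_ this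
    rintro _ ⟨e, he, rfl⟩
    exact ⟨⟨e, he⟩, rfl⟩
  obtain ⟨V, h1, h2, h3⟩ := loc_fin (E := fun e : t => D e) (φ := φ) (fun i j => by
    have := hspan ⁅(j : L), (i : L)⁆
    rw [hV.br] at this
    exact this) (fun i => ln_all hV (ht i.2) hm φ)
  refine ⟨V, h1, h2, fun z x hx => ?_⟩
  have : ∀ F ∈ Submodule.span ℂ (Set.range (fun e : t => D e)), F x ∈ V := by
    intro F hF
    induction hF using Submodule.span_induction with
    | mem f hf =>
      obtain ⟨i, rfl⟩ := hf
      exact h3 i x hx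
    | zero => simp
    | add f g _ _ hf hg => exact V.add_mem hf hg
    | smul c f _ hf => exact V.smul_mem c hf
  exact this _ (hspan z)

theorem loc_fin_all (hV : VF D) (hm : m ≠ 0) (T : Submodule ℂ (Reg (Og s₂ p₂ q r m))) (hT : T.FG) :
    ∃ V : Submodule ℂ (Reg (Og s₂ p₂ q r m)), V.FG ∧ T ≤ V ∧ ∀ z, ∀ x ∈ V, D z x ∈ V := by
  induction T, hT using Submodule.fg_induction with
  | singleton φ =>
    obtain ⟨V, h1, h2, h3⟩ := loc_fin_one hV hm φ
    exact ⟨V, h1, (Submodule.span_singleton_le_iff_mem _ _).2 h2, h3⟩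
  | sup T T' _ _ h h' =>
    obtain ⟨V, h1, h2, h3⟩ := h
    obtain ⟨V', h1', h2', h3'⟩ := h'
    refine ⟨V ⊔ V', h1.sup h1', sup_le_sup h2 h2', fun z x hx => ?_⟩
    obtain ⟨a, ha, b, hb, rfl⟩ := Submodule.mem_sup.1 hx
    rw [map_add]
    exact Submodule.add_mem_sup (h3 z a ha) (h3' z b hb)

end setup
end Dis
end

section
open Module LieAlgebra
set_option linter.unusedSectionVars false

namespace Dis
universe u

section coh
variable {L : Type u} [LieRing L] [LieAlgebra ℂ L] [Module.Finite ℂ L] [HasTrivialRadical ℂ L]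
variable {M : Type*} [AddCommGroup M] [Module ℂ M] [Module.Finite ℂ M]
variable (ρ : L →ₗ[ℂ] End ℂ M)

/-- the coboundary of a 1-cochain -/
noncomputable def dOne : (L →ₗ[ℂ] M) →ₗ[ℂ] (L →ₗ[ℂ] L →ₗ[ℂ] M) where
  toFun η := LinearMap.mk₂ ℂ (fun u v => ρ u (η v) - ρ v (η u) - η ⁅u, v⁆)
    (fun a b c => by simp only [map_add, LinearMap.add_apply, add_lie]; abel)
    (fun k a b => by simp only [map_smul, LinearMap.smul_apply, smul_lie, smul_sub])
    (fun a b c => by simp only [map_add, LinearMap.add_apply, lie_add]; abel)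
    (fun k a b => by simp only [map_smul, LinearMap.smul_apply, lie_smul, smul_sub])
  map_add' η η' := by
    ext u v; simp only [LinearMap.mk₂_apply, LinearMap.add_apply, map_add]; abel
  map_smul' k η := by
    ext u v; simp only [LinearMap.mk₂_apply, LinearMap.smul_apply, map_smul, smul_sub, RingHom.id_apply]

lemma dOne_apply (η : L →ₗ[ℂ] M) (u v : L) :
    dOne ρ η u v = ρ u (η v) - ρ v (η u) - η ⁅u, v⁆ := rfl

/-- the representation on 2-cochains -/
noncomputable def cTwo : L →ₗ[ℂ] End ℂ (L →ₗ[ℂ] L →ₗ[ℂ] M) := homRep (adL L) (homRep (adL L) ρ)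

lemma cTwo_apply (z : L) (ω : L →ₗ[ℂ] L →ₗ[ℂ] M) (u v : L) :
    cTwo ρ z ω u v = ρ z (ω u v) - ω u ⁅z, v⁆ - ω ⁅z, u⁆ v := rfl

/-- alternating closed 2-cochains -/
def zTwo : Submodule ℂ (L →ₗ[ℂ] L →ₗ[ℂ] M) where
  carrier := {ω | (∀ u v, ω u v = - ω v u) ∧ ∀ z u v : L, ρ z (ω u v) + ρ u (ω v z) + ρ v (ω z u) =
    ω ⁅z, u⁆ v + ω ⁅u, v⁆ z + ω ⁅v, z⁆ u}
  add_mem' := by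
    rintro a b ⟨h1, h2⟩ ⟨h3, h4⟩
    refine ⟨fun u v => ?_, fun z u v => ?_⟩
    · simp only [LinearMap.add_apply]; rw [h1, h3]; abel
    · simp only [LinearMap.add_apply, map_add]
      rw [← sub_eq_zero]
      have := congrArg₂ (· + ·) (sub_eq_zero.2 (h2 z u v)) (sub_eq_zero.2 (h4 z u v))
      rw [add_zero] at this
      rw [← this]
      abel
  zero_mem' := ⟨fun u v => by simp, fun z u v => by simp⟩
  smul_mem' := by
    rintro c a ⟨h1, h2⟩
    refine ⟨fun u v => ?_, fun z u v => ?_⟩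
    · simp only [LinearMap.smul_apply]; rw [h1, smul_neg]
    · simp only [LinearMap.smul_apply, map_smul, ← smul_add, h2]

variable {ρ}
lemma dOne_mem (hρ : IsRep ρ) (η : L →ₗ[ℂ] M) : dOne ρ η ∈ zTwo ρ := by
  refine ⟨fun u v => ?_, fun z u v => ?_⟩
  · simp only [dOne_apply]
    rw [← lie_skew v u, map_neg]
    abel
  · simp only [dOne_apply]
    have j : ⁅⁅z, u⁆, v⁆ + ⁅⁅u, v⁆, z⁆ + ⁅⁅v, z⁆, u⁆ = 0 := by
      rw [← lie_skew ⁅z, u⁆ v, ← lie_skew ⁅u, v⁆ z, ← lie_skew ⁅v, z⁆ u, ← neg_add, ← neg_add, neg_eq_zero]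
      have := lie_jacobi z u v
      rw [← this]
      abel
    have j' := congrArg η j
    rw [map_add, map_add, map_zero] at j'
    simp only [hρ.apply, map_sub]
    rw [← sub_eq_zero, ← j']
    abel

lemma cTwo_z (ω : L →ₗ[ℂ] L →ₗ[ℂ] M) (h : ω ∈ zTwo ρ) (z : L) : cTwo ρ z ω = dOne ρ (ω z) := by
  obtain ⟨h1, h2⟩ := h
  ext u v
  rw [cTwo_apply, dOne_apply, h1 u ⁅z, v⁆, ← lie_skew z v, map_neg, LinearMap.neg_apply]
  have h3 := h2 z u v
  rw [h1 v z, h1 _ z, map_neg] at h3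
  rw [← sub_eq_zero] at h3 ⊢
  rw [← h3]
  abel

lemma dOne_eq (hρ : IsRep ρ) (z : L) (η : L →ₗ[ℂ] M) :
    cTwo ρ z (dOne ρ η) = dOne ρ (homRep (adL L) ρ z η) := by
  have e : ∀ u, homRep (adL L) ρ z η u = ρ z (η u) - η ⁅z, u⁆ := fun u => rfl
  ext u v
  rw [cTwo_apply]
  simp only [dOne_apply, e, map_sub, hρ.apply]
  have := congrArg η (leibniz_lie z u v)
  rw [map_add] at this
  rw [this]
  abel

lemma isRep_cTwo (hρ : IsRep ρ) : IsRep (cTwo ρ) := isRep_hom isRep_ad (isRep_hom isRep_ad hρ)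

lemma inv_exact (hρ : IsRep ρ) (ω : L →ₗ[ℂ] L →ₗ[ℂ] M) (h : ω ∈ zTwo ρ) (hi : ∀ z, cTwo ρ z ω = 0) :
    ∃ η, ω = dOne ρ η := by
  obtain ⟨h1, h2⟩ := h
  have hi' : ∀ z u v, ρ z (ω u v) = ω u ⁅z, v⁆ + ω ⁅z, u⁆ v := by
    intro z u v
    have := LinearMap.congr_fun (LinearMap.congr_fun (hi z) u) v
    rw [cTwo_apply, sub_sub] at this
    exact sub_eq_zero.1 this
  have h3 : ∀ z u v, ρ z (ω u v) = ω z ⁅u, v⁆ := by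
    intro z u v
    have h4 := h2 z u v
    rw [hi', hi', hi', h1 u ⁅z, v⁆, h1 v ⁅u, z⁆, h1 z ⁅v, u⁆, ← lie_skew z v, ← lie_skew u z,
      ← lie_skew v u] at h4
    simp only [map_neg, LinearMap.neg_apply, neg_neg] at h4
    rw [hi', h1 u ⁅z, v⁆, h1 z ⁅u, v⁆, ← lie_skew z v]
    simp only [map_neg, LinearMap.neg_apply, neg_neg]
    rw [← sub_eq_zero] at h4 ⊢
    rw [← h4]
    abel
  obtain ⟨p, hp1, hp2, hp3, hp4⟩ := exists_pr ρ hρ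
  have hpω : ∀ z t, p (ω z t) = 0 := by
    intro z t
    have : LinearMap.ker (p ∘ₗ ω z) = ⊤ := perfect fun u v => by
      rw [LinearMap.mem_ker, LinearMap.comp_apply, ← h3, hp3]
    exact LinearMap.congr_fun (LinearMap.ker_eq_top.1 this) t
  let G : Submodule ℂ (L × M) := Submodule.span ℂ {a | ∃ u v : L, a = (⁅u, v⁆, ω u v)}
  have hG : ∀ a ∈ G, (∀ z, ρ z a.2 = ω z a.1) ∧ p a.2 = 0 := by
    intro a ha
    induction ha using Submodule.span_induction with
    | mem x hx =>
      obtain ⟨u, v, rfl⟩ := hx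
      exact ⟨fun z => h3 _ _ _, hpω _ _⟩
    | zero => simp
    | add x y _ _ hx hy =>
      exact ⟨fun z => by rw [Prod.fst_add, Prod.snd_add, map_add, map_add, hx.1, hy.1],
        by rw [Prod.snd_add, map_add, hx.2, hy.2, add_zero]⟩
    | smul c x _ hx =>
      exact ⟨fun z => by rw [Prod.smul_fst, Prod.smul_snd, map_smul, map_smul, hx.1],
        by rw [Prod.smul_snd, map_smul, hx.2, smul_zero]⟩
  have hG0 : ∀ n, ((0 : L), n) ∈ G → n = 0 := by
    intro n hn
    obtain ⟨a, b⟩ := hG _ hn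
    rw [← b]
    exact (hp2 n fun z => by rw [a z]; exact map_zero _).symm
  have huniq : ∀ t n n', (t, n) ∈ G → (t, n') ∈ G → n = n' := by
    intro t n n' hn hn'
    have := G.sub_mem hn hn'
    rw [Prod.mk_sub_mk, sub_self] at this
    exact sub_eq_zero.1 (hG0 _ this)
  have hex : ∀ t, ∃ n, (t, n) ∈ G := by
    have : G.map (LinearMap.fst ℂ L M) = ⊤ := perfect fun u v =>
      ⟨(⁅u, v⁆, ω u v), Submodule.subset_span ⟨u, v, rfl⟩, rfl⟩
    intro t
    have ht : t ∈ G.map (LinearMap.fst ℂ L M) := by rw [this]; trivial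
    obtain ⟨⟨a, b⟩, h, rfl⟩ := ht
    exact ⟨b, h⟩
  choose f hf using hex
  let η : L →ₗ[ℂ] M :=
    { toFun := f
      map_add' := fun a b => huniq _ _ _ (hf _) (G.add_mem (hf a) (hf b))
      map_smul' := fun c a => huniq _ _ _ (hf _) (G.smul_mem c (hf a)) }
  refine ⟨η, ?_⟩
  ext u v
  rw [dOne_apply]
  have e1 : η ⁅u, v⁆ = ω u v := huniq _ _ _ (hf _) (Submodule.subset_span ⟨u, v, rfl⟩)
  have e2 : ∀ z t, ρ z (η t) = ω z t := fun z t => (hG _ (hf t)).1 z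
  rw [e1, e2, e2, h1 v u]
  abel

theorem exact_two (hρ : IsRep ρ) (ω : L →ₗ[ℂ] L →ₗ[ℂ] M) (h : ω ∈ zTwo ρ) : ∃ η, ω = dOne ρ η := by
  have hst : ∀ x, ∀ w ∈ zTwo ρ, cTwo ρ x w ∈ zTwo ρ := fun x w hw => by
    rw [cTwo_z w hw]; exact dOne_mem hρ _
  have : Module.Finite ℂ (L →ₗ[ℂ] L →ₗ[ℂ] M) := inferInstance
  have : Module.Finite ℂ (zTwo ρ) := inferInstance
  obtain ⟨P, h1, h2, h3, h4⟩ := exists_pr (M := zTwo ρ) (rrestr (cTwo ρ) (zTwo ρ) hst) ((isRep_cTwo hρ).restr _ hst)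
  obtain ⟨η, hη⟩ := inv_exact hρ (P ⟨ω, h⟩).1 (P ⟨ω, h⟩).2 (fun z => congrArg Subtype.val (h1 z ⟨ω, h⟩))
  have h5 : rimg (M := zTwo ρ) (rrestr (cTwo ρ) (zTwo ρ) hst) ≤
      (LinearMap.range (dOne ρ)).comap (zTwo ρ).subtype := rimg_le fun x (w : zTwo ρ) => by
    change cTwo ρ x w.1 ∈ LinearMap.range (dOne ρ)
    rw [cTwo_z w.1 w.2]
    exact ⟨_, rfl⟩
  obtain ⟨η', hη'⟩ := h5 (h4 ⟨ω, h⟩)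
  change dOne ρ η' = ω - (P ⟨ω, h⟩).1 at hη'
  refine ⟨η + η', ?_⟩
  rw [map_add, hη', ← hη]
  abel

theorem exists_eta (hρ : IsRep ρ) (ω : L →ₗ[ℂ] L →ₗ[ℂ] M) (h : ω ∈ zTwo ρ) (s : LieSubalgebra ℂ L)
    [HasTrivialRadical ℂ s] (hs : ∀ c ∈ s, cTwo ρ c ω = 0) :
    ∃ η, ω = dOne ρ η ∧ ∀ c ∈ s, ∀ u, ρ c (η u) = η ⁅c, u⁆ := by
  obtain ⟨η, rfl⟩ := exact_two hρ ω h
  have hr := (isRep_hom (isRep_ad (g := L)) hρ).sub s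
  obtain ⟨P, h1, h2, h3, h4⟩ := exists_pr (subRep s (homRep (adL L) ρ)) hr
  have hinv : ∀ c ∈ s, homRep (adL L) ρ c (P η) = 0 := fun c hc => h1 ⟨c, hc⟩ η
  refine ⟨P η, ?_, fun c hc u => sub_eq_zero.1 (LinearMap.congr_fun (hinv c hc) u)⟩
  have hd := (weyl _ (subRep s (cTwo ρ)) ((isRep_cTwo hρ).sub s) rfl).disjoint
  rw [← sub_eq_zero]
  refine Submodule.disjoint_def.1 hd _ (mem_rinv.2 fun c => ?_) ?_
  · rw [subRep_apply, map_sub, hs c c.2, dOne_eq hρ, hinv c c.2, map_zero, sub_zero]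
  · rw [← map_sub]
    have : rimg (subRep s (homRep (adL L) ρ)) ≤ (rimg (subRep s (cTwo ρ))).comap (dOne ρ) :=
      rimg_le fun c w => by
        rw [Submodule.mem_comap, subRep_apply, ← dOne_eq hρ]
        exact mem_rimg (subRep s (cTwo ρ)) c _
    exact this (h4 η)

end coh
end Dis
end

section
open Module LieAlgebra
set_option linter.unusedSectionVars false

namespace Dis
universe u

section fin
variable {L : Type u} [LieRing L] [LieAlgebra ℂ L] [Module.Finite ℂ L] [HasTrivialRadical ℂ L]
variable {s₂ : LieSubalgebra ℂ L} {p₂ : End ℂ L} {q r m : Polynomial ℂ}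
variable {D : L →ₗ[ℂ] (Reg (Og s₂ p₂ q r m) →ₗ[ℂ] Reg (Og s₂ p₂ q r m))}

/-- the pointwise form -/
noncomputable def Fo (o : Og s₂ p₂ q r m) : L →ₗ[ℂ] L →ₗ[ℂ] ℂ :=
  ((brk (L := L)).compl₁₂ (tau o) (tau o)).compr₂ (killingForm ℂ L o.1.2)

lemma Fo_apply (o : Og s₂ p₂ q r m) (z z' : L) :
    Fo o z z' = killingForm ℂ L o.1.2 ⁅tau o z, tau o z'⁆ := rfl

lemma Fo_skew (o : Og s₂ p₂ q r m) (z z' : L) : Fo o z z' = - Fo o z' z := by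
  rw [Fo_apply, Fo_apply, ← map_neg, lie_skew]

lemma kf_Kw {o : Og s₂ p₂ q r m} {κ : L} (h : κ ∈ Kw o) (X : L) :
    killingForm ℂ L o.1.2 ⁅κ, X⁆ = 0 := by
  rw [← kf_lie, ← lie_skew, Kw_y h, neg_zero, map_zero, LinearMap.zero_apply]

lemma Fo_eq (h2 : IsOProj s₂.toSubmodule p₂) (o : Og s₂ p₂ q r m) {z z' a a' : L} (ha : a ∈ s₂)
    (ha' : a' ∈ s₂) (h : z - a ∈ LinearMap.range o.1.1) (h' : z' - a' ∈ LinearMap.range o.1.1) :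
    Fo o z z' = killingForm ℂ L o.1.2 ⁅a, a'⁆ := by
  have key : ∀ z a : L, a ∈ s₂ → z - a ∈ LinearMap.range o.1.1 → tau o z - a ∈ Kw o := by
    intro z a ha h
    refine ⟨s₂.sub_mem (tau_mem h2 o z) ha, ?_⟩
    have := Submodule.sub_mem _ h (tau_diff' o z)
    rwa [sub_sub_sub_cancel_left] at this
  have k1 := kf_Kw (key z a ha h) (tau o z')
  have k2 := kf_Kw (key z' a' ha' h') a
  rw [sub_lie, map_sub, sub_eq_zero] at k1 k2
  rw [Fo_apply, k1, ← lie_skew, map_neg, k2, ← map_neg, lie_skew]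

lemma av_F (z z' : L) : AV (fun o : Og s₂ p₂ q r m => Fo o z z') :=
  av_y.bilin ((av_tau_app z).bilin (av_tau_app z') brk) (killingForm ℂ L)

lemma vd_F (hV : VF D) (u z z' : L) : VD (D u) (fun o => Fo o z z')
    (fun o => - (Fo o ⁅tau o u, z⁆ z' + Fo o z ⁅tau o u, z'⁆)) := by
  have h1 := fun z => (hV.t u).app (hV.leib u) (VD.const (hV.leib u) z)
  have h3 := (hV.y u).bilin (hV.leib u) ((h1 z).bilin (hV.leib u) (h1 z') brk) (killingForm ℂ L)
  refine h3.congr fun o => ?_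
  simp only [Fo_apply, brk_apply, map_zero, add_zero, LinearMap.sub_apply, Module.End.mul_apply, ad_apply]
  rw [← lie_skew (tau o u) o.1.2, map_neg, LinearMap.neg_apply, kf_lie, leibniz_lie (tau o u)]
  simp only [sub_lie, lie_sub, map_add, map_sub]
  ring

/-- the 2-cochain with values in regular functions -/
noncomputable def omR : L →ₗ[ℂ] L →ₗ[ℂ] Reg (Og s₂ p₂ q r m) :=
  LinearMap.mk₂ ℂ (fun z z' => ⟨_, av_F z z' LinearMap.id⟩)
    (fun a b c => Subtype.ext (funext fun o => by
      change Fo o (a + b) c = Fo o a c + Fo o b c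
      rw [map_add, LinearMap.add_apply]))
    (fun k a b => Subtype.ext (funext fun o => by
      change Fo o (k • a) b = k * Fo o a b
      rw [map_smul]; rfl))
    (fun a b c => Subtype.ext (funext fun o => by
      change Fo o a (b + c) = Fo o a b + Fo o a c
      rw [map_add]))
    (fun k a b => Subtype.ext (funext fun o => by
      change Fo o a (k • b) = k * Fo o a b
      rw [map_smul]; rfl))

lemma omR_val (o : Og s₂ p₂ q r m) (z z' : L) : (omR z z' : Reg (Og s₂ p₂ q r m)).1 o = Fo o z z' := rfl

lemma D_omR (hV : VF D) (o : Og s₂ p₂ q r m) (u z z' : L) :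
    (-(D u (omR z z'))).1 o = Fo o ⁅tau o u, z⁆ z' + Fo o z ⁅tau o u, z'⁆ := by
  have := (vd_F hV u z z').eq LinearMap.id (av_F z z' LinearMap.id) ((vd_F hV u z z').av' _)
  have h2 := congrFun (congrArg Subtype.val this) o
  change - ((D u (omR z z')).1 o) = _
  rw [neg_eq_iff_eq_neg]
  exact h2

lemma om_closed (h2 : IsOProj s₂.toSubmodule p₂) (hV : VF D) (z u v : L) :
    -(D z (omR u v)) + -(D u (omR v z)) + -(D v (omR z u)) =
      omR ⁅z, u⁆ v + omR ⁅u, v⁆ z + omR ⁅v, z⁆ u := by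
  refine Subtype.ext (funext fun o => ?_)
  change (-(D z (omR u v))).1 o + (-(D u (omR v z))).1 o + (-(D v (omR z u))).1 o =
    Fo o ⁅z, u⁆ v + Fo o ⁅u, v⁆ z + Fo o ⁅v, z⁆ u
  rw [D_omR hV, D_omR hV, D_omR hV]
  have key : ∀ a b c : L, Fo o ⁅tau o a, b⁆ c - Fo o ⁅tau o b, a⁆ c - Fo o ⁅a, b⁆ c =
      killingForm ℂ L o.1.2 ⁅⁅tau o a, tau o b⁆, tau o c⁆ := by
    intro a b c
    rw [← LinearMap.sub_apply, ← LinearMap.sub_apply, ← map_sub, ← map_sub]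
    refine Fo_eq h2 o (s₂.lie_mem (tau_mem h2 o a) (tau_mem h2 o b)) (tau_mem h2 o c) ?_ (tau_diff' o c)
    have := Submodule.neg_mem _ (im_lie o (tau_diff' o a) (tau_diff' o b))
    convert this using 1
    simp only [lie_sub, sub_lie]
    rw [← lie_skew (tau o b) a]
    abel
  have k1 := key z u v
  have k2 := key u v z
  have k3 := key v z u
  have j : killingForm ℂ L o.1.2 ⁅⁅tau o z, tau o u⁆, tau o v⁆ +
      killingForm ℂ L o.1.2 ⁅⁅tau o u, tau o v⁆, tau o z⁆ +
      killingForm ℂ L o.1.2 ⁅⁅tau o v, tau o z⁆, tau o u⁆ = 0 := by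
    rw [← map_add, ← map_add]
    have : ⁅⁅tau o z, tau o u⁆, tau o v⁆ + ⁅⁅tau o u, tau o v⁆, tau o z⁆ +
        ⁅⁅tau o v, tau o z⁆, tau o u⁆ = 0 := by
      rw [← lie_skew ⁅tau o z, tau o u⁆, ← lie_skew ⁅tau o u, tau o v⁆, ← lie_skew ⁅tau o v, tau o z⁆,
        ← neg_add, ← neg_add, neg_eq_zero]
      have := lie_jacobi (tau o z) (tau o u) (tau o v)
      rw [← this]
      abel
    rw [this, map_zero]
  rw [Fo_skew o u ⁅tau o z, v⁆, Fo_skew o v ⁅tau o u, z⁆, Fo_skew o z ⁅tau o v, u⁆]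
  linear_combination k1 + k2 + k3 + j

lemma om_inv (h2 : IsOProj s₂.toSubmodule p₂) (hV : VF D) (c u v : L) (hc : c ∈ s₂) :
    -(D c (omR u v)) = omR u ⁅c, v⁆ + omR ⁅c, u⁆ v := by
  refine Subtype.ext (funext fun o => ?_)
  change _ = Fo o u ⁅c, v⁆ + Fo o ⁅c, u⁆ v
  rw [D_omR hV]
  set κ := c - tau o c with hκ
  have hk : κ ∈ Kw o := tau_s2 h2 o c hc
  have key : ∀ z, ⁅κ, z⁆ - ⁅κ, tau o z⁆ ∈ LinearMap.range o.1.1 := by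
    intro z
    rw [← lie_sub]
    exact im_lie o hk.2 (tau_diff' o z)
  have e1 := Fo_eq h2 o (s₂.lie_mem hk.1 (tau_mem h2 o u)) (tau_mem h2 o v) (key u) (tau_diff' o v)
  have e2 := Fo_eq h2 o (tau_mem h2 o u) (s₂.lie_mem hk.1 (tau_mem h2 o v)) (tau_diff' o u) (key v)
  have e3 := kf_Kw hk ⁅tau o u, tau o v⁆
  rw [leibniz_lie, map_add, ← e1, ← e2, hκ] at e3
  simp only [sub_lie, map_sub, LinearMap.sub_apply] at e3
  linear_combination - e3

lemma D_base (h2 : IsOProj s₂.toSubmodule p₂) (hV : VF D) (o : Og s₂ p₂ q r m) (z : L)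
    (hz : z ∈ LinearMap.range o.1.1) (φ : Reg (Og s₂ p₂ q r m)) : (D z φ).1 o = 0 := by
  have : LinearMap.ker ((evR o).toLinearMap ∘ₗ D z) = ⊤ := by
    refine reg_induct ?_ fun a ha ℓ => ?_
    · rw [LinearMap.mem_ker, LinearMap.comp_apply, (hV.leib z).one, map_zero]
    · rw [LinearMap.mem_ker, LinearMap.comp_apply] at ha ⊢
      rw [hV.leib z, map_add]
      have ha' : evR o (D z a) = 0 := ha
      change evR o (a * D z _) + evR o (D z a * _) = 0
      rw [map_mul, map_mul, ha', zero_mul, add_zero, split_lin, map_add,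
        (hV.w z).eq _ _ ((hV.w z).av' _), (hV.y z).eq _ _ ((hV.y z).av' _), map_add]
      change a.1 o * ((ℓ ∘ₗ LinearMap.inl ℂ _ _) (ad ℂ L z * o.1.1 - o.1.1 * ad ℂ L z) +
        (ℓ ∘ₗ LinearMap.inr ℂ _ _) ⁅tau o z, o.1.2⁆) = 0
      rw [Im_w hz, Kw_y (tau_im h2 o z hz), map_zero, map_zero, add_zero, mul_zero]
  exact LinearMap.congr_fun (LinearMap.ker_eq_top.1 this) φ

lemma perfect_sub (s : LieSubalgebra ℂ L) [HasTrivialRadical ℂ s] (f : L →ₗ[ℂ] ℂ)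
    (h : ∀ u ∈ s, ∀ v ∈ s, f ⁅u, v⁆ = 0) (c : L) (hc : c ∈ s) : f c = 0 := by
  have : LinearMap.ker (f ∘ₗ s.toSubmodule.subtype) = ⊤ := perfect (g := s) fun u v => by
    rw [LinearMap.mem_ker]
    exact h u u.2 v v.2
  exact LinearMap.congr_fun (LinearMap.ker_eq_top.1 this) ⟨c, hc⟩

/-- the vanishing theorem for a module which is locally finite around the cochain -/
theorem abs_eta {M : Type*} [AddCommGroup M] [Module ℂ M] (ρ : L →ₗ[ℂ] End ℂ M) (hρ : IsRep ρ)
    (V : Submodule ℂ M) (hVf : V.FG) (hst : ∀ z, ∀ x ∈ V, ρ z x ∈ V) (om : L →ₗ[ℂ] L →ₗ[ℂ] M)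
    (hom : ∀ z z', om z z' ∈ V) (hsk : ∀ u v, om u v = - om v u)
    (hcl : ∀ z u v : L, ρ z (om u v) + ρ u (om v z) + ρ v (om z u) =
      om ⁅z, u⁆ v + om ⁅u, v⁆ z + om ⁅v, z⁆ u) (s : LieSubalgebra ℂ L) [HasTrivialRadical ℂ s]
    (hin : ∀ c ∈ s, ∀ u v, ρ c (om u v) = om u ⁅c, v⁆ + om ⁅c, u⁆ v) :
    ∃ η : L →ₗ[ℂ] M, (∀ z z', om z z' = ρ z (η z') - ρ z' (η z) - η ⁅z, z'⁆) ∧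
      ∀ c ∈ s, ∀ u, ρ c (η u) = η ⁅c, u⁆ := by
  have hfin : Module.Finite ℂ V := Module.Finite.iff_fg.2 hVf
  let ω : L →ₗ[ℂ] L →ₗ[ℂ] V := LinearMap.mk₂ ℂ (fun z z' => ⟨om z z', hom z z'⟩)
    (fun a b c => Subtype.ext (LinearMap.map_add₂ om a b c))
    (fun k a b => Subtype.ext (LinearMap.map_smul₂ om k a b))
    (fun a b c => Subtype.ext (map_add (om a) b c))
    (fun k a b => Subtype.ext (map_smul (om a) k b))
  have hω : ω ∈ zTwo (rrestr ρ V hst) :=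
    ⟨fun u v => Subtype.ext (hsk u v), fun z u v => Subtype.ext (hcl z u v)⟩
  have hinv : ∀ c ∈ s, cTwo (rrestr ρ V hst) c ω = 0 := by
    intro c hc
    ext u v : 2
    rw [cTwo_apply, sub_sub]
    exact sub_eq_zero.2 (Subtype.ext (hin c hc u v))
  obtain ⟨η, hη, hη2⟩ := exists_eta (hρ.restr V hst) ω hω s hinv
  refine ⟨V.subtype ∘ₗ η, fun z z' => ?_, fun c hc u => congrArg Subtype.val (hη2 c hc u)⟩
  exact congrArg Subtype.val (LinearMap.congr_fun (LinearMap.congr_fun hη z) z')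

theorem base_zero (h2 : IsOProj s₂.toSubmodule p₂) (s₁ : LieSubalgebra ℂ L) [HasTrivialRadical ℂ s₁]
    [HasTrivialRadical ℂ s₂] (hm : m ≠ 0) (o : Og s₂ p₂ q r m)
    (hs : ∀ z ∈ s₁, z ∈ LinearMap.range o.1.1) (κ : L) (h1 : κ ∈ s₁) (h2' : κ ∈ s₂) :
    killingForm ℂ L o.1.2 κ = 0 := by
  obtain ⟨D, hV⟩ := exists_VF (q := q) (r := r) (m := m) h2
  let T : Submodule ℂ (Reg (Og s₂ p₂ q r m)) :=
    LinearMap.range (TensorProduct.lift (omR (L := L) (s₂ := s₂) (p₂ := p₂) (q := q) (r := r) (m := m)))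
  have hT : T.FG := by
    rw [← Module.Finite.iff_fg]
    exact Module.Finite.range _
  obtain ⟨V, hVf, hTV, hst⟩ := loc_fin_all hV hm T hT
  have hωV : ∀ z z', omR z z' ∈ V := fun z z' => hTV ⟨z ⊗ₜ z', TensorProduct.lift.tmul _ _⟩
  let D' : L →ₗ[ℂ] End ℂ (Reg (Og s₂ p₂ q r m)) :=
    { toFun := fun z => (-1 : ℂ) • D z
      map_add' := fun a b => by rw [map_add, smul_add]
      map_smul' := fun k a => by rw [map_smul, smul_comm]; rfl }
  have hD' : ∀ z x, D' z x = -(D z x) := fun z x => by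
    change (-1 : ℂ) • D z x = _
    rw [neg_smul, one_smul]
  have hrep : IsRep D' := by
    intro a b
    refine LinearMap.ext fun x => ?_
    rw [hD', hV.br, LinearMap.sub_apply, LinearMap.sub_apply, Module.End.mul_apply, Module.End.mul_apply,
      hD', hD', hD', hD', map_neg, map_neg, neg_neg, neg_neg, neg_sub]
    rfl
  have hst' : ∀ z, ∀ x ∈ V, D' z x ∈ V := fun z x hx => by
    rw [hD']
    exact V.neg_mem (hst z x hx)
  obtain ⟨η, hη, hη2⟩ := abs_eta D' hrep V hVf hst' omR hωV
    (fun u v => Subtype.ext (funext fun o => Fo_skew o u v))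
    (fun z u v => by
      rw [hD', hD', hD']
      exact om_closed h2 hV z u v) s₂
    (fun c hc u v => by
      rw [hD']
      exact om_inv h2 hV c u v hc)
  let f : L →ₗ[ℂ] ℂ := (evR o).toLinearMap ∘ₗ η
  have hε : ∀ z ∈ s₁, ∀ x, (D' z x).1 o = 0 := by
    intro z hz x
    rw [hD']
    change - (D z x).1 o = 0
    rw [D_base h2 hV o z (hs z hz), neg_zero]
  have hf : ∀ z z', Fo o z z' = (D' z (η z')).1 o - (D' z' (η z)).1 o - f ⁅z, z'⁆ := by
    intro z z'
    exact congrFun (congrArg Subtype.val (hη z z')) o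
  have hf1 : f κ = 0 := by
    refine perfect_sub s₁ f (fun u hu v hv => ?_) κ h1
    have := hf u v
    rw [hε u hu, hε v hv, Fo_apply, kf_Kw (tau_im h2 o u (hs u hu))] at this
    linear_combination this
  have hf2 : (f - killingForm ℂ L o.1.2) κ = 0 := by
    refine perfect_sub s₂ _ (fun u hu v hv => ?_) κ h2'
    have := hf u v
    rw [hη2 u hu, hη2 v hv] at this
    have e : ∀ t, (η t).1 o = f t := fun t => rfl
    rw [e, e, ← lie_skew v u, map_neg, Fo_eq h2 o hu hv (by rw [sub_self]; exact Submodule.zero_mem _)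
      (by rw [sub_self]; exact Submodule.zero_mem _)] at this
    rw [LinearMap.sub_apply]
    linear_combination - this
  rw [LinearMap.sub_apply, hf1, zero_sub, neg_eq_zero] at hf2
  exact hf2

theorem main (s₁ s₂ : LieSubalgebra ℂ L) [HasTrivialRadical ℂ s₁] [HasTrivialRadical ℂ s₂]
    (hsum : ∀ z : L, ∃ x ∈ s₁, ∃ y ∈ s₂, z = x + y) : HasTrivialRadical ℂ ↥(s₁ ⊓ s₂) := by
  obtain ⟨p₁, h1⟩ := exists_isOProj s₁
  obtain ⟨p₂, h2⟩ := exists_isOProj s₂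
  refine radical_of_center s₁ h1 h2 hsum fun x hx hxc => ?_
  obtain ⟨hnd, hg⟩ := good_base s₁ h1 h2 hsum
  obtain ⟨q, r, m, hm, hG⟩ := hg x hx hxc
  refine hnd x hx fun κ hκ => ?_
  obtain ⟨k1, k2⟩ := (LieSubalgebra.mem_inf _ _ _).1 hκ
  exact base_zero h2 s₁ hm (⟨(p₁, x), hG⟩ : Og s₂ p₂ q r m)
    (fun z hz => ⟨z, h1.fix hz⟩) κ k1 k2

end fin
end Dis
end

/-- Let `L` be a finite-dimensional complex semisimple Lie algebra
(no nonzero solvable ideals) which is disemisimple, i.e. `L = s₁ + s₂` is the vector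
space sum of two semisimple subalgebras `s₁` and `s₂`. Then the subalgebra `s₁ ∩ s₂`
is zero or semisimple. -/
theorem semisimple_disemisimple_inter_semisimple_or_bot
    {L : Type*} [LieRing L] [LieAlgebra ℂ L] [Module.Finite ℂ L]
    (hL : LieAlgebra.HasTrivialRadical ℂ L)
    (s₁ s₂ : LieSubalgebra ℂ L)
    (h₁ : LieAlgebra.HasTrivialRadical ℂ s₁)
    (h₂ : LieAlgebra.HasTrivialRadical ℂ s₂)
    (hsum : s₁.toSubmodule ⊔ s₂.toSubmodule = ⊤) :
    s₁ ⊓ s₂ = ⊥ ∨ LieAlgebra.HasTrivialRadical ℂ ↥(s₁ ⊓ s₂) := by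
  right
  refine Dis.main s₁ s₂ fun z => ?_
  have hz : z ∈ s₁.toSubmodule ⊔ s₂.toSubmodule := by rw [hsum]; trivial
  obtain ⟨x, hx, y, hy, rfl⟩ := Submodule.mem_sup.1 hz
  exact ⟨x, hx, y, hy, rfl⟩
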